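/- arXiv:1411.4637 — 2 statements merged into one kernel-verified Lean document; each statement's English description precedes it below -/
import Mathlib

section
/- Let Ω ⊂ ℝⁿ be an open set with 0 ∈ ∂Ω, and suppose there is ρ > 0 with B_ρ(ρe₁) ⊂ Ω. Let f be bounded measurable and let u be a nonnegative Lipschitz function on B₂ ∩ Ω̄ satisfying 𝓛u = f weakly in B₂ ∩ Ω and u = 0 on ∂Ω ∩ B₂. Then there exists α ≥ 0 such that u(x) = αx₁ + o(|x|) as x → 0 with x ∈ B_ρ(ρe₁), i.e. (u(x) − αx₁)/|x| → 0 as x → 0 within the ball B_ρ(ρe₁). -/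
open Set Filter MeasureTheory Metric Bornology
open scoped Topology RealInnerProductSpace ENNReal NNReal

noncomputable section

/-- Euclidean space `ℝⁿ`. -/
abbrev EucSp (n : ℕ) := EuclideanSpace ℝ (Fin n)

variable {n : ℕ}

/-- Uniform ellipticity of the coefficient field `A` on the set `s`:
`λ|ξ|² ≤ ⟨A(x)ξ, ξ⟩ ≤ Λ|ξ|²`. -/
def IsElliptic (A : EucSp n → (EucSp n →L[ℝ] EucSp n)) (lam Lam : ℝ)
    (s : Set (EucSp n)) : Prop :=
  ∀ x ∈ s, ∀ ξ : EucSp n,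
    lam * ‖ξ‖ ^ 2 ≤ ⟪A x ξ, ξ⟫ ∧ ⟪A x ξ, ξ⟫ ≤ Lam * ‖ξ‖ ^ 2

/-- Symmetry of the coefficient field on `s`. -/
def IsSymmCoeff (A : EucSp n → (EucSp n →L[ℝ] EucSp n)) (s : Set (EucSp n)) : Prop :=
  ∀ x ∈ s, ∀ ξ η : EucSp n, ⟪A x ξ, η⟫ = ⟪ξ, A x η⟫

/-- `A` is Hölder continuous with exponent `γ` and seminorm at most `K` on `s`. -/
def HolderSemi (A : EucSp n → (EucSp n →L[ℝ] EucSp n)) (γ K : ℝ)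
    (s : Set (EucSp n)) : Prop :=
  ∀ x ∈ s, ∀ y ∈ s, ‖A x - A y‖ ≤ K * ‖x - y‖ ^ γ

/-- `v` is locally Lipschitz on the set `s`. -/
def LocLipOn (v : EucSp n → ℝ) (s : Set (EucSp n)) : Prop :=
  ∀ x ∈ s, ∃ K : ℝ≥0, ∃ t ∈ 𝓝[s] x, LipschitzOnWith K v t

/-- A test function for the weak formulation in the open set `D`:
smooth with compact support contained in `D`. -/
def IsTest (D : Set (EucSp n)) (φ : EucSp n → ℝ) : Prop :=
  ContDiff ℝ (⊤ : ℕ∞) φ ∧ HasCompactSupport φ ∧ tsupport φ ⊆ D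

/-- `𝓛 v = div(A ∇ v) = f` weakly in `D`:
`∫_D ⟨A(x)∇v, ∇φ⟩ = −∫_D f φ` for every test function `φ`. -/
def WeakEq (A : EucSp n → (EucSp n →L[ℝ] EucSp n)) (v f : EucSp n → ℝ)
    (D : Set (EucSp n)) : Prop :=
  ∀ φ : EucSp n → ℝ, IsTest D φ →
    ∫ x in D, ⟪A x (gradient v x), gradient φ x⟫ = - ∫ x in D, f x * φ x

/-- `𝓛 v ≥ f` weakly in `D`:
`∫_D ⟨A(x)∇v, ∇φ⟩ ≤ −∫_D f φ` for every nonnegative test function `φ`. -/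
def WeakGe (A : EucSp n → (EucSp n →L[ℝ] EucSp n)) (v f : EucSp n → ℝ)
    (D : Set (EucSp n)) : Prop :=
  ∀ φ : EucSp n → ℝ, IsTest D φ → (∀ x, 0 ≤ φ x) →
    ∫ x in D, ⟪A x (gradient v x), gradient φ x⟫ ≤ - ∫ x in D, f x * φ x

/-- `𝓛 v ≤ f` weakly in `D`:
`∫_D ⟨A(x)∇v, ∇φ⟩ ≥ −∫_D f φ` for every nonnegative test function `φ`. -/
def WeakLe (A : EucSp n → (EucSp n →L[ℝ] EucSp n)) (v f : EucSp n → ℝ)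
    (D : Set (EucSp n)) : Prop :=
  ∀ φ : EucSp n → ℝ, IsTest D φ → (∀ x, 0 ≤ φ x) →
    - ∫ x in D, f x * φ x ≤ ∫ x in D, ⟪A x (gradient v x), gradient φ x⟫

/-- The positive part `v⁺ = max(v, 0)`. -/
def PPart (v : EucSp n → ℝ) : EucSp n → ℝ := fun x => max (v x) 0

/-- The negative part `v⁻ = max(−v, 0)`. -/
def NPart (v : EucSp n → ℝ) : EucSp n → ℝ := fun x => max (-v x) 0

/-- The right-hand side `f·χ_{v<0}`. -/
def ChiNeg (f v : EucSp n → ℝ) : EucSp n → ℝ := fun x => if v x < 0 then f x else 0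

/-- `Ω⁺(v) = {x ∈ Ω : v(x) > 0}`. -/
def plusSet (Ω : Set (EucSp n)) (v : EucSp n → ℝ) : Set (EucSp n) :=
  {x ∈ Ω | 0 < v x}

/-- `Ω⁻(v)` = interior of `{x ∈ Ω : v(x) ≤ 0}`. -/
def minusSet (Ω : Set (EucSp n)) (v : EucSp n → ℝ) : Set (EucSp n) :=
  interior {x ∈ Ω | v x ≤ 0}

/-- The free boundary `F(v) = ∂{v > 0} ∩ Ω`. -/
def freeBdry (Ω : Set (EucSp n)) (v : EucSp n → ℝ) : Set (EucSp n) :=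
  frontier (plusSet Ω v) ∩ Ω

/-- `x₀ ∈ F(v)` is regular from the right, via the touching ball `B(y,r) ⊆ Ω⁺(v)`
with `B̄ ∩ F(v) = {x₀}`. -/
def TouchRight (Ω : Set (EucSp n)) (v : EucSp n → ℝ) (x₀ y : EucSp n) (r : ℝ) : Prop :=
  0 < r ∧ ball y r ⊆ plusSet Ω v ∧ closure (ball y r) ∩ freeBdry Ω v = {x₀}

/-- `x₀ ∈ F(v)` is regular from the left, via the touching ball `B(y,r) ⊆ Ω⁻(v)`
with `B̄ ∩ F(v) = {x₀}`. -/
def TouchLeft (Ω : Set (EucSp n)) (v : EucSp n → ℝ) (x₀ y : EucSp n) (r : ℝ) : Prop :=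
  0 < r ∧ ball y r ⊆ minusSet Ω v ∧ closure (ball y r) ∩ freeBdry Ω v = {x₀}

/-- The unit normal at `x₀` to a ball centered at `y` touching `F(v)` from the
right at `x₀`, pointing towards `Ω⁺(v)`, i.e. into the ball. -/
def nuRight (x₀ y : EucSp n) : EucSp n := ‖y - x₀‖⁻¹ • (y - x₀)

/-- The unit normal at `x₀` to a ball centered at `y` touching `F(v)` from the
left at `x₀`, pointing towards `Ω⁺(v)`, i.e. away from the ball. -/
def nuLeft (x₀ y : EucSp n) : EucSp n := ‖x₀ - y‖⁻¹ • (x₀ - y)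

/-- `v(x) ≤ α⟨x − x₀, ν⟩⁺ + o(|x − x₀|)` as `x → x₀` within `s`. -/
def ExpandLe (v : EucSp n → ℝ) (x₀ ν : EucSp n) (α : ℝ) (s : Set (EucSp n)) : Prop :=
  ∀ ε > (0:ℝ), ∀ᶠ x in 𝓝[s] x₀,
    v x ≤ α * max ⟪x - x₀, ν⟫ 0 + ε * ‖x - x₀‖

/-- `v(x) ≥ α⟨x − x₀, ν⟩⁺ + o(|x − x₀|)` as `x → x₀` within `s`. -/
def ExpandGe (v : EucSp n → ℝ) (x₀ ν : EucSp n) (α : ℝ) (s : Set (EucSp n)) : Prop :=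
  ∀ ε > (0:ℝ), ∀ᶠ x in 𝓝[s] x₀,
    α * max ⟪x - x₀, ν⟫ 0 - ε * ‖x - x₀‖ ≤ v x

/-- `v(x) = o(|x − x₀|)` as `x → x₀` within `s`. -/
def SmallO (v : EucSp n → ℝ) (x₀ : EucSp n) (s : Set (EucSp n)) : Prop :=
  ∀ ε > (0:ℝ), ∀ᶠ x in 𝓝[s] x₀, |v x| ≤ ε * ‖x - x₀‖

/-- The non-tangential cone at `x₀` in direction `ν` with opening parameter `θ`. -/
def ntCone (x₀ ν : EucSp n) (θ : ℝ) : Set (EucSp n) :=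
  {x | θ * ‖x - x₀‖ < ⟪x - x₀, ν⟫}

/-- Hypotheses on the free boundary condition function `G(β, x, ν)`: strictly
increasing in `β ≥ 0`, Lipschitz in all arguments, and
`G(0) := inf_{x ∈ Ω, |ν|=1} G(0, x, ν) ≥ G0 > 0`. -/
def GHyp (Ω : Set (EucSp n)) (G : ℝ → EucSp n → EucSp n → ℝ) (G0 : ℝ) : Prop :=
  (∀ x ν, StrictMonoOn (fun β => G β x ν) (Ici (0:ℝ))) ∧
  (∃ LG : ℝ≥0, LipschitzWith LG (fun p : ℝ × EucSp n × EucSp n => G p.1 p.2.1 p.2.2)) ∧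
  0 < G0 ∧ ∀ x ∈ Ω, ∀ ν : EucSp n, ‖ν‖ = 1 → G0 ≤ G 0 x ν

/-- A (crude) notion of bounded Lipschitz domain: bounded, open, and near every
boundary point, `Ω` is the supergraph of a Lipschitz function in some direction. -/
def IsLipschitzDomain (Ω : Set (EucSp n)) : Prop :=
  IsOpen Ω ∧ IsBounded Ω ∧ Ω.Nonempty ∧
  ∀ x ∈ frontier Ω, ∃ r : ℝ, 0 < r ∧ ∃ (g : EucSp n → ℝ) (L : ℝ≥0) (e : EucSp n),
    ‖e‖ = 1 ∧ LipschitzWith L g ∧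
    ∀ y ∈ ball x r, (y ∈ Ω ↔ g (y - ⟪y, e⟫ • e) < ⟪y, e⟫)

/-- The class `𝓕` of admissible supersolutions (Definition 1.2). -/
def memF (A : EucSp n → (EucSp n →L[ℝ] EucSp n)) (Ω : Set (EucSp n))
    (f₁ f₂ : EucSp n → ℝ) (G : ℝ → EucSp n → EucSp n → ℝ) (w : EucSp n → ℝ) : Prop :=
  ContinuousOn w (closure Ω) ∧ LocLipOn w (closure Ω) ∧
  WeakLe A w f₁ (plusSet Ω w) ∧
  WeakLe A w (ChiNeg f₂ w) (minusSet Ω w) ∧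
  (∀ x₀ y r, TouchLeft Ω w x₀ y r →
    ∃ α β : ℝ, 0 ≤ α ∧ 0 ≤ β ∧
      ExpandLe (PPart w) x₀ (nuLeft x₀ y) α Set.univ ∧
      ExpandGe (NPart w) x₀ (-(nuLeft x₀ y)) β Set.univ ∧
      α < G β x₀ (nuLeft x₀ y)) ∧
  (∀ x₀ ∈ freeBdry Ω w, (∀ y r, ¬ TouchLeft Ω w x₀ y r) → SmallO w x₀ Set.univ)

/-- A minorant (strict subsolution) for the free boundary problem. -/
def IsMinorant (A : EucSp n → (EucSp n →L[ℝ] EucSp n)) (Ω : Set (EucSp n))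
    (f₁ f₂ : EucSp n → ℝ) (G : ℝ → EucSp n → EucSp n → ℝ) (u : EucSp n → ℝ) : Prop :=
  LocLipOn u Ω ∧
  WeakGe A u f₁ (plusSet Ω u) ∧
  WeakGe A u (ChiNeg f₂ u) (minusSet Ω u) ∧
  ∀ x₀ ∈ freeBdry Ω u, ∃ y r, TouchRight Ω u x₀ y r ∧
    ∃ α β : ℝ, 0 ≤ α ∧ 0 ≤ β ∧
      ExpandGe (PPart u) x₀ (nuRight x₀ y) α Set.univ ∧
      ExpandLe (NPart u) x₀ (-(nuRight x₀ y)) β Set.univ ∧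
      G β x₀ (nuRight x₀ y) < α

/-- A weak solution of the two-phase free boundary problem (Definition 1.1). -/
def IsWeakSolution (A : EucSp n → (EucSp n →L[ℝ] EucSp n)) (Ω : Set (EucSp n))
    (f₁ f₂ : EucSp n → ℝ) (G : ℝ → EucSp n → EucSp n → ℝ) (u : EucSp n → ℝ) : Prop :=
  ContinuousOn u Ω ∧
  WeakEq A u f₁ (plusSet Ω u) ∧
  WeakEq A u (ChiNeg f₂ u) (minusSet Ω u) ∧
  (∀ x₀ y r, TouchRight Ω u x₀ y r →
    ∃ α β : ℝ, 0 ≤ α ∧ 0 ≤ β ∧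
      ExpandGe (PPart u) x₀ (nuRight x₀ y) α (ball y r) ∧
      ExpandLe (NPart u) x₀ (-(nuRight x₀ y)) β (closure (ball y r))ᶜ ∧
      (∀ θ ∈ Ioo (0:ℝ) 1,
        SmallO (fun x => PPart u x - α * ⟪x - x₀, nuRight x₀ y⟫) x₀
          (ntCone x₀ (nuRight x₀ y) θ) ∧
        SmallO (fun x => NPart u x - β * ⟪x - x₀, -(nuRight x₀ y)⟫) x₀
          (ntCone x₀ (-(nuRight x₀ y)) θ)) ∧
      α ≤ G β x₀ (nuRight x₀ y)) ∧
  (∀ x₀ y r, TouchLeft Ω u x₀ y r →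
    ∃ α β : ℝ, 0 ≤ α ∧ 0 ≤ β ∧
      ExpandGe (NPart u) x₀ (-(nuLeft x₀ y)) β (ball y r) ∧
      ExpandLe (PPart u) x₀ (nuLeft x₀ y) α (closure (ball y r))ᶜ ∧
      (∀ θ ∈ Ioo (0:ℝ) 1,
        SmallO (fun x => PPart u x - α * ⟪x - x₀, nuLeft x₀ y⟫) x₀
          (ntCone x₀ (nuLeft x₀ y) θ) ∧
        SmallO (fun x => NPart u x - β * ⟪x - x₀, -(nuLeft x₀ y)⟫) x₀
          (ntCone x₀ (-(nuLeft x₀ y)) θ)) ∧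
      G β x₀ (nuLeft x₀ y) ≤ α)

/-- The Perron family: admissible supersolutions above the minorant `ubar`
with boundary values `φb`. -/
def PerronFam (A : EucSp n → (EucSp n →L[ℝ] EucSp n)) (Ω : Set (EucSp n))
    (f₁ f₂ : EucSp n → ℝ) (G : ℝ → EucSp n → EucSp n → ℝ)
    (ubar φb : EucSp n → ℝ) : Set (EucSp n → ℝ) :=
  {w | memF A Ω f₁ f₂ G w ∧ (∀ x ∈ closure Ω, ubar x ≤ w x) ∧
       ∀ x ∈ frontier Ω, w x = φb x}

namespace AsymptoticDev

section Divergence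

variable {E : Type*} [NormedAddCommGroup E] [InnerProductSpace ℝ E] [FiniteDimensional ℝ E]
  [MeasurableSpace E] [BorelSpace E] {μ : Measure E} [μ.IsAddHaarMeasure]

/-- Divergence theorem for a Lipschitz function against a compactly supported `C¹` vector field. -/
theorem integral_fderiv_apply_eq_neg_integral_mul_trace {C : ℝ≥0} {v : E → ℝ}
    (hv : LipschitzWith C v) {V : E → E} {V' : E → E →L[ℝ] E}
    (hV : ∀ x, HasFDerivAt V (V' x) x) (hV' : Continuous V') (hc : HasCompactSupport V) :
    ∫ x, fderiv ℝ v x (V x) ∂μ = -∫ x, v x * LinearMap.trace ℝ E (V' x).toLinearMap ∂μ := by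
  classical
  set b := stdOrthonormalBasis ℝ E
  have hVc : ContDiff ℝ 1 V := contDiff_one_iff_fderiv.2
    ⟨fun x => (hV x).differentiableAt, by
      convert hV' using 1
      exact funext fun x => (hV x).fderiv⟩
  have hVd (i) : ContDiff ℝ 1 (fun x => ⟪b i, V x⟫) := contDiff_const.inner ℝ hVc
  have hVs (i) : HasCompactSupport (fun x => ⟪b i, V x⟫) :=
    hc.comp_left (g := fun w => ⟪b i, w⟫) (by simp)
  have hVL (i) := (hVd i).lipschitzWith_of_hasCompactSupport (hVs i) one_ne_zero
  have hVf (i x) : HasFDerivAt (fun x => ⟪b i, V x⟫) ((innerSL ℝ (b i)).comp (V' x)) x :=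
    ((innerSL ℝ (b i)).hasFDerivAt).comp x (hV x)
  have hint (i) : Integrable (fun x => lineDeriv ℝ v x (b i) * ⟪b i, V x⟫) μ := by
    have h1 : Integrable (fun x => ⟪b i, V x⟫) μ :=
      (hVd i).continuous.integrable_of_hasCompactSupport (hVs i)
    refine h1.bdd_mul (c := C * ‖b i‖) (aestronglyMeasurable_lineDeriv hv.continuous μ)
      (.of_forall fun x => norm_lineDeriv_le_of_lipschitz ℝ hv)
  have hae : ∀ᵐ x ∂μ, fderiv ℝ v x (V x) = ∑ i, lineDeriv ℝ v x (b i) * ⟪b i, V x⟫ := by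
    filter_upwards [hv.ae_differentiableAt (μ := μ)] with x hx
    conv_lhs => rw [← b.sum_repr' (V x)]
    simp [map_sum, hx.lineDeriv_eq_fderiv, mul_comm]
  rw [integral_congr_ae hae, integral_finsetSum _ fun i _ => hint i, ← integral_neg]
  have hint2 (i) : Integrable (fun x => -(v x * ⟪b i, V' x (b i)⟫)) μ := by
    have hc' : HasCompactSupport (fun x => v x * ⟪b i, V' x (b i)⟫) := by
      have := (hc.fderiv (𝕜 := ℝ))
      rw [show fderiv ℝ V = V' from funext fun x => (hV x).fderiv] at this
      exact (this.comp_left (g := fun T : E →L[ℝ] E => ⟪b i, T (b i)⟫) (by simp)).mul_left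
    have : Continuous (fun x => v x * ⟪b i, V' x (b i)⟫) := by
      have := hv.continuous
      fun_prop
    exact (this.integrable_of_hasCompactSupport hc').neg
  calc ∑ i, ∫ x, lineDeriv ℝ v x (b i) * ⟪b i, V x⟫ ∂μ
      = ∑ i, ∫ x, -(v x * ⟪b i, V' x (b i)⟫) ∂μ := by
        refine Finset.sum_congr rfl fun i _ => ?_
        obtain ⟨D, hD⟩ := hVL i
        rw [hv.integral_lineDeriv_mul_eq hD (hVs i)]
        refine integral_congr_ae (.of_forall fun x => ?_)
        simp only
        rw [(hVf i x).differentiableAt.lineDeriv_eq_fderiv, (hVf i x).fderiv]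
        simp [mul_comm]
    _ = _ := by
        rw [← integral_finsetSum _ fun i _ => hint2 i]
        refine integral_congr_ae (.of_forall fun x => ?_)
        simp [LinearMap.trace_eq_sum_inner _ b, Finset.mul_sum]

end Divergence

end AsymptoticDev

namespace AsymptoticDev

section Profiles

/-- A smooth radial profile supported in `(-∞, 1]`, as a function of the squared radius. -/
def bump₁ (q : ℝ) : ℝ := expNegInvGlue (1 - q)

/-- The primitive of `-bump₁` that vanishes on `[1, ∞)`. -/
def bump₀ (q : ℝ) : ℝ := ∫ t in q..1, bump₁ t

/-- The function `-bump₁'`. -/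
def bump₂ (q : ℝ) : ℝ := ((1 - q)⁻¹) ^ 2 * expNegInvGlue (1 - q)

/-- The function `-bump₂'`. -/
def bump₃ (q : ℝ) : ℝ := -deriv bump₂ q

theorem contDiff_bump₁ : ContDiff ℝ (⊤ : ℕ∞) bump₁ :=
  expNegInvGlue.contDiff.comp (contDiff_const.sub contDiff_id)

theorem contDiff_bump₂ : ContDiff ℝ (⊤ : ℕ∞) bump₂ := by
  have := (expNegInvGlue.contDiff_polynomial_eval_inv_mul (n := (⊤ : ℕ∞)) (Polynomial.X ^ 2)).comp
    ((contDiff_const (c := (1 : ℝ))).sub contDiff_id)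
  have h : bump₂ = fun q => ((1 - q) ^ 2)⁻¹ * expNegInvGlue (1 - q) := by
    funext q
    simp [bump₂]
  rw [h]
  simpa [Function.comp_def] using this

theorem contDiff_bump₃ : ContDiff ℝ (⊤ : ℕ∞) bump₃ :=
  ((contDiff_infty_iff_deriv.1 contDiff_bump₂).2).neg

theorem hasDerivAt_bump₁ (q : ℝ) : HasDerivAt bump₁ (-bump₂ q) q := by
  have h := expNegInvGlue.hasDerivAt_polynomial_eval_inv_mul 1 (1 - q)
  have h' : HasDerivAt (fun q : ℝ => 1 - q) (-1) q := by
    simpa using (hasDerivAt_id q).const_sub 1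
  have := h.comp q h'
  have h1 : bump₁ = fun q => expNegInvGlue (1 - q) := rfl
  rw [h1]
  simpa [Function.comp_def, bump₂] using this

theorem hasDerivAt_bump₂ (q : ℝ) : HasDerivAt bump₂ (-bump₃ q) q := by
  have := (contDiff_bump₂.differentiable (by simp) q).hasDerivAt
  simpa [bump₃] using this

theorem hasDerivAt_bump₀ (q : ℝ) : HasDerivAt bump₀ (-bump₁ q) q :=
  intervalIntegral.integral_hasDerivAt_left
    (contDiff_bump₁.continuous.intervalIntegrable _ _)
    contDiff_bump₁.continuous.stronglyMeasurable.stronglyMeasurableAtFilter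
    contDiff_bump₁.continuous.continuousAt

theorem contDiff_bump₀ : ContDiff ℝ (⊤ : ℕ∞) bump₀ := by
  refine contDiff_infty_iff_deriv.2 ⟨fun q => (hasDerivAt_bump₀ q).differentiableAt, ?_⟩
  rw [show deriv bump₀ = fun q => -bump₁ q from funext fun q => (hasDerivAt_bump₀ q).deriv]
  exact contDiff_bump₁.neg

theorem bump₁_eq_zero {q : ℝ} (hq : 1 ≤ q) : bump₁ q = 0 :=
  expNegInvGlue.zero_of_nonpos (by linarith)

theorem bump₂_eq_zero {q : ℝ} (hq : 1 ≤ q) : bump₂ q = 0 := by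
  rw [bump₂, expNegInvGlue.zero_of_nonpos (by linarith), mul_zero]

theorem bump₀_eq_zero {q : ℝ} (hq : 1 ≤ q) : bump₀ q = 0 := by
  rw [bump₀, intervalIntegral.integral_symm, neg_eq_zero]
  refine intervalIntegral.integral_zero_ae (.of_forall fun t ht => ?_)
  rw [uIoc_of_le hq] at ht
  exact bump₁_eq_zero ht.1.le

theorem bump₃_eq_zero {q : ℝ} (hq : 1 ≤ q) : bump₃ q = 0 := by
  have h : EqOn bump₃ 0 (closure (Ioi 1)) := by
    refine EqOn.closure (fun t ht => ?_) contDiff_bump₃.continuous continuous_const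
    have : bump₂ =ᶠ[𝓝 t] fun _ => 0 := by
      filter_upwards [Ioi_mem_nhds ht] with y hy using bump₂_eq_zero (le_of_lt hy)
    simp [bump₃, this.deriv_eq]
  rw [closure_Ioi] at h
  exact h hq

theorem bump₁_nonneg (q : ℝ) : 0 ≤ bump₁ q := expNegInvGlue.nonneg _

theorem bump₁_pos {q : ℝ} (hq : q < 1) : 0 < bump₁ q := expNegInvGlue.pos_of_pos (by linarith)

theorem bump₁_le_one (q : ℝ) : bump₁ q ≤ 1 := by
  rcases le_or_gt 1 q with h | h
  · simp [bump₁_eq_zero h]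
  · have : 0 < 1 - q := by linarith
    simp [bump₁, expNegInvGlue, this.not_ge, this.le]

theorem bump₂_nonneg (q : ℝ) : 0 ≤ bump₂ q :=
  mul_nonneg (sq_nonneg _) (expNegInvGlue.nonneg _)

theorem bump₂_pos {q : ℝ} (hq : q < 1) : 0 < bump₂ q := by
  have : 0 < 1 - q := by linarith
  exact mul_pos (by positivity) (expNegInvGlue.pos_of_pos this)

/-- A continuous function vanishing on `[1, ∞)` is bounded on `[0, ∞)`. -/
theorem exists_abs_le_of_eq_zero {g : ℝ → ℝ} (hg : Continuous g) (h0 : ∀ q, 1 ≤ q → g q = 0) :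
    ∃ C, 0 ≤ C ∧ ∀ q, 0 ≤ q → |g q| ≤ C := by
  obtain ⟨C, hC⟩ := isCompact_Icc.exists_bound_of_continuousOn (s := Icc (0 : ℝ) 1) hg.continuousOn
  refine ⟨max C 0, le_max_right _ _, fun q hq => ?_⟩
  rcases le_or_gt 1 q with h | h
  · simp [h0 q h]
  · exact (hC q ⟨hq, h.le⟩).trans (le_max_left _ _)

/-- A smooth approximation of the Heaviside function, with transition in `[1, 2]`. -/
def step₁ (t : ℝ) : ℝ := Real.smoothTransition (t - 1)

/-- The primitive of `step₁`, a smooth convex approximation of the positive part. -/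
def step₀ (t : ℝ) : ℝ := ∫ s in (0 : ℝ)..t, step₁ s

/-- The derivative of `step₁`. -/
def step₂ (t : ℝ) : ℝ := deriv step₁ t

/-- The derivative of `step₂`. -/
def step₃ (t : ℝ) : ℝ := deriv step₂ t

theorem contDiff_step₁ : ContDiff ℝ (⊤ : ℕ∞) step₁ :=
  Real.smoothTransition.contDiff.comp (contDiff_id.sub contDiff_const)

theorem contDiff_step₂ : ContDiff ℝ (⊤ : ℕ∞) step₂ := (contDiff_infty_iff_deriv.1 contDiff_step₁).2

theorem contDiff_step₃ : ContDiff ℝ (⊤ : ℕ∞) step₃ := (contDiff_infty_iff_deriv.1 contDiff_step₂).2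

theorem hasDerivAt_step₁ (t : ℝ) : HasDerivAt step₁ (step₂ t) t :=
  (contDiff_step₁.differentiable (by simp) t).hasDerivAt

theorem hasDerivAt_step₂ (t : ℝ) : HasDerivAt step₂ (step₃ t) t :=
  (contDiff_step₂.differentiable (by simp) t).hasDerivAt

theorem hasDerivAt_step₀ (t : ℝ) : HasDerivAt step₀ (step₁ t) t :=
  intervalIntegral.integral_hasDerivAt_right
    (contDiff_step₁.continuous.intervalIntegrable _ _)
    contDiff_step₁.continuous.stronglyMeasurable.stronglyMeasurableAtFilter
    contDiff_step₁.continuous.continuousAt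

theorem contDiff_step₀ : ContDiff ℝ (⊤ : ℕ∞) step₀ := by
  refine contDiff_infty_iff_deriv.2 ⟨fun q => (hasDerivAt_step₀ q).differentiableAt, ?_⟩
  rw [show deriv step₀ = step₁ from funext fun q => (hasDerivAt_step₀ q).deriv]
  exact contDiff_step₁

theorem step₁_eq_zero {t : ℝ} (ht : t ≤ 1) : step₁ t = 0 :=
  Real.smoothTransition.zero_of_nonpos (by linarith)

theorem step₁_eq_one {t : ℝ} (ht : 2 ≤ t) : step₁ t = 1 :=
  Real.smoothTransition.one_of_one_le (by linarith)

theorem step₁_nonneg (t : ℝ) : 0 ≤ step₁ t := Real.smoothTransition.nonneg _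

theorem step₁_le_one (t : ℝ) : step₁ t ≤ 1 := Real.smoothTransition.le_one _

theorem step₂_nonneg (t : ℝ) : 0 ≤ step₂ t :=
  (Real.smoothTransition.monotone.comp fun _ _ h => sub_le_sub_right h 1).deriv_nonneg

theorem step₂_eq_zero {t : ℝ} (ht : t < 1 ∨ 2 < t) : step₂ t = 0 := by
  rcases ht with ht | ht
  · have : step₁ =ᶠ[𝓝 t] fun _ => 0 := by
      filter_upwards [Iio_mem_nhds ht] with y hy using step₁_eq_zero (le_of_lt hy)
    simp [step₂, this.deriv_eq]
  · have : step₁ =ᶠ[𝓝 t] fun _ => 1 := by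
      filter_upwards [Ioi_mem_nhds ht] with y hy using step₁_eq_one (le_of_lt hy)
    simp [step₂, this.deriv_eq]

theorem step₃_eq_zero {t : ℝ} (ht : t < 1 ∨ 2 < t) : step₃ t = 0 := by
  have : step₂ =ᶠ[𝓝 t] fun _ => 0 := by
    rcases ht with ht | ht
    · filter_upwards [Iio_mem_nhds ht] with y hy using step₂_eq_zero (.inl hy)
    · filter_upwards [Ioi_mem_nhds ht] with y hy using step₂_eq_zero (.inr hy)
  simp [step₃, this.deriv_eq]

theorem step₀_eq_zero {t : ℝ} (ht : t ≤ 1) : step₀ t = 0 := by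
  refine intervalIntegral.integral_zero_ae (.of_forall fun s hs => step₁_eq_zero ?_)
  rcases le_or_gt 0 t with h | h
  · rw [uIoc_of_le h] at hs
    exact hs.2.trans ht
  · rw [uIoc_of_ge h.le] at hs
    linarith [hs.2]

theorem step₀_nonneg (t : ℝ) : 0 ≤ step₀ t := by
  rcases le_or_gt t 0 with h | h
  · rw [step₀_eq_zero (by linarith)]
  · exact intervalIntegral.integral_nonneg h.le fun s _ => step₁_nonneg s

theorem step₀_sub_id_antitone : Antitone fun t => step₀ t - t :=
  antitone_of_hasDerivAt_nonpos (fun t => (hasDerivAt_step₀ t).sub (hasDerivAt_id t))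
    fun t => by simpa using step₁_le_one t

theorem step₀_le_max (t : ℝ) : step₀ t ≤ max t 0 := by
  rcases le_or_gt t 0 with h | h
  · rw [step₀_eq_zero (by linarith)]
    exact le_max_right _ _
  · have := step₀_sub_id_antitone h.le
    simp only [step₀_eq_zero zero_le_one] at this
    exact le_trans (by linarith) (le_max_left _ _)

theorem max_sub_le_step₀ (t : ℝ) : max t 0 - 2 ≤ step₀ t := by
  rcases le_or_gt t 2 with h | h
  · have : max t 0 ≤ 2 := max_le h zero_le_two
    linarith [step₀_nonneg t]
  · rw [max_eq_left (by linarith)]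
    have h1 : MonotoneOn (fun t => step₀ t - t) (Ici 2) := by
      refine monotoneOn_of_deriv_nonneg (convex_Ici 2) ?_ ?_ ?_
      · exact (contDiff_step₀.continuous.sub continuous_id).continuousOn
      · exact fun x _ => ((hasDerivAt_step₀ x).sub
          (hasDerivAt_id x)).differentiableAt.differentiableWithinAt
      · intro x hx
        rw [interior_Ici] at hx
        have hd : HasDerivAt (fun t => step₀ t - t) (step₁ x - 1) x :=
          (hasDerivAt_step₀ x).sub (hasDerivAt_id x)
        rw [hd.deriv, step₁_eq_one (le_of_lt hx), sub_self]
    have := h1 (mem_Ici.2 le_rfl) (mem_Ici.2 h.le) h.le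
    simp only at this
    linarith [step₀_nonneg 2]

theorem abs_mul_step₁_sub_max_le (t : ℝ) : |t * step₁ t - max t 0| ≤ 2 := by
  rcases le_or_gt t 1 with h | h
  · rw [step₁_eq_zero h, mul_zero, zero_sub, abs_neg, abs_of_nonneg (le_max_right _ _)]
    exact max_le (by linarith) zero_le_two
  · rw [max_eq_left (by linarith)]
    rcases le_or_gt 2 t with h2 | h2
    · simp [step₁_eq_one h2]
    · rw [abs_le]
      constructor <;> nlinarith [step₁_nonneg t, step₁_le_one t]

theorem exists_abs_mul_step_le :
    ∃ C, 0 ≤ C ∧ ∀ t, |t * step₂ t| ≤ C ∧ |t ^ 2 * step₃ t| ≤ C := by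
  obtain ⟨C, hC⟩ := isCompact_Icc.exists_bound_of_continuousOn (s := Icc (1 : ℝ) 2)
    (f := fun t => t * step₂ t) (continuous_id.mul contDiff_step₂.continuous).continuousOn
  obtain ⟨D, hD⟩ := isCompact_Icc.exists_bound_of_continuousOn (s := Icc (1 : ℝ) 2)
    (f := fun t => t ^ 2 * step₃ t)
    ((continuous_id.pow 2).mul contDiff_step₃.continuous).continuousOn
  refine ⟨max (max C D) 0, le_max_right _ _, fun t => ?_⟩
  by_cases ht : t ∈ Icc (1 : ℝ) 2
  · exact ⟨(hC t ht).trans ((le_max_left _ _).trans (le_max_left _ _)),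
      (hD t ht).trans ((le_max_right _ _).trans (le_max_left _ _))⟩
  · have : t < 1 ∨ 2 < t := by
      by_contra! h
      exact ht h
    simp [step₂_eq_zero this, step₃_eq_zero this]

end Profiles

end AsymptoticDev

namespace AsymptoticDev

variable {E : Type*} [NormedAddCommGroup E] [InnerProductSpace ℝ E]

section Quadratic

/-- A symmetric operator `a` together with its coercive inverse `B`. -/
structure EllipticPair (a B : E →L[ℝ] E) (c : ℝ) : Prop where
  pos : 0 < c
  right_inv : ∀ x, a (B x) = x
  left_inv : ∀ x, B (a x) = x
  symm : ∀ x y, ⟪B x, y⟫ = ⟪x, B y⟫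
  coercive : ∀ x, c * ‖x‖ ^ 2 ≤ ⟪B x, x⟫

/-- The quadratic form of `B`. -/
def quad (B : E →L[ℝ] E) (x : E) : ℝ := ⟪B x, x⟫

variable {a B : E →L[ℝ] E} {c : ℝ}

@[fun_prop]
theorem continuous_quad : Continuous (quad B) := by
  unfold quad
  fun_prop

theorem contDiff_quad : ContDiff ℝ (⊤ : ℕ∞) (quad B) :=
  ContDiff.inner ℝ B.contDiff contDiff_id

theorem quad_smul (t : ℝ) (x : E) : quad B (t • x) = t ^ 2 * quad B x := by
  simp only [quad, map_smul, real_inner_smul_left, real_inner_smul_right]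
  ring

namespace EllipticPair

theorem quad_nonneg (h : EllipticPair a B c) (x : E) : 0 ≤ quad B x :=
  le_trans (mul_nonneg h.pos.le (sq_nonneg _)) (h.coercive x)

theorem inner_apply (h : EllipticPair a B c) (e x : E) : ⟪B x, a e⟫ = ⟪e, x⟫ := by
  rw [h.symm, h.left_inv, real_inner_comm]

theorem inner_apply_self_pos (h : EllipticPair a B c) {e : E} (he : e ≠ 0) : 0 < ⟪e, a e⟫ := by
  have h1 := h.coercive (a e)
  rw [h.left_inv] at h1
  have h2 : a e ≠ 0 := fun h0 => he (by rw [← h.left_inv e, h0, map_zero])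
  have h3 : 0 < ‖a e‖ := norm_pos_iff.2 h2
  have := h.pos
  exact lt_of_lt_of_le (by positivity) h1

theorem quad_sub (h : EllipticPair a B c) (x z : E) :
    quad B (x - z) = quad B x - 2 * ⟪B x, z⟫ + quad B z := by
  simp only [quad, map_sub, inner_sub_left, inner_sub_right]
  rw [h.symm z x, real_inner_comm (B x) z]
  ring

theorem hasFDerivAt_quad_sub (h : EllipticPair a B c) (z x : E) :
    HasFDerivAt (fun x => quad B (x - z)) ((2 : ℝ) • innerSL ℝ (B (x - z))) x := by
  have h1 : HasFDerivAt (fun x => x - z) (ContinuousLinearMap.id ℝ E) x :=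
    (hasFDerivAt_id x).sub_const z
  have h2 := (B.hasFDerivAt.comp x h1).inner ℝ h1
  refine h2.congr_fderiv (ContinuousLinearMap.ext fun y => ?_)
  simp [h.symm y, two_mul, real_inner_comm, inner_sub_right]

theorem norm_le_of_quad_le (h : EllipticPair a B c) {x : E} {R : ℝ} (hx : quad B x ≤ R) :
    ‖x‖ ≤ R / c + 1 := by
  have h1 : c * ‖x‖ ^ 2 ≤ R := (h.coercive x).trans hx
  have h2 : ‖x‖ ^ 2 ≤ R / c := by
    rw [le_div_iff₀ h.pos]
    linarith
  nlinarith [sq_nonneg (‖x‖ - 1)]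

theorem hasCompactSupport [FiniteDimensional ℝ E] (h : EllipticPair a B c) {X : Type*} [Zero X]
    {F : E → X} {R : ℝ} {z : E} (hF : ∀ x, R ≤ quad B (x - z) → F x = 0) : HasCompactSupport F := by
  refine HasCompactSupport.intro (isCompact_closedBall z (R / c + 1)) fun x hx => hF x ?_
  by_contra! hlt
  exact hx (by simpa [dist_eq_norm] using h.norm_le_of_quad_le hlt.le)

end EllipticPair

end Quadratic

section TestFunctions

variable {a B : E →L[ℝ] E} {c : ℝ}

/-- A test function that is the product of a function of `⟪e, x⟫` and a radial function. -/
def testFun (B : E →L[ℝ] E) (e : E) (h G : ℝ → ℝ) (z x : E) : ℝ := h ⟪e, x⟫ * G (quad B (x - z))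

/-- The gradient of `testFun`. -/
def testGrad (B : E →L[ℝ] E) (e : E) (h h₁ G G₁ : ℝ → ℝ) (z x : E) : E :=
  (h₁ ⟪e, x⟫ * G (quad B (x - z))) • e + (2 * h ⟪e, x⟫ * G₁ (quad B (x - z))) • B (x - z)

/-- The expression `div (a ∇φ)` for the test function `φ = testFun B e h G z`. -/
def testOp (a B : E →L[ℝ] E) (e : E) (h h₁ h₂ G G₁ G₂ : ℝ → ℝ) (z x : E) : ℝ :=
  ⟪e, a e⟫ * h₂ ⟪e, x⟫ * G (quad B (x - z)) +
    4 * h₁ ⟪e, x⟫ * G₁ (quad B (x - z)) * ⟪e, x - z⟫ +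
    h ⟪e, x⟫ * (2 * Module.finrank ℝ E * G₁ (quad B (x - z)) +
      4 * G₂ (quad B (x - z)) * quad B (x - z))

theorem contDiff_testFun {e : E} {h G : ℝ → ℝ} (hh : ContDiff ℝ (⊤ : ℕ∞) h)
    (hG : ContDiff ℝ (⊤ : ℕ∞) G) (z : E) : ContDiff ℝ (⊤ : ℕ∞) (testFun B e h G z) :=
  (hh.comp (contDiff_const.inner ℝ contDiff_id)).mul
    (hG.comp (contDiff_quad.comp (contDiff_id.sub contDiff_const)))

theorem hasFDerivAt_inner_const (e x : E) : HasFDerivAt (fun x => ⟪e, x⟫) (innerSL ℝ e) x :=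
  (innerSL ℝ e).hasFDerivAt

theorem EllipticPair.hasFDerivAt_mul (hp : EllipticPair a B c) {h h₁ G G₁ : ℝ → ℝ}
    (hh : ∀ t, HasDerivAt h (h₁ t) t) (hG : ∀ t, HasDerivAt G (G₁ t) t) (e z x : E) :
    HasFDerivAt (fun x => h ⟪e, x⟫ * G (quad B (x - z)))
      (innerSL ℝ (testGrad B e h h₁ G G₁ z x)) x := by
  have h1 := (hh ⟪e, x⟫).comp_hasFDerivAt x (hasFDerivAt_inner_const e x)
  have h2 := (hG (quad B (x - z))).comp_hasFDerivAt x (hp.hasFDerivAt_quad_sub z x)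
  refine (h1.mul h2).congr_fderiv (ContinuousLinearMap.ext fun y => ?_)
  simp [testGrad]
  ring

theorem EllipticPair.gradient_testFun [CompleteSpace E] (hp : EllipticPair a B c)
    {h h₁ G G₁ : ℝ → ℝ} (hh : ∀ t, HasDerivAt h (h₁ t) t) (hG : ∀ t, HasDerivAt G (G₁ t) t)
    (e z x : E) : gradient (testFun B e h G z) x = testGrad B e h h₁ G G₁ z x := by
  refine HasGradientAt.gradient ?_
  rw [hasGradientAt_iff_hasFDerivAt]
  exact hp.hasFDerivAt_mul hh hG e z x

variable [FiniteDimensional ℝ E] [MeasurableSpace E] [BorelSpace E] {μ : Measure E}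
  [μ.IsAddHaarMeasure]

/-- Integration by parts against `testFun`. -/
theorem EllipticPair.integral_fderiv_gradient_testFun (hp : EllipticPair a B c)
    {C : ℝ≥0} {v : E → ℝ} (hv : LipschitzWith C v) {h h₁ h₂ G G₁ G₂ : ℝ → ℝ} {R : ℝ}
    (hh : ∀ t, HasDerivAt h (h₁ t) t) (hh₁ : ∀ t, HasDerivAt h₁ (h₂ t) t) (hh₂ : Continuous h₂)
    (hG : ∀ t, HasDerivAt G (G₁ t) t) (hG₁ : ∀ t, HasDerivAt G₁ (G₂ t) t) (hG₂ : Continuous G₂)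
    (hR : ∀ q, R ≤ q → G q = 0) (hR₁ : ∀ q, R ≤ q → G₁ q = 0) (e z : E) :
    ∫ x, fderiv ℝ v x (a (gradient (testFun B e h G z) x)) ∂μ =
      -∫ x, v x * testOp a B e h h₁ h₂ G G₁ G₂ z x ∂μ := by
  have ch : Continuous h := continuous_iff_continuousAt.2 fun t => (hh t).continuousAt
  have ch₁ : Continuous h₁ := continuous_iff_continuousAt.2 fun t => (hh₁ t).continuousAt
  have cG : Continuous G := continuous_iff_continuousAt.2 fun t => (hG t).continuousAt
  have cG₁ : Continuous G₁ := continuous_iff_continuousAt.2 fun t => (hG₁ t).continuousAt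
  set V : E → E := fun x => (h₁ ⟪e, x⟫ * G (quad B (x - z))) • a e +
    (h ⟪e, x⟫ * G₁ (quad B (x - z))) • ((2 : ℝ) • (x - z)) with hVdef
  set V' : E → E →L[ℝ] E := fun x =>
    (innerSL ℝ (testGrad B e h₁ h₂ G G₁ z x)).smulRight (a e) +
    ((h ⟪e, x⟫ * G₁ (quad B (x - z))) • ((2 : ℝ) • ContinuousLinearMap.id ℝ E) +
      (innerSL ℝ (testGrad B e h h₁ G₁ G₂ z x)).smulRight ((2 : ℝ) • (x - z))) with hV'def
  have hV : ∀ x, HasFDerivAt V (V' x) x := fun x => by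
    have h3 : HasFDerivAt (fun x : E => (2 : ℝ) • (x - z))
        ((2 : ℝ) • ContinuousLinearMap.id ℝ E) x := ((hasFDerivAt_id x).sub_const z).const_smul 2
    exact ((hp.hasFDerivAt_mul hh₁ hG e z x).smul_const (a e)).add
      ((hp.hasFDerivAt_mul hh hG₁ e z x).smul h3)
  have hV' : Continuous V' := by
    simp only [hV'def, testGrad]
    have : Continuous fun w : E => innerSL ℝ w := (innerSL ℝ (E := E)).continuous
    refine Continuous.add ?_ (Continuous.add ?_ ?_)
    · exact (ContinuousLinearMap.smulRightL ℝ E E).continuous₂.comp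
        ((this.comp (by fun_prop)).prodMk continuous_const)
    · fun_prop
    · exact (ContinuousLinearMap.smulRightL ℝ E E).continuous₂.comp
        ((this.comp (by fun_prop)).prodMk (by fun_prop))
  have hc : HasCompactSupport V := hp.hasCompactSupport (R := R) (z := z) fun x hx => by
    simp [V, hR _ hx, hR₁ _ hx]
  have key := integral_fderiv_apply_eq_neg_integral_mul_trace (μ := μ) hv hV hV' hc
  convert key using 3 with x
  · congr 1
    rw [hp.gradient_testFun hh hG, testGrad]
    simp only [map_add, map_smul, hp.right_inv, V, smul_smul]
    congr 2
    ring
  · funext x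
    congr 1
    have t1 (f : E →L[ℝ] ℝ) (w : E) : LinearMap.trace ℝ E (f.smulRight w).toLinearMap = f w :=
      LinearMap.trace_smulRight f.toLinearMap w
    have t2 : LinearMap.trace ℝ E (ContinuousLinearMap.id ℝ E).toLinearMap = Module.finrank ℝ E :=
      LinearMap.trace_id ℝ E
    simp only [hV'def, ContinuousLinearMap.toLinearMap_add, map_add, t1,
      ContinuousLinearMap.toLinearMap_smul, map_smul, t2]
    simp only [testOp, testGrad, innerSL_apply_apply, inner_add_left, real_inner_smul_left,
      hp.inner_apply, smul_eq_mul]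
    simp only [quad]
    ring

end TestFunctions

end AsymptoticDev

namespace AsymptoticDev

variable {E : Type*} [NormedAddCommGroup E] [InnerProductSpace ℝ E]

section Rescaling

/-- The rescaling `x ↦ U (r x) / r`. -/
def rescale (U : E → ℝ) (r : ℝ) (x : E) : ℝ := U (r • x) / r

theorem rescale_rescale (U : E → ℝ) (r t : ℝ) : rescale (rescale U r) t = rescale U (r * t) := by
  funext x
  simp only [rescale, smul_smul, div_div]

variable {L : ℝ≥0} {U : E → ℝ}

theorem _root_.LipschitzWith.rescale (hU : LipschitzWith L U) {r : ℝ} (hr : 0 < r) :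
    LipschitzWith L (rescale U r) := by
  refine LipschitzWith.of_dist_le_mul fun x y => ?_
  have h := hU.dist_le_mul (r • x) (r • y)
  rw [dist_smul₀, Real.norm_of_nonneg hr.le] at h
  simp only [Real.dist_eq, AsymptoticDev.rescale, ← sub_div, abs_div, abs_of_pos hr] at h ⊢
  rw [div_le_iff₀ hr]
  linarith

theorem rescale_zero (h0 : U 0 = 0) (r : ℝ) : rescale U r 0 = 0 := by
  simp [rescale, h0]

omit [InnerProductSpace ℝ E] in
theorem _root_.LipschitzWith.abs_le (hU : LipschitzWith L U) (h0 : U 0 = 0) (x : E) :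
    |U x| ≤ L * ‖x‖ := by
  simpa [Real.dist_eq, h0] using hU.dist_le_mul x 0

variable [FiniteDimensional ℝ E] [MeasurableSpace E] [BorelSpace E] {μ : Measure E}
  [μ.IsAddHaarMeasure]

theorem integral_eq_pow_mul_integral_comp (f : E → ℝ) (z : E) {s : ℝ} (hs : 0 < s) :
    ∫ x, f x ∂μ = s ^ Module.finrank ℝ E * ∫ y, f (z + s • y) ∂μ := by
  rw [Measure.integral_comp_smul_of_nonneg μ (fun y => f (z + y)) s (hR := hs.le),
    integral_add_left_eq_self, smul_eq_mul, mul_inv_cancel_left₀ (by positivity)]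

omit [InnerProductSpace ℝ E] [FiniteDimensional ℝ E] in
/-- Pointwise limits of Lipschitz functions pass to the limit under compactly supported
integrals, along an arbitrary filter. -/
theorem tendsto_integral_mul_of_lipschitz {ι : Type*} {l : Filter ι} {v : ι → E → ℝ} {v₀ : E → ℝ}
    (hv : ∀ᶠ i in l, LipschitzWith L (v i)) (hv₀ : LipschitzWith L v₀)
    (hlim : ∀ x, Tendsto (fun i => v i x) l (𝓝 (v₀ x))) {ψ : E → ℝ} (hψ : Continuous ψ)
    (hc : HasCompactSupport ψ) :
    Tendsto (fun i => ∫ x, v i x * ψ x ∂μ) l (𝓝 (∫ x, v₀ x * ψ x ∂μ)) := by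
  have hI : Integrable ψ μ := hψ.integrable_of_hasCompactSupport hc
  set I := ∫ x, ‖ψ x‖ ∂μ
  have hI0 : 0 ≤ I := integral_nonneg fun _ => norm_nonneg _
  rw [Metric.tendsto_nhds]
  intro ε hε
  set δ := ε / (2 * (I + 1) * (2 * L + 1)) with hδdef
  have hδ : 0 < δ := by positivity
  obtain ⟨T, hT, hcov⟩ := Metric.totallyBounded_iff.1 hc.isCompact.totallyBounded δ hδ
  have hev : ∀ᶠ i in l, ∀ y ∈ T, dist (v i y) (v₀ y) < δ :=
    (eventually_all_finite hT).2 fun y _ => Metric.tendsto_nhds.1 (hlim y) δ hδ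
  filter_upwards [hv, hev] with i hi hTi
  have hint (w : E → ℝ) (hw : Continuous w) : Integrable (fun x => w x * ψ x) μ :=
    (hw.mul hψ).integrable_of_hasCompactSupport hc.mul_left
  rw [Real.dist_eq, ← integral_sub (hint _ hi.continuous) (hint _ hv₀.continuous)]
  have hb : ∀ x, ‖v i x * ψ x - v₀ x * ψ x‖ ≤ (2 * L + 1) * δ * ‖ψ x‖ := by
    intro x
    by_cases hx : x ∈ tsupport ψ
    · obtain ⟨y, hy, hxy⟩ := mem_iUnion₂.1 (hcov hx)
      rw [← sub_mul, norm_mul]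
      gcongr
      have h1 := hi.dist_le_mul x y
      have h2 := hv₀.dist_le_mul x y
      have h3 := (hTi y hy).le
      have h4 : (L : ℝ) * dist x y ≤ L * δ := by
        gcongr
        exact (mem_ball.1 hxy).le
      rw [← dist_eq_norm]
      have := dist_triangle4 (v i x) (v i y) (v₀ y) (v₀ x)
      rw [dist_comm (v₀ y) (v₀ x)] at this
      linarith
    · simp [image_eq_zero_of_notMem_tsupport hx]
  refine (norm_integral_le_of_norm_le (hI.norm.const_mul _) (ae_of_all _ hb)).trans_lt ?_
  rw [integral_const_mul]
  have : (2 * L + 1) * δ * I = ε / 2 * (I / (I + 1)) := by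
    rw [hδdef]
    field_simp
  have h5 : I / (I + 1) ≤ 1 := (div_le_one (by positivity)).2 (by linarith)
  change (2 * L + 1) * δ * I < ε
  rw [this]
  nlinarith

end Rescaling

section Averages

variable {a B : E →L[ℝ] E} {c : ℝ} [FiniteDimensional ℝ E] [MeasurableSpace E] [BorelSpace E]
  {μ : Measure E} [μ.IsAddHaarMeasure]

/-- Differentiation of a weighted average in its radius. -/
theorem EllipticPair.hasDerivAt_average (hp : EllipticPair a B c) {w : E → ℝ} (hw : Continuous w)
    {g g₁ : ℝ → ℝ} (hg : ∀ q, HasDerivAt g (-g₁ q) q) (hg₁ : Continuous g₁)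
    (h0 : ∀ q, 1 ≤ q → g q = 0) (h0' : ∀ q, 1 ≤ q → g₁ q = 0) (z : E) (N : ℕ) {s : ℝ}
    (hs : 0 < s) :
    HasDerivAt (fun s => (s ^ N)⁻¹ * ∫ x, w x * g (quad B (x - z) / s ^ 2) ∂μ)
      ((s ^ (N + 1))⁻¹ * ∫ x, w x * (-N * g (quad B (x - z) / s ^ 2) +
        2 * g₁ (quad B (x - z) / s ^ 2) * (quad B (x - z) / s ^ 2)) ∂μ) s := by
  have cg : Continuous g := continuous_iff_continuousAt.2 fun t => (hg t).continuousAt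
  obtain ⟨D, hD0, hD⟩ := exists_abs_le_of_eq_zero hg₁ h0'
  have hsub (s : ℝ) (hs : 0 < s) (x : E) (hx : s ^ 2 ≤ quad B (x - z)) :
      1 ≤ quad B (x - z) / s ^ 2 := (one_le_div (by positivity)).2 hx
  have hcs (k : ℝ → ℝ) (hk : ∀ q, 1 ≤ q → k q = 0) (s : ℝ) (hs : 0 < s) :
      HasCompactSupport fun x => w x * k (quad B (x - z) / s ^ 2) :=
    hp.hasCompactSupport (R := s ^ 2) (z := z) fun x hx => by rw [hk _ (hsub s hs x hx), mul_zero]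
  have hint (k : ℝ → ℝ) (hkc : Continuous k) (hk : ∀ q, 1 ≤ q → k q = 0) :
      Integrable (fun x => w x * k (quad B (x - z) / s ^ 2)) μ :=
    Continuous.integrable_of_hasCompactSupport (by fun_prop) (hcs k hk s hs)
  have hs' : ∀ t ∈ ball s (s / 2), s / 2 < t ∧ t < 2 * s := fun t ht => by
    rw [mem_ball, Real.dist_eq, abs_lt] at ht
    constructor <;> linarith
  have hder : HasDerivAt (fun s => ∫ x, w x * g (quad B (x - z) / s ^ 2) ∂μ)
      (∫ x, w x * (2 * g₁ (quad B (x - z) / s ^ 2) * (quad B (x - z) / s ^ 2) * s⁻¹) ∂μ) s := by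
    refine (hasDerivAt_integral_of_dominated_loc_of_deriv_le (μ := μ)
      (F := fun s x => w x * g (quad B (x - z) / s ^ 2))
      (F' := fun s x => w x *
        (2 * g₁ (quad B (x - z) / s ^ 2) * (quad B (x - z) / s ^ 2) * s⁻¹))
      (bound := fun x => (closedBall z ((2 * s) ^ 2 / c + 1)).indicator
        (fun x => ‖w x‖ * (2 * D * 1 * (s / 2)⁻¹)) x)
      (s := ball s (s / 2)) (ball_mem_nhds _ (by positivity)) ?_ (hint g cg h0) ?_ ?_ ?_ ?_).2
    · exact Eventually.of_forall fun t => Continuous.aestronglyMeasurable (by fun_prop)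
    · exact Continuous.aestronglyMeasurable (by fun_prop)
    · refine ae_of_all _ fun x t ht => ?_
      obtain ⟨ht1, ht2⟩ := hs' t ht
      have ht0 : 0 < t := by linarith
      by_cases hx : quad B (x - z) ≤ t ^ 2
      · have hxm : x ∈ closedBall z ((2 * s) ^ 2 / c + 1) := by
          rw [mem_closedBall, dist_eq_norm]
          refine hp.norm_le_of_quad_le (hx.trans ?_)
          gcongr
        rw [indicator_of_mem hxm, norm_mul, norm_mul, norm_mul, norm_mul, Real.norm_ofNat]
        have hq : 0 ≤ quad B (x - z) / t ^ 2 := div_nonneg (hp.quad_nonneg _) (sq_nonneg _)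
        have h1 : ‖g₁ (quad B (x - z) / t ^ 2)‖ ≤ D := hD _ hq
        have h2 : ‖quad B (x - z) / t ^ 2‖ ≤ 1 := by
          rw [Real.norm_of_nonneg hq]
          exact (div_le_one (by positivity)).2 hx
        have h3 : ‖t⁻¹‖ ≤ (s / 2)⁻¹ := by
          rw [Real.norm_of_nonneg (by positivity)]
          gcongr
        gcongr
      · rw [h0' _ (hsub t ht0 x (not_le.1 hx).le)]
        simp only [mul_zero, zero_mul, norm_zero]
        exact indicator_nonneg (fun _ _ => by positivity) _
    · exact IntegrableOn.integrable_indicator (Continuous.continuousOn (by fun_prop)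
        |>.integrableOn_compact (isCompact_closedBall _ _)) measurableSet_closedBall
    · refine ae_of_all _ fun x t ht => ?_
      have ht0 : 0 < t := by linarith [(hs' t ht).1]
      have h1 : HasDerivAt (fun t : ℝ => quad B (x - z) / t ^ 2)
          (-(2 * (quad B (x - z) / t ^ 2) * t⁻¹)) t := by
        have := ((hasDerivAt_pow 2 t).inv (by positivity)).const_mul (quad B (x - z))
        refine this.congr_deriv ?_
        simp
        field_simp
      refine (((hg _).comp t h1).const_mul (w x)).congr_deriv ?_
      ring
  have hpow : HasDerivAt (fun s : ℝ => (s ^ N)⁻¹) (-N * (s ^ (N + 1))⁻¹) s := by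
    refine ((hasDerivAt_pow N s).inv (by positivity)).congr_deriv ?_
    rcases N with _ | N
    · simp
    · simp
      field_simp
      ring
  refine (hpow.mul hder).congr_deriv ?_
  have e1 : (∫ x, w x * (2 * g₁ (quad B (x - z) / s ^ 2) * (quad B (x - z) / s ^ 2) * s⁻¹) ∂μ) =
      s⁻¹ * ∫ x, w x * (2 * g₁ (quad B (x - z) / s ^ 2) * (quad B (x - z) / s ^ 2)) ∂μ := by
    rw [← integral_const_mul]
    exact integral_congr_ae (ae_of_all _ fun x => by ring)
  have e2 : (∫ x, w x * (-N * g (quad B (x - z) / s ^ 2) +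
      2 * g₁ (quad B (x - z) / s ^ 2) * (quad B (x - z) / s ^ 2)) ∂μ) =
      -N * (∫ x, w x * g (quad B (x - z) / s ^ 2) ∂μ) +
        ∫ x, w x * (2 * g₁ (quad B (x - z) / s ^ 2) * (quad B (x - z) / s ^ 2)) ∂μ := by
    rw [← integral_const_mul, ← integral_add ((hint g cg h0).const_mul _)
      (hint (fun q => 2 * g₁ q * q) (by fun_prop) fun q hq => by rw [h0' q hq]; ring)]
    exact integral_congr_ae (ae_of_all _ fun x => by ring)
  rw [e1, e2]
  generalize (∫ x, w x * g (quad B (x - z) / s ^ 2) ∂μ) = X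
  generalize (∫ x, w x * (2 * g₁ (quad B (x - z) / s ^ 2) * (quad B (x - z) / s ^ 2)) ∂μ) = Y
  field_simp
  ring

end Averages

end AsymptoticDev

namespace AsymptoticDev

variable {E : Type*} [NormedAddCommGroup E] [InnerProductSpace ℝ E] [FiniteDimensional ℝ E]
  [MeasurableSpace E] [BorelSpace E] {μ : Measure E} [μ.IsAddHaarMeasure]
  {a B : E →L[ℝ] E} {c : ℝ} {L : ℝ≥0}

section MeanSlope

/-- A weighted average of the slope of `v` over the half-space `⟪e, x⟫ > 0`. -/
def meanSlope (μ : Measure E) (B : E →L[ℝ] E) (e : E) (v : E → ℝ) : ℝ :=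
  ∫ x, v x * (max ⟪e, x⟫ 0 * bump₂ (quad B x)) ∂μ

/-- The logarithmic derivative in `r` of the mean slope of `rescale v r` at `r = 1`. -/
def meanSlopeDeriv (μ : Measure E) (B : E →L[ℝ] E) (e : E) (v : E → ℝ) : ℝ :=
  ∫ x, v x * (max ⟪e, x⟫ 0 * (-(Module.finrank ℝ E + 2) * bump₂ (quad B x) +
    2 * bump₃ (quad B x) * quad B x)) ∂μ

theorem integral_mul_posPart_mul_comp (v : E → ℝ) (e : E) (k : ℝ → ℝ) {s : ℝ} (hs : 0 < s) :
    ∫ x, v x * max ⟪e, x⟫ 0 * k (quad B (x - 0) / s ^ 2) ∂μ =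
      s ^ (Module.finrank ℝ E + 2) *
        ∫ x, rescale v s x * (max ⟪e, x⟫ 0 * k (quad B x)) ∂μ := by
  rw [integral_eq_pow_mul_integral_comp _ 0 hs, pow_add, mul_assoc]
  congr 1
  rw [← integral_const_mul]
  refine integral_congr_ae (ae_of_all _ fun x => ?_)
  have h1 : max ⟪e, s • x⟫ 0 = s * max ⟪e, x⟫ 0 := by
    rw [real_inner_smul_right, mul_max_of_nonneg _ _ hs.le, mul_zero]
  have h2 : s ^ 2 * quad B x / s ^ 2 = quad B x := by field_simp
  simp only [zero_add, sub_zero, h1, quad_smul, h2, rescale]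
  field_simp

theorem EllipticPair.hasDerivAt_meanSlope (hp : EllipticPair a B c) {v : E → ℝ}
    (hv : Continuous v) (e : E) {r : ℝ} (hr : 0 < r) :
    HasDerivAt (fun r => meanSlope μ B e (rescale v r))
      (r⁻¹ * meanSlopeDeriv μ B e (rescale v r)) r := by
  have hw : Continuous fun x => v x * max ⟪e, x⟫ 0 := by fun_prop
  have h := hp.hasDerivAt_average (μ := μ) hw hasDerivAt_bump₂ contDiff_bump₃.continuous
    (fun q => bump₂_eq_zero) (fun q => bump₃_eq_zero) 0 (Module.finrank ℝ E + 2) hr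
  rw [integral_mul_posPart_mul_comp v e
    (fun q => -((Module.finrank ℝ E + 2 : ℕ) : ℝ) * bump₂ q + 2 * bump₃ q * q) hr] at h
  refine (h.congr_of_eventuallyEq ?_).congr_deriv ?_
  · filter_upwards [lt_mem_nhds hr] with s hs
    rw [integral_mul_posPart_mul_comp v e bump₂ hs, inv_mul_cancel_left₀ (by positivity)]
    rfl
  · rw [pow_succ, mul_inv, mul_comm (r ^ _)⁻¹, mul_assoc, inv_mul_cancel_left₀ (by positivity)]
    simp [meanSlopeDeriv]

end MeanSlope

section Flux

/-- A smooth test function approximating `max ⟪e, x⟫ 0 * bump₁ (quad B x)`. -/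
def linTest (B : E →L[ℝ] E) (e : E) (ε : ℝ) : E → ℝ :=
  testFun B e (fun t => ε * step₀ (t / ε)) bump₁ 0

theorem hasDerivAt_mul_step₀ {ε : ℝ} (hε : 0 < ε) (t : ℝ) :
    HasDerivAt (fun t => ε * step₀ (t / ε)) (step₁ (t / ε)) t := by
  refine (((hasDerivAt_step₀ (t / ε)).comp t ((hasDerivAt_id t).div_const ε)).const_mul
    ε).congr_deriv ?_
  field_simp

theorem hasDerivAt_step₁_div (ε t : ℝ) :
    HasDerivAt (fun t => step₁ (t / ε)) (step₂ (t / ε) / ε) t := by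
  refine ((hasDerivAt_step₁ (t / ε)).comp t ((hasDerivAt_id t).div_const ε)).congr_deriv ?_
  ring

theorem hasDerivAt_neg_bump₂ (q : ℝ) : HasDerivAt (fun q => -bump₂ q) (bump₃ q) q :=
  (hasDerivAt_bump₂ q).neg.congr_deriv (neg_neg _)

omit [FiniteDimensional ℝ E] [MeasurableSpace E] [BorelSpace E] in
theorem contDiff_linTest (B : E →L[ℝ] E) (e : E) (ε : ℝ) :
    ContDiff ℝ (⊤ : ℕ∞) (linTest B e ε) :=
  contDiff_testFun (contDiff_const.mul (contDiff_step₀.comp (contDiff_id.div_const _)))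
    contDiff_bump₁ 0

omit [FiniteDimensional ℝ E] [MeasurableSpace E] [BorelSpace E] in
theorem EllipticPair.tsupport_testFun_subset (hp : EllipticPair a B c) {h G : ℝ → ℝ} {ε R : ℝ}
    (hh : ∀ t, t ≤ ε → h t = 0) (hG : ∀ q, R ≤ q → G q = 0) (e z : E) :
    tsupport (testFun B e h G z) ⊆ {x | ε ≤ ⟪e, x⟫} ∩ closedBall z (R / c + 1) := by
  refine closure_minimal (fun x hx => ?_) ((isClosed_le (by fun_prop) (by fun_prop)).inter
    isClosed_closedBall)
  rw [Function.mem_support, testFun, mul_ne_zero_iff] at hx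
  refine ⟨(not_lt.1 fun hlt => hx.1 (hh _ hlt.le)), ?_⟩
  rw [mem_closedBall, dist_eq_norm]
  exact hp.norm_le_of_quad_le (not_lt.1 fun hlt => hx.2 (hG _ hlt.le))

omit [FiniteDimensional ℝ E] [MeasurableSpace E] [BorelSpace E] in
theorem EllipticPair.tsupport_linTest_subset (hp : EllipticPair a B c) (e : E) {ε : ℝ}
    (hε : 0 < ε) :
    tsupport (linTest B e ε) ⊆ {x | ε ≤ ⟪e, x⟫} ∩ closedBall 0 (1 / c + 1) :=
  hp.tsupport_testFun_subset
    (fun t ht => by rw [step₀_eq_zero ((div_le_one hε).2 ht), mul_zero])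
    (fun q hq => bump₁_eq_zero hq) e 0

omit [InnerProductSpace ℝ E] [FiniteDimensional ℝ E] [BorelSpace E] in
theorem norm_integral_le_of_support {X : Type*} [NormedAddCommGroup X] [NormedSpace ℝ X] {K : Set E}
    (hK : IsCompact K) {F : E → X} {C : ℝ} (h1 : ∀ x ∈ K, ‖F x‖ ≤ C) (h2 : ∀ x ∉ K, F x = 0) :
    ‖∫ x, F x ∂μ‖ ≤ C * μ.real K := by
  rw [← setIntegral_eq_integral_of_forall_compl_eq_zero h2]
  exact norm_setIntegral_le_of_norm_le_const hK.measure_lt_top h1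

theorem EllipticPair.exists_flux_estimate (hp : EllipticPair a B c) (e : E) (L : ℝ≥0) :
    ∃ C : ℝ, 0 ≤ C ∧ ∀ ε η : ℝ, 0 < ε → ε ≤ 1 → 0 ≤ η → ∀ v : E → ℝ, LipschitzWith L v → v 0 = 0 →
      |∫ x, fderiv ℝ v x (a (gradient (linTest B e ε) x)) ∂μ| ≤
        η * (∫ x, |linTest B e ε x| ∂μ + ∫ x, ‖gradient (linTest B e ε) x‖ ∂μ) →
      |2 * meanSlopeDeriv μ B e v +
        ⟪e, a e⟫ * ∫ x, v x * (step₂ (⟪e, x⟫ / ε) / ε * bump₁ (quad B x)) ∂μ| ≤ C * (η + ε) := by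
  obtain ⟨D₁, hD₁0, hD₁⟩ := exists_abs_le_of_eq_zero contDiff_bump₁.continuous
    (fun q => bump₁_eq_zero)
  obtain ⟨D₂, hD₂0, hD₂⟩ := exists_abs_le_of_eq_zero contDiff_bump₂.continuous
    (fun q => bump₂_eq_zero)
  obtain ⟨D₃, hD₃0, hD₃⟩ := exists_abs_le_of_eq_zero contDiff_bump₃.continuous
    (fun q => bump₃_eq_zero)
  have hc0 := hp.pos
  set R : ℝ := 1 / c + 1 with hR
  have hR0 : 0 < R := by positivity
  set K : Set E := closedBall 0 R
  have hK : IsCompact K := isCompact_closedBall _ _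
  have hKc (x : E) (hx : x ∉ K) : 1 ≤ quad B x := by
    by_contra! hlt
    exact hx (mem_closedBall_zero_iff.2 (hp.norm_le_of_quad_le hlt.le))
  set d : ℝ := (Module.finrank ℝ E : ℝ)
  have hd0 : 0 ≤ d := Nat.cast_nonneg _
  set C₁ : ℝ := ‖e‖ * R * D₁
  set C₂ : ℝ := 1 * D₁ * ‖e‖ + 2 * (‖e‖ * R) * D₂ * (‖B‖ * R)
  set C₃ : ℝ := L * R * (4 * D₂ * 2 + 2 * (2 * d * D₂ + 4 * (D₃ * 1)))
  refine ⟨(C₁ + C₂ + C₃) * μ.real K, by positivity, ?_⟩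
  intro ε η hε hε1 hη v hv hv0 hflux
  have hℓ (x : E) (hx : x ∈ K) : max ⟪e, x⟫ 0 ≤ ‖e‖ * R := by
    refine max_le ((real_inner_le_norm e x).trans ?_) (by positivity)
    gcongr
    simpa [K] using hx
  have hh (x : E) : |ε * step₀ (⟪e, x⟫ / ε)| ≤ max ⟪e, x⟫ 0 := by
    rw [abs_of_nonneg (mul_nonneg hε.le (step₀_nonneg _))]
    have := mul_le_mul_of_nonneg_left (step₀_le_max (⟪e, x⟫ / ε)) hε.le
    rwa [mul_max_of_nonneg _ _ hε.le, mul_div_cancel₀ _ hε.ne', mul_zero] at this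
  have hh' (x : E) : |ε * step₀ (⟪e, x⟫ / ε) - max ⟪e, x⟫ 0| ≤ 2 * ε := by
    have h1 := mul_le_mul_of_nonneg_left (step₀_le_max (⟪e, x⟫ / ε)) hε.le
    have h2 := mul_le_mul_of_nonneg_left (max_sub_le_step₀ (⟪e, x⟫ / ε)) hε.le
    rw [mul_sub] at h2
    rw [mul_max_of_nonneg _ _ hε.le, mul_div_cancel₀ _ hε.ne', mul_zero] at h1 h2
    rw [abs_le]
    constructor <;> linarith
  have hh1 (x : E) : |step₁ (⟪e, x⟫ / ε) * ⟪e, x⟫ - max ⟪e, x⟫ 0| ≤ 2 * ε := by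
    have h1 := mul_le_mul_of_nonneg_left (abs_mul_step₁_sub_max_le (⟪e, x⟫ / ε)) hε.le
    rw [← abs_of_pos hε, ← abs_mul, abs_of_pos hε, mul_sub, mul_max_of_nonneg _ _ hε.le,
      ← mul_assoc, mul_div_cancel₀ _ hε.ne', mul_zero] at h1
    rw [mul_comm (step₁ _)]
    linarith
  have hφ : ∫ x, |linTest B e ε x| ∂μ ≤ C₁ * μ.real K := by
    refine (Real.le_norm_self _).trans (norm_integral_le_of_support hK
      (fun x hx => ?_) fun x hx => ?_)
    · rw [Real.norm_eq_abs, abs_abs, linTest, testFun, abs_mul, sub_zero]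
      refine mul_le_mul ?_ ?_ (abs_nonneg _) (by positivity)
      · exact (hh x).trans (hℓ x hx)
      · exact hD₁ _ (hp.quad_nonneg x)
    · rw [linTest, testFun, sub_zero, bump₁_eq_zero (hKc x hx), mul_zero, abs_zero]
  have hφ' : ∫ x, ‖gradient (linTest B e ε) x‖ ∂μ ≤ C₂ * μ.real K := by
    simp only [linTest, hp.gradient_testFun (hasDerivAt_mul_step₀ hε) hasDerivAt_bump₁]
    refine (Real.le_norm_self _).trans (norm_integral_le_of_support hK
      (fun x hx => ?_) fun x hx => ?_)
    · rw [norm_norm, testGrad, sub_zero]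
      refine (norm_add_le _ _).trans (add_le_add ?_ ?_)
      · rw [norm_smul, norm_mul]
        gcongr
        · exact abs_le.2 ⟨by linarith [step₁_nonneg (⟪e, x⟫ / ε)], step₁_le_one _⟩
        · exact hD₁ _ (hp.quad_nonneg x)
      · rw [norm_smul, norm_mul, norm_mul, Real.norm_ofNat, norm_neg]
        gcongr
        · exact (hh x).trans (hℓ x hx)
        · exact hD₂ _ (hp.quad_nonneg x)
        · refine (B.le_opNorm x).trans ?_
          gcongr
          simpa [K] using hx
    · rw [testGrad, sub_zero, bump₁_eq_zero (hKc x hx), bump₂_eq_zero (hKc x hx)]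
      simp
  have hibp := hp.integral_fderiv_gradient_testFun (μ := μ) hv (hasDerivAt_mul_step₀ hε)
    (hasDerivAt_step₁_div ε) (by have := contDiff_step₂.continuous; fun_prop) hasDerivAt_bump₁
    hasDerivAt_neg_bump₂ contDiff_bump₃.continuous (fun q => bump₁_eq_zero)
    (fun q hq => by rw [bump₂_eq_zero hq, neg_zero]) e 0
  have cs₀ := contDiff_step₀.continuous
  have cs₁ := contDiff_step₁.continuous
  have cs₂ := contDiff_step₂.continuous
  have cb₁ := contDiff_bump₁.continuous
  have cb₂ := contDiff_bump₂.continuous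
  have cb₃ := contDiff_bump₃.continuous
  have cv := hv.continuous
  have hint (F : E → ℝ) (hF : Continuous F) (hF0 : ∀ x, 1 ≤ quad B (x - 0) → F x = 0) :
      Integrable F μ := hF.integrable_of_hasCompactSupport (hp.hasCompactSupport hF0)
  set P : E → ℝ := fun x => v x * (max ⟪e, x⟫ 0 *
    (-(d + 2) * bump₂ (quad B x) + 2 * bump₃ (quad B x) * quad B x)) with hP
  set S : E → ℝ := fun x => v x * (step₂ (⟪e, x⟫ / ε) / ε * bump₁ (quad B x)) with hS
  set T : E → ℝ := fun x => v x * testOp a B e (fun t => ε * step₀ (t / ε))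
    (fun t => step₁ (t / ε)) (fun t => step₂ (t / ε) / ε) bump₁ (fun q => -bump₂ q) bump₃ 0 x
    with hT
  have iP : Integrable P μ := hint P (by simp only [hP]; fun_prop) fun x hx => by
    rw [sub_zero] at hx
    simp only [hP, bump₂_eq_zero hx, bump₃_eq_zero hx]
    ring
  have iS : Integrable S μ := hint S (by simp only [hS]; fun_prop) fun x hx => by
    rw [sub_zero] at hx
    simp only [hS, bump₁_eq_zero hx]
    ring
  have iT : Integrable T μ := hint T (by simp only [hT, testOp]; fun_prop) fun x hx => by
    simp only [hT, testOp, bump₁_eq_zero hx, bump₂_eq_zero hx, bump₃_eq_zero hx]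
    ring
  have herr : |∫ x, (2 * P x + ⟪e, a e⟫ * S x - T x) ∂μ| ≤ C₃ * ε * μ.real K := by
    rw [← Real.norm_eq_abs]
    refine norm_integral_le_of_support hK (fun x hx => ?_) fun x hx => ?_
    · have e1 : 2 * P x + ⟪e, a e⟫ * S x - T x = v x *
          (4 * bump₂ (quad B x) * (step₁ (⟪e, x⟫ / ε) * ⟪e, x⟫ - max ⟪e, x⟫ 0) +
          (ε * step₀ (⟪e, x⟫ / ε) - max ⟪e, x⟫ 0) *
            (2 * d * bump₂ (quad B x) - 4 * (bump₃ (quad B x) * quad B x))) := by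
        simp only [hP, hS, hT, testOp, sub_zero]
        ring
      have hq := hp.quad_nonneg x
      have e2 : |bump₃ (quad B x) * quad B x| ≤ D₃ * 1 := by
        rcases le_total 1 (quad B x) with hq1 | hq1
        · rw [bump₃_eq_zero hq1, zero_mul, abs_zero]
          positivity
        · rw [abs_mul, abs_of_nonneg hq]
          gcongr
          exact hD₃ _ hq
      have e3 : C₃ * ε = L * R * (4 * D₂ * (2 * ε) + 2 * ε * (2 * d * D₂ + 4 * (D₃ * 1))) := by
        simp only [C₃]
        ring
      rw [e1, e3, norm_mul]
      gcongr
      · refine (hv.abs_le hv0 x).trans ?_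
        gcongr
        simpa [K] using hx
      · refine (norm_add_le _ _).trans (add_le_add ?_ ?_)
        · rw [norm_mul, norm_mul, Real.norm_ofNat]
          gcongr
          · exact hD₂ _ hq
          · exact hh1 x
        · rw [norm_mul]
          gcongr
          · exact hh' x
          · refine (norm_sub_le _ _).trans (add_le_add ?_ ?_)
            · rw [norm_mul, norm_mul, Real.norm_ofNat, Real.norm_of_nonneg hd0]
              gcongr
              exact hD₂ _ hq
            · rw [norm_mul, Real.norm_ofNat]
              gcongr
              exact e2
    · have hx := hKc x hx
      simp only [hP, hS, hT, testOp, sub_zero, bump₁_eq_zero hx, bump₂_eq_zero hx,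
        bump₃_eq_zero hx]
      ring
  have hsplit : ∫ x, (2 * P x + ⟪e, a e⟫ * S x - T x) ∂μ =
      2 * meanSlopeDeriv μ B e v + ⟪e, a e⟫ * ∫ x, S x ∂μ - ∫ x, T x ∂μ := by
    have i1 : Integrable (fun x => 2 * P x + ⟪e, a e⟫ * S x) μ :=
      (iP.const_mul _).add (iS.const_mul _)
    rw [integral_sub i1 iT,
      integral_add (iP.const_mul _) (iS.const_mul _), integral_const_mul, integral_const_mul]
    rfl
  have hTle : |∫ x, T x ∂μ| ≤ η * (C₁ * μ.real K + C₂ * μ.real K) := by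
    rw [← abs_neg, ← hibp]
    refine hflux.trans ?_
    gcongr
  rw [hsplit] at herr
  have h1 := abs_le.1 herr
  have h2 := abs_le.1 hTle
  have hKr : 0 ≤ μ.real K := measureReal_nonneg
  have n1 : 0 ≤ C₁ * μ.real K := by positivity
  have n2 : 0 ≤ C₂ * μ.real K := by positivity
  have n3 : 0 ≤ C₃ * μ.real K := by positivity
  rw [abs_le]
  constructor <;>
    nlinarith [mul_nonneg n1 hε.le, mul_nonneg n2 hε.le, mul_nonneg n3 hη]

end Flux

end AsymptoticDev

namespace AsymptoticDev

variable {E : Type*} [NormedAddCommGroup E] [InnerProductSpace ℝ E] {a B : E →L[ℝ] E}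
  {c γ : ℝ} {L : ℝ≥0} {e : E} {U v : E → ℝ}

/-- `v` is a limit of rescalings of `U` at the origin, along some filter. -/
def IsBlowup (U v : E → ℝ) : Prop :=
  ∃ l : Filter ℝ, l.NeBot ∧ l ≤ 𝓝[>] 0 ∧ ∀ x, Tendsto (fun r => rescale U r x) l (𝓝 (v x))

theorem exists_tendsto_rescale (hU : LipschitzWith L U) (h0 : U 0 = 0) (l : Ultrafilter ℝ)
    (hl : (l : Filter ℝ) ≤ 𝓝[>] 0) :
    ∃ v : E → ℝ, ∀ x, Tendsto (fun r => rescale U r x) l (𝓝 (v x)) := by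
  have key (x : E) : ∃ y, Tendsto (fun r => rescale U r x) l (𝓝 y) := by
    have hmem : ∀ᶠ r in (l : Filter ℝ), rescale U r x ∈ Icc (-(L * ‖x‖)) (L * ‖x‖) := by
      filter_upwards [hl self_mem_nhdsWithin] with r hr
      exact abs_le.1 ((hU.rescale hr).abs_le (rescale_zero h0 r) x)
    obtain ⟨y, -, hy⟩ := isCompact_Icc.ultrafilter_le_nhds (l.map fun r => rescale U r x)
      (le_principal_iff.2 hmem)
    exact ⟨y, hy⟩
  choose v hv using key
  exact ⟨v, hv⟩

theorem IsBlowup.lipschitz (hv : IsBlowup U v) (hU : LipschitzWith L U) : LipschitzWith L v := by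
  obtain ⟨l, hl, hl0, hlim⟩ := hv
  refine LipschitzWith.of_dist_le_mul fun x y => ?_
  refine le_of_tendsto ((hlim x).dist (hlim y)) ?_
  filter_upwards [hl0 self_mem_nhdsWithin] with r hr
  exact (hU.rescale hr).dist_le_mul x y

theorem IsBlowup.zero (hv : IsBlowup U v) (h0 : U 0 = 0) : v 0 = 0 := by
  obtain ⟨l, hl, -, hlim⟩ := hv
  refine tendsto_nhds_unique (hlim 0) ?_
  simp only [rescale_zero h0]
  exact tendsto_const_nhds

theorem IsBlowup.rescale_of_pos (hv : IsBlowup U v) {t : ℝ} (ht : 0 < t) :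
    IsBlowup U (rescale v t) := by
  obtain ⟨l, hl, hl0, hlim⟩ := hv
  refine ⟨l.map (· * t), inferInstance, ?_, fun x => ?_⟩
  · refine (map_mono hl0).trans ?_
    refine tendsto_nhdsWithin_iff.2 ⟨tendsto_nhdsWithin_of_tendsto_nhds ?_, ?_⟩
    · simpa using (continuous_mul_const t).tendsto 0
    · filter_upwards [self_mem_nhdsWithin] with r (hr : 0 < r)
      exact mul_pos hr ht
  · rw [tendsto_map'_iff]
    refine ((hlim (t • x)).div_const t).congr fun r => ?_
    simp only [Function.comp_apply, ← rescale_rescale]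
    rfl

theorem EllipticPair.hasCompactSupport_posPart_mul [FiniteDimensional ℝ E]
    (hp : EllipticPair a B c) (e : E) {k : ℝ → ℝ}
    (hk : ∀ q, 1 ≤ q → k q = 0) : HasCompactSupport fun x => max ⟪e, x⟫ 0 * k (quad B x) :=
  hp.hasCompactSupport (R := 1) (z := 0) fun x hx => by
    rw [sub_zero] at hx
    rw [hk _ hx, mul_zero]

theorem continuous_posPart_mul (B : E →L[ℝ] E) (e : E) {k : ℝ → ℝ} (hk : Continuous k) :
    Continuous fun x => max ⟪e, x⟫ 0 * k (quad B x) := by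
  fun_prop

variable [FiniteDimensional ℝ E] [MeasurableSpace E] [BorelSpace E] {μ : Measure E}

/-- The rescalings of the Lipschitz function `U` are nonnegative and approximately solve
`div (a ∇ U) = 0`, up to an error of order `r ^ γ`, on half-balls of `⟪e, x⟫ > C r`. -/
structure AlmostSolution (μ : Measure E) (a : E →L[ℝ] E) (e : E) (γ : ℝ) (L : ℝ≥0) (U : E → ℝ) :
    Prop where
  lipschitz : LipschitzWith L U
  zero : U 0 = 0
  estimate : ∀ R : ℝ, ∃ C > 0, ∀ᶠ r in 𝓝[>] (0 : ℝ),
    (∀ x, ‖x‖ < R → C * r < ⟪e, x⟫ → 0 ≤ rescale U r x) ∧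
    ∀ φ : E → ℝ, ContDiff ℝ (⊤ : ℕ∞) φ → HasCompactSupport φ →
      tsupport φ ⊆ {x | ‖x‖ < R ∧ C * r < ⟪e, x⟫} →
      |∫ x, fderiv ℝ (rescale U r) x (a (gradient φ x)) ∂μ| ≤
        C * r ^ γ * (∫ x, |φ x| ∂μ + ∫ x, ‖gradient φ x‖ ∂μ)

section Monotonicity

variable [μ.IsAddHaarMeasure]

theorem EllipticPair.abs_meanSlope_le (hp : EllipticPair a B c) (hv : LipschitzWith L v)
    (h0 : v 0 = 0) :
    |meanSlope μ B e v| ≤ ∫ x, L * ‖x‖ * |max ⟪e, x⟫ 0 * bump₂ (quad B x)| ∂μ := by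
  have hc := hp.hasCompactSupport_posPart_mul e (fun q => bump₂_eq_zero (q := q))
  have hk := continuous_posPart_mul B e contDiff_bump₂.continuous
  have hi : Integrable (fun x => L * ‖x‖ * |max ⟪e, x⟫ 0 * bump₂ (quad B x)|) μ :=
    Continuous.integrable_of_hasCompactSupport (by fun_prop) (hc.norm.mul_left)
  rw [meanSlope, ← Real.norm_eq_abs]
  refine norm_integral_le_of_norm_le hi (ae_of_all _ fun x => ?_)
  rw [norm_mul]
  exact mul_le_mul_of_nonneg_right (hv.abs_le h0 x) (norm_nonneg _)

theorem AlmostSolution.eventually_meanSlopeDeriv_le (hU : AlmostSolution μ a e γ L U)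
    (hp : EllipticPair a B c) (hγ0 : 0 < γ) (hγ1 : γ < 1) :
    ∃ C, ∀ᶠ r in 𝓝[>] (0 : ℝ), meanSlopeDeriv μ B e (rescale U r) ≤ C * r ^ γ := by
  have hp' := hp.pos
  obtain ⟨C₀, hC₀, hflux⟩ := hp.exists_flux_estimate (μ := μ) e L
  obtain ⟨C, hC, hest⟩ := hU.estimate (1 / c + 2)
  refine ⟨C₀ * (3 * C) / 2, ?_⟩
  have hev : ∀ᶠ r in 𝓝[>] (0 : ℝ), r < min 1 (1 / (2 * C)) :=
    mem_nhdsWithin_of_mem_nhds (gt_mem_nhds (by positivity))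
  filter_upwards [hest, hev, self_mem_nhdsWithin] with r ⟨hpos, hweak⟩ hr (hr0 : 0 < r)
  have hr1 : r ≤ 1 := (hr.trans_le (min_le_left _ _)).le
  have hr2 : 2 * C * r ≤ 1 := by
    have := (hr.trans_le (min_le_right _ _)).le
    rw [le_div_iff₀ (by positivity)] at this
    linarith
  have hε : 0 < 2 * C * r := by positivity
  have hsub : {x : E | 2 * C * r ≤ ⟪e, x⟫} ∩ closedBall 0 (1 / c + 1) ⊆
      {x | ‖x‖ < 1 / c + 2 ∧ C * r < ⟪e, x⟫} := by
    rintro x ⟨h1, h2⟩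
    rw [mem_closedBall_zero_iff] at h2
    rw [mem_ofPred_eq] at h1
    have : 0 < C * r := by positivity
    exact ⟨by linarith, by linarith⟩
  have h1 := hflux (2 * C * r) (C * r ^ γ) hε hr2 (by positivity) (rescale U r)
    (hU.lipschitz.rescale hr0) (rescale_zero hU.zero r)
    (hweak _ (contDiff_linTest B e _)
      (HasCompactSupport.of_support_subset_isCompact (isCompact_closedBall 0 (1 / c + 1))
        fun x hx => (hp.tsupport_linTest_subset e hε (subset_tsupport _ hx)).2)
      ((hp.tsupport_linTest_subset e hε).trans hsub))
  have h2 : 0 ≤ ∫ x, rescale U r x *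
      (step₂ (⟪e, x⟫ / (2 * C * r)) / (2 * C * r) * bump₁ (quad B x)) ∂μ := by
    refine integral_nonneg fun x => ?_
    by_cases hx1 : ⟪e, x⟫ / (2 * C * r) < 1
    · simp [step₂_eq_zero (Or.inl hx1)]
    by_cases hx2 : 1 ≤ quad B x
    · simp [bump₁_eq_zero hx2]
    · have hx := hsub (a := x) ⟨by
        simpa using (le_div_iff₀ hε).1 (not_lt.1 hx1), mem_closedBall_zero_iff.2
          (hp.norm_le_of_quad_le (not_le.1 hx2).le)⟩
      exact mul_nonneg (hpos x hx.1 hx.2)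
        (mul_nonneg (div_nonneg (step₂_nonneg _) hε.le) (bump₁_nonneg _))
  have h3 : 0 ≤ ⟪e, a e⟫ := by
    have := (mul_nonneg hp.pos.le (sq_nonneg _)).trans (hp.coercive (a e))
    rwa [hp.left_inv] at this
  have h4 : r ≤ r ^ γ := by
    simpa using Real.rpow_le_rpow_of_exponent_ge hr0 hr1 hγ1.le
  have h5 := (abs_le.1 h1).2
  have h6 := mul_nonneg h3 h2
  have h7 : C₀ * (C * r ^ γ + 2 * C * r) ≤ C₀ * (3 * C) * r ^ γ := by
    have : 2 * C * r ≤ 2 * C * r ^ γ := by gcongr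
    calc C₀ * (C * r ^ γ + 2 * C * r) ≤ C₀ * (C * r ^ γ + 2 * C * r ^ γ) := by gcongr
      _ = C₀ * (3 * C) * r ^ γ := by ring
  linarith

theorem AlmostSolution.exists_tendsto_meanSlope (hU : AlmostSolution μ a e γ L U)
    (hp : EllipticPair a B c) (hγ0 : 0 < γ) (hγ1 : γ < 1) :
    ∃ κ, Tendsto (fun r => meanSlope μ B e (rescale U r)) (𝓝[>] 0) (𝓝 κ) := by
  obtain ⟨C, hC⟩ := hU.eventually_meanSlopeDeriv_le hp hγ0 hγ1
  obtain ⟨r₀, hr₀, hr₀'⟩ := mem_nhdsGT_iff_exists_Ioo_subset.1 hC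
  have hr₀ : 0 < r₀ := hr₀
  set F : ℝ → ℝ := fun r => meanSlope μ B e (rescale U r) - C / γ * r ^ γ with hF
  have hder : ∀ r, 0 < r → HasDerivAt F (r⁻¹ * meanSlopeDeriv μ B e (rescale U r) -
      C / γ * (γ * r ^ (γ - 1))) r := fun r hr =>
    (hp.hasDerivAt_meanSlope hU.lipschitz.continuous e hr).sub
      ((Real.hasDerivAt_rpow_const (Or.inl hr.ne')).const_mul _)
  have hanti : AntitoneOn F (Ioo 0 r₀) := by
    refine antitoneOn_of_deriv_nonpos (convex_Ioo _ _)
      (fun r hr => (hder r hr.1).continuousAt.continuousWithinAt)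
      (fun r hr => ?_) fun r hr => ?_
    · rw [interior_Ioo] at hr
      exact (hder r hr.1).differentiableAt.differentiableWithinAt
    · rw [interior_Ioo] at hr
      have hr0 := hr.1
      have h1 : meanSlopeDeriv μ B e (rescale U r) ≤ C * r ^ γ := hr₀' hr
      have h2 : C / γ * (γ * r ^ (γ - 1)) = r⁻¹ * (C * r ^ γ) := by
        rw [Real.rpow_sub_one hr0.ne']
        field_simp
      rw [(hder r hr0).deriv, h2, sub_nonpos]
      gcongr
  have hbdd : BddAbove (F '' Ioo 0 r₀) := by
    refine ⟨(∫ x, L * ‖x‖ * |max ⟪e, x⟫ 0 * bump₂ (quad B x)| ∂μ) + |C / γ| * r₀ ^ γ, ?_⟩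
    rintro _ ⟨r, hr, rfl⟩
    have hr0 := hr.1
    have h1 := (abs_le.1 (hp.abs_meanSlope_le (μ := μ) (e := e) (hU.lipschitz.rescale hr.1)
      (rescale_zero hU.zero r))).2
    have h2 : -(C / γ * r ^ γ) ≤ |C / γ| * r₀ ^ γ := by
      refine (neg_le_abs _).trans ?_
      rw [abs_mul, abs_of_nonneg (Real.rpow_nonneg hr0.le γ)]
      gcongr
      exact hr.2.le
    simp only [hF]
    linarith
  have hlim := hanti.tendsto_nhdsWithin_Ioo_right (nonempty_Ioo.2 hr₀) hbdd
  have hpow : Tendsto (fun r : ℝ => C / γ * r ^ γ) (𝓝[>] 0) (𝓝 (C / γ * 0)) := by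
    refine Tendsto.const_mul _ (tendsto_nhdsWithin_of_tendsto_nhds ?_)
    have := (Real.continuousAt_rpow_const 0 γ (Or.inr hγ0.le)).tendsto
    rwa [Real.zero_rpow hγ0.ne'] at this
  exact ⟨_, (hlim.add hpow).congr fun r => by simp [hF]⟩

end Monotonicity

section Blowup

omit [BorelSpace E] in
theorem IsBlowup.nonneg (hv : IsBlowup U v) (hU : AlmostSolution μ a e γ L U) (he : e ≠ 0) {x : E}
    (hx : 0 ≤ ⟪e, x⟫) : 0 ≤ v x := by
  have hvc := (hv.lipschitz hU.lipschitz).continuous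
  obtain ⟨l, hl, hl0, hlim⟩ := hv
  have hpos (y : E) (hy : 0 < ⟪e, y⟫) : 0 ≤ v y := by
    obtain ⟨C, hC, hest⟩ := hU.estimate (‖y‖ + 1)
    refine ge_of_tendsto (hlim y) ?_
    have hev : ∀ᶠ r in 𝓝[>] (0 : ℝ), r < ⟪e, y⟫ / C :=
      mem_nhdsWithin_of_mem_nhds (gt_mem_nhds (by positivity))
    filter_upwards [hl0 hest, hl0 hev] with r h1 h2
    rw [lt_div_iff₀ hC] at h2
    exact h1.1 y (by linarith) (by linarith)
  have ht : Tendsto (fun t : ℝ => v (x + t • e)) (𝓝[>] 0) (𝓝 (v x)) := by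
    have : Continuous fun t : ℝ => v (x + t • e) := by fun_prop
    simpa using (this.tendsto 0).mono_left nhdsWithin_le_nhds
  refine ge_of_tendsto ht ?_
  filter_upwards [self_mem_nhdsWithin] with t (ht : 0 < t)
  refine hpos _ ?_
  rw [inner_add_right, real_inner_smul_right]
  have : 0 < ⟪e, e⟫ := real_inner_self_pos.2 he
  positivity

variable [μ.IsAddHaarMeasure]

theorem IsBlowup.meanSlope_eq (hv : IsBlowup U v) (hU : LipschitzWith L U)
    (hp : EllipticPair a B c) {κ : ℝ}
    (hκ : Tendsto (fun r => meanSlope μ B e (rescale U r)) (𝓝[>] 0) (𝓝 κ)) :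
    meanSlope μ B e v = κ := by
  have hvL := hv.lipschitz hU
  obtain ⟨l, hl, hl0, hlim⟩ := hv
  have hev : ∀ᶠ r in l, LipschitzWith L (rescale U r) := by
    filter_upwards [hl0 self_mem_nhdsWithin] with r hr using hU.rescale hr
  exact tendsto_nhds_unique (tendsto_integral_mul_of_lipschitz hev hvL hlim
    (continuous_posPart_mul B e contDiff_bump₂.continuous)
    (hp.hasCompactSupport_posPart_mul e (fun q => bump₂_eq_zero (q := q)))) (hκ.mono_left hl0)

theorem IsBlowup.integral_fderiv_testFun (hv : IsBlowup U v) (hU : AlmostSolution μ a e γ L U)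
    (hγ : 0 < γ) (hp : EllipticPair a B c) {h h₁ h₂ G G₁ G₂ : ℝ → ℝ} {ε R : ℝ} (hε : 0 < ε)
    (hh : ∀ t, HasDerivAt h (h₁ t) t) (hh₁ : ∀ t, HasDerivAt h₁ (h₂ t) t) (hh₂ : Continuous h₂)
    (hG : ∀ t, HasDerivAt G (G₁ t) t) (hG₁ : ∀ t, HasDerivAt G₁ (G₂ t) t) (hG₂ : Continuous G₂)
    (hhs : ContDiff ℝ (⊤ : ℕ∞) h) (hGs : ContDiff ℝ (⊤ : ℕ∞) G) (h0 : ∀ t, t ≤ ε → h t = 0)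
    (hR : ∀ q, R ≤ q → G q = 0) (hR₁ : ∀ q, R ≤ q → G₁ q = 0) (hR₂ : ∀ q, R ≤ q → G₂ q = 0)
    (z : E) :
    ∫ x, fderiv ℝ v x (a (gradient (testFun B e h G z) x)) ∂μ = 0 := by
  have hvL := hv.lipschitz hU.lipschitz
  obtain ⟨l, hl, hl0, hlim⟩ := hv
  have hev : ∀ᶠ r in l, LipschitzWith L (rescale U r) := by
    filter_upwards [hl0 self_mem_nhdsWithin] with r hr using hU.lipschitz.rescale hr
  have ch : Continuous h := hhs.continuous
  have ch₁ : Continuous h₁ := continuous_iff_continuousAt.2 fun t => (hh₁ t).continuousAt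
  have cG : Continuous G := hGs.continuous
  have cG₁ : Continuous G₁ := continuous_iff_continuousAt.2 fun t => (hG₁ t).continuousAt
  have hconv := (tendsto_integral_mul_of_lipschitz (μ := μ) hev hvL hlim
    (ψ := testOp a B e h h₁ h₂ G G₁ G₂ z) (by unfold testOp; fun_prop)
    (hp.hasCompactSupport (R := R) (z := z) fun x hx => by
      simp [testOp, hR _ hx, hR₁ _ hx, hR₂ _ hx])).neg
  rw [← hp.integral_fderiv_gradient_testFun hvL hh hh₁ hh₂ hG hG₁ hG₂ hR hR₁] at hconv
  refine tendsto_nhds_unique hconv ?_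
  obtain ⟨C, hC, hest⟩ := hU.estimate (‖z‖ + (R / c + 1) + 1)
  have hsub := hp.tsupport_testFun_subset h0 hR e z
  set I := ∫ x, |testFun B e h G z x| ∂μ + ∫ x, ‖gradient (testFun B e h G z) x‖ ∂μ
  have hpow : Tendsto (fun r : ℝ => C * r ^ γ * I) l (𝓝 (C * 0 * I)) := by
    refine ((Tendsto.const_mul _ ?_).mul_const _).mono_left (hl0.trans nhdsWithin_le_nhds)
    have := (Real.continuousAt_rpow_const 0 γ (Or.inr hγ.le)).tendsto
    rwa [Real.zero_rpow hγ.ne'] at this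
  rw [mul_zero, zero_mul] at hpow
  refine squeeze_zero_norm' ?_ hpow
  have hsmall : ∀ᶠ r in 𝓝[>] (0 : ℝ), r < ε / C :=
    mem_nhdsWithin_of_mem_nhds (gt_mem_nhds (by positivity))
  filter_upwards [hev, hl0 hest, hl0 hsmall] with r hr h1 h2
  rw [← hp.integral_fderiv_gradient_testFun hr hh hh₁ hh₂ hG hG₁ hG₂ hR hR₁]
  refine h1.2 _ (contDiff_testFun hhs hGs z)
    (HasCompactSupport.of_support_subset_isCompact (isCompact_closedBall z (R / c + 1))
        fun x hx => (hsub (subset_tsupport _ hx)).2) fun x hx => ?_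
  obtain ⟨hx1, hx2⟩ := hsub hx
  rw [mem_closedBall, dist_eq_norm] at hx2
  rw [lt_div_iff₀ hC] at h2
  rw [mem_ofPred_eq] at hx1
  exact ⟨by linarith [norm_le_norm_add_norm_sub' x z], by linarith⟩

end Blowup

end AsymptoticDev

namespace AsymptoticDev

variable {E : Type*} [NormedAddCommGroup E] [InnerProductSpace ℝ E] [FiniteDimensional ℝ E]
  [MeasurableSpace E] [BorelSpace E] {μ : Measure E} [μ.IsAddHaarMeasure]
  {a B : E →L[ℝ] E} {c γ : ℝ} {L : ℝ≥0} {e : E} {U v : E → ℝ}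

section Vanishing

theorem IsBlowup.meanSlopeDeriv_eq_zero (hv : IsBlowup U v) (hU : AlmostSolution μ a e γ L U)
    (hp : EllipticPair a B c) (hγ0 : 0 < γ) (hγ1 : γ < 1) : meanSlopeDeriv μ B e v = 0 := by
  obtain ⟨κ, hκ⟩ := hU.exists_tendsto_meanSlope hp hγ0 hγ1
  have h1 := hp.hasDerivAt_meanSlope (μ := μ) (hv.lipschitz hU.lipschitz).continuous e one_pos
  have h2 : HasDerivAt (fun r => meanSlope μ B e (rescale v r)) 0 1 :=
    (hasDerivAt_const 1 κ).congr_of_eventuallyEq <| by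
      filter_upwards [lt_mem_nhds one_pos] with r hr
      exact (hv.rescale_of_pos hr).meanSlope_eq hU.lipschitz hp hκ
  have h3 := h1.unique h2
  have h4 : rescale v 1 = v := by
    funext x
    simp [rescale]
  rwa [h4, inv_one, one_mul] at h3

theorem IsBlowup.exists_boundary_integral_le (hv : IsBlowup U v)
    (hU : AlmostSolution μ a e γ L U) (hp : EllipticPair a B c) (hγ0 : 0 < γ) (hγ1 : γ < 1) :
    ∃ C : ℝ, ∀ ε, 0 < ε → ε ≤ 1 →
      ⟪e, a e⟫ * ∫ x, v x * (step₂ (⟪e, x⟫ / ε) / ε * bump₁ (quad B x)) ∂μ ≤ C * ε := by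
  obtain ⟨C, hC, hflux⟩ := hp.exists_flux_estimate (μ := μ) e L
  refine ⟨C, fun ε hε hε1 => ?_⟩
  have h0 : ∫ x, fderiv ℝ v x (a (gradient (linTest B e ε) x)) ∂μ = 0 :=
    hv.integral_fderiv_testFun hU hγ0 hp hε (hasDerivAt_mul_step₀ hε) (hasDerivAt_step₁_div ε)
      (by have := contDiff_step₂.continuous; fun_prop) hasDerivAt_bump₁ hasDerivAt_neg_bump₂
      contDiff_bump₃.continuous (contDiff_const.mul (contDiff_step₀.comp (contDiff_id.div_const _)))
      contDiff_bump₁ (fun t ht => by rw [step₀_eq_zero ((div_le_one hε).2 ht), mul_zero])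
      (fun q => bump₁_eq_zero) (fun q hq => by rw [bump₂_eq_zero hq, neg_zero])
      (fun q => bump₃_eq_zero) 0
  have h1 := hflux ε 0 hε hε1 le_rfl v (hv.lipschitz hU.lipschitz) (hv.zero hU.zero)
    (by rw [h0, abs_zero, zero_mul])
  rw [hv.meanSlopeDeriv_eq_zero hU hp hγ0 hγ1, mul_zero, zero_add, zero_add] at h1
  exact (le_abs_self _).trans h1

omit [FiniteDimensional ℝ E] [MeasurableSpace E] [BorelSpace E] in
theorem EllipticPair.quad_sub_div_eq_zero {k : ℝ → ℝ} (hk : ∀ q, 1 ≤ q → k q = 0) {x y : E} {ρ : ℝ}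
    (hρ : 0 < ρ) (hx : ρ ^ 2 ≤ quad B (x - y)) : k (quad B (x - y) / ρ ^ 2) = 0 :=
  hk _ ((one_le_div (by positivity)).2 hx)

theorem hasDerivAt_comp_div {k k₁ : ℝ → ℝ} (hk : ∀ q, HasDerivAt k (k₁ q) q) (s q : ℝ) :
    HasDerivAt (fun q => k (q / s)) (k₁ (q / s) / s) q := by
  refine ((hk (q / s)).comp q ((hasDerivAt_id q).div_const s)).congr_deriv ?_
  ring

theorem EllipticPair.exists_le_boundary_integral (hp : EllipticPair a B c) (he : e ≠ 0) {y : E}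
    (hy : ⟪e, y⟫ = 0) {ρ : ℝ} (hρ : 0 < ρ) :
    ∃ A > 0, ∃ D : ℝ, ∀ ε, 0 < ε →
      A - D * ε ≤ ⟪e, a e⟫ *
        ∫ x, step₂ (⟪e, x⟫ / ε) / ε * bump₁ (quad B (x - y) / ρ ^ 2) ∂μ := by
  have ha := hp.inner_apply_self_pos he
  have cs₁ := contDiff_step₁.continuous
  have cs₂ := contDiff_step₂.continuous
  have cb₁ := contDiff_bump₁.continuous
  have cb₂ := contDiff_bump₂.continuous
  have hint (F : E → ℝ) (hF : Continuous F) (hF0 : ∀ x, ρ ^ 2 ≤ quad B (x - y) → F x = 0) :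
      Integrable F μ := hF.integrable_of_hasCompactSupport (hp.hasCompactSupport hF0)
  set β : E → ℝ := fun x => bump₂ (quad B (x - y) / ρ ^ 2) with hβ
  have cβ : Continuous β := by fun_prop
  have hβ0 (x : E) (hx : ρ ^ 2 ≤ quad B (x - y)) : β x = 0 :=
    quad_sub_div_eq_zero (fun q => bump₂_eq_zero) hρ hx
  have iβ : Integrable β μ := hint β cβ hβ0
  have iβ' : Integrable (fun x => max ⟪e, x⟫ 0 * β x) μ :=
    hint _ (by fun_prop) fun x hx => by rw [hβ0 x hx, mul_zero]
  have hpos : 0 < ∫ x, max ⟪e, x⟫ 0 * β x ∂μ := by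
    refine Continuous.integral_pos_of_hasCompactSupport_nonneg_nonzero (by fun_prop)
      (hp.hasCompactSupport (R := ρ ^ 2) (z := y) fun x hx => by rw [hβ0 x hx, mul_zero])
      (fun x => mul_nonneg (le_max_right _ _) (bump₂_nonneg _))
      (x := y + (ρ / (quad B (a e) + 1)) • a e) ?_
    have hq : 0 ≤ quad B (a e) := hp.quad_nonneg _
    rw [inner_add_right, hy, real_inner_smul_right, zero_add, max_eq_left (by positivity)]
    refine (mul_pos (by positivity) (bump₂_pos ?_)).ne'
    rw [add_sub_cancel_left, quad_smul, div_lt_one (by positivity), div_pow, div_mul_eq_mul_div,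
      div_lt_iff₀ (by positivity)]
    have : 0 < ρ ^ 2 := by positivity
    gcongr
    nlinarith
  refine ⟨2 / ρ ^ 2 * ∫ x, max ⟪e, x⟫ 0 * β x ∂μ, by positivity,
    2 / ρ ^ 2 * (2 * ∫ x, β x ∂μ), fun ε hε => ?_⟩
  have hder : ∀ x, HasFDerivAt (fun x => (step₁ (⟪e, x⟫ / ε) *
      bump₁ (quad B (x - y) / ρ ^ 2)) • a e) _ x := fun x =>
    (hp.hasFDerivAt_mul (hasDerivAt_step₁_div ε) (hasDerivAt_comp_div hasDerivAt_bump₁ (ρ ^ 2))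
      e y x).smul_const (a e)
  have hdiv := integral_fderiv_apply_eq_neg_integral_mul_trace (μ := μ) (C := 0)
    (LipschitzWith.const (1 : ℝ)) hder
    (by
      have : Continuous fun w : E => innerSL ℝ w := (innerSL ℝ (E := E)).continuous
      refine (ContinuousLinearMap.smulRightL ℝ E E).continuous₂.comp
        ((this.comp ?_).prodMk continuous_const)
      unfold testGrad
      fun_prop)
    (hp.hasCompactSupport (R := ρ ^ 2) (z := y) fun x hx => by
      rw [quad_sub_div_eq_zero (fun q => bump₁_eq_zero) hρ hx, mul_zero, zero_smul])
  have htr (x : E) : LinearMap.trace ℝ E ((innerSL ℝ (testGrad B e (fun t => step₁ (t / ε))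
      (fun t => step₂ (t / ε) / ε) (fun q => bump₁ (q / ρ ^ 2))
      (fun q => -bump₂ (q / ρ ^ 2) / ρ ^ 2) y x)).smulRight (a e)).toLinearMap =
      ⟪e, a e⟫ * (step₂ (⟪e, x⟫ / ε) / ε * bump₁ (quad B (x - y) / ρ ^ 2)) -
        2 / ρ ^ 2 * (step₁ (⟪e, x⟫ / ε) * ⟪e, x⟫ * β x) := by
    refine (LinearMap.trace_smulRight _ _).trans ?_
    simp only [testGrad, ContinuousLinearMap.coe_coe, innerSL_apply_apply, inner_add_left,
      real_inner_smul_left, hp.inner_apply, inner_sub_right, hy, hβ]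
    ring
  simp only [htr, fderiv_fun_const, Pi.zero_apply, zero_apply, integral_zero,
    one_mul] at hdiv
  have i1 : Integrable (fun x => step₂ (⟪e, x⟫ / ε) / ε * bump₁ (quad B (x - y) / ρ ^ 2)) μ :=
    hint _ (by fun_prop) fun x hx => by
      rw [quad_sub_div_eq_zero (fun q => bump₁_eq_zero) hρ hx, mul_zero]
  have i2 : Integrable (fun x => step₁ (⟪e, x⟫ / ε) * ⟪e, x⟫ * β x) μ :=
    hint _ (by fun_prop) fun x hx => by rw [hβ0 x hx, mul_zero]
  rw [integral_sub (i1.const_mul _) (i2.const_mul _), integral_const_mul,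
    integral_const_mul] at hdiv
  have hmono : ∫ x, (max ⟪e, x⟫ 0 * β x - 2 * ε * β x) ∂μ ≤
      ∫ x, step₁ (⟪e, x⟫ / ε) * ⟪e, x⟫ * β x ∂μ := by
    refine integral_mono (iβ'.sub (iβ.const_mul _)) i2 fun x => ?_
    have h1 := mul_le_mul_of_nonneg_left (abs_le.1 (abs_mul_step₁_sub_max_le (⟪e, x⟫ / ε))).1 hε.le
    rw [mul_sub, mul_max_of_nonneg _ _ hε.le, ← mul_assoc, mul_div_cancel₀ _ hε.ne', mul_zero]
      at h1
    have : 0 ≤ β x := bump₂_nonneg _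
    simp only
    nlinarith
  rw [integral_sub iβ' (iβ.const_mul _), integral_const_mul] at hmono
  have h2 := mul_le_mul_of_nonneg_left hmono (by positivity : 0 ≤ 2 / ρ ^ 2)
  linarith

theorem IsBlowup.eq_zero_of_quad_lt_one (hv : IsBlowup U v) (hU : AlmostSolution μ a e γ L U)
    (hp : EllipticPair a B c) (hγ0 : 0 < γ) (hγ1 : γ < 1) (he : e ≠ 0) {y : E}
    (hy : ⟪e, y⟫ = 0) (hq : quad B y < 1) : v y = 0 := by
  have hvc := (hv.lipschitz hU.lipschitz).continuous
  have cs₂ := contDiff_step₂.continuous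
  have cb₁ := contDiff_bump₁.continuous
  have ha := hp.inner_apply_self_pos he
  have hc := hp.pos
  by_contra hne
  have hvy : 0 < v y := lt_of_le_of_ne (hv.nonneg hU he hy.ge) (Ne.symm hne)
  set κ := v y * bump₁ (quad B y) / 2 with hκdef
  have hκ : 0 < κ := by
    have := bump₁_pos hq
    positivity
  have hev : ∀ᶠ x in 𝓝 y, κ < v x * bump₁ (quad B x) := by
    have hcont : Continuous fun x => v x * bump₁ (quad B x) := by fun_prop
    refine hcont.tendsto y |>.eventually (lt_mem_nhds ?_)
    linarith
  obtain ⟨δ, hδ, hball⟩ := Metric.eventually_nhds_iff.1 hev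
  set ρ := √c * δ with hρdef
  have hρ : 0 < ρ := by positivity
  have hρ2 : ρ ^ 2 = c * δ ^ 2 := by rw [hρdef, mul_pow, Real.sq_sqrt hc.le]
  have hlow (x : E) (hx : 0 ≤ ⟪e, x⟫) :
      κ * bump₁ (quad B (x - y) / ρ ^ 2) ≤ v x * bump₁ (quad B x) := by
    by_cases hxq : ρ ^ 2 ≤ quad B (x - y)
    · rw [EllipticPair.quad_sub_div_eq_zero (fun q => bump₁_eq_zero) hρ hxq, mul_zero]
      exact mul_nonneg (hv.nonneg hU he hx) (bump₁_nonneg _)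
    · have h1 : c * ‖x - y‖ ^ 2 < c * δ ^ 2 :=
        (hp.coercive (x - y)).trans_lt (hρ2 ▸ not_le.1 hxq)
      have h2 : dist x y < δ := by
        rw [dist_eq_norm]
        exact lt_of_pow_lt_pow_left₀ 2 hδ.le (lt_of_mul_lt_mul_left h1 hc.le)
      exact (mul_le_of_le_one_right hκ.le (bump₁_le_one _)).trans (hball h2).le
  obtain ⟨C, hC⟩ := hv.exists_boundary_integral_le hU hp hγ0 hγ1
  obtain ⟨A, hA, D, hD⟩ := hp.exists_le_boundary_integral (μ := μ) he hy hρ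
  have key : ∀ ε, 0 < ε → ε ≤ 1 → κ * (A - D * ε) ≤ C * ε := by
    intro ε hε hε1
    refine le_trans ?_ (hC ε hε hε1)
    refine (mul_le_mul_of_nonneg_left (hD ε hε) hκ.le).trans ?_
    rw [mul_left_comm]
    refine mul_le_mul_of_nonneg_left ?_ ha.le
    rw [← integral_const_mul]
    refine integral_mono ?_ ?_ fun x => ?_
    · exact Continuous.integrable_of_hasCompactSupport (by fun_prop)
        (hp.hasCompactSupport (R := ρ ^ 2) (z := y) fun x hx => by
          rw [EllipticPair.quad_sub_div_eq_zero (fun q => bump₁_eq_zero) hρ hx, mul_zero, mul_zero])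
    · exact Continuous.integrable_of_hasCompactSupport (by fun_prop)
        (hp.hasCompactSupport (R := 1) (z := 0) fun x hx => by
          rw [sub_zero] at hx
          rw [bump₁_eq_zero hx, mul_zero, mul_zero])
    · by_cases hx : 0 ≤ ⟪e, x⟫
      · have h1 : 0 ≤ step₂ (⟪e, x⟫ / ε) / ε := div_nonneg (step₂_nonneg _) hε.le
        have h2 := mul_le_mul_of_nonneg_left (hlow x hx) h1
        calc _ = step₂ (⟪e, x⟫ / ε) / ε * (κ * bump₁ (quad B (x - y) / ρ ^ 2)) := by ring
          _ ≤ _ := h2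
          _ = _ := by ring
      · have : ⟪e, x⟫ / ε < 1 := (div_neg_of_neg_of_pos (not_le.1 hx) hε).trans one_pos
        simp [step₂_eq_zero (Or.inl this)]
  have hκA : 0 < κ * A := mul_pos hκ hA
  set N := |C + κ * D| + 1
  have hN : 0 < N := by positivity
  have h1 := key (min 1 (κ * A / (2 * N))) (by positivity) (min_le_left _ _)
  set ε := min 1 (κ * A / (2 * N))
  have hε : 0 < ε := by positivity
  have h2 : ε * (2 * N) ≤ κ * A := (le_div_iff₀ (by positivity)).1 (min_le_right _ _)
  have h3 : (C + κ * D) * ε ≤ N * ε := by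
    gcongr
    exact (le_abs_self _).trans (by simp [N])
  nlinarith

theorem IsBlowup.eq_zero_of_inner_eq_zero (hv : IsBlowup U v) (hU : AlmostSolution μ a e γ L U)
    (hp : EllipticPair a B c) (hγ0 : 0 < γ) (hγ1 : γ < 1) (he : e ≠ 0) {y : E}
    (hy : ⟪e, y⟫ = 0) : v y = 0 := by
  have hq := hp.quad_nonneg y
  set t := quad B y + 1
  have ht : 0 < t := by positivity
  have h1 := (hv.rescale_of_pos ht).eq_zero_of_quad_lt_one hU hp hγ0 hγ1 he (y := t⁻¹ • y)
    (by rw [real_inner_smul_right, hy, mul_zero])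
    (by
      rw [quad_smul, inv_pow, inv_mul_lt_iff₀ (by positivity)]
      simp only [t]
      nlinarith)
  rw [rescale, smul_inv_smul₀ ht.ne', div_eq_zero_iff] at h1
  exact h1.resolve_right ht.ne'

end Vanishing

end AsymptoticDev

namespace AsymptoticDev

variable {E : Type*} [NormedAddCommGroup E] [InnerProductSpace ℝ E]
  {a B : E →L[ℝ] E} {c γ : ℝ} {L : ℝ≥0} {e : E} {U v : E → ℝ}

section Reflection

theorem EllipticPair.quad_sub_reflection (hp : EllipticPair a B c) (he : e ≠ 0) (z x : E) :
    quad B (x - (z - (2 * ⟪e, z⟫ / ⟪e, a e⟫) • a e)) =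
      quad B (x - z) + 4 * ⟪e, z⟫ / ⟪e, a e⟫ * ⟪e, x⟫ := by
  have ha := hp.inner_apply_self_pos he
  have h1 : x - (z - (2 * ⟪e, z⟫ / ⟪e, a e⟫) • a e) =
      (x - z) - (-(2 * ⟪e, z⟫ / ⟪e, a e⟫)) • a e := by
    rw [neg_smul, sub_neg_eq_add]
    abel
  rw [h1, hp.quad_sub, quad_smul, real_inner_smul_right, hp.inner_apply, inner_sub_right]
  rw [show quad B (a e) = ⟪e, a e⟫ by rw [quad, hp.left_inv]]
  field_simp
  ring

theorem EllipticPair.inner_reflection (hp : EllipticPair a B c) (he : e ≠ 0) (z : E) :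
    ⟪e, z - (2 * ⟪e, z⟫ / ⟪e, a e⟫) • a e⟫ = -⟪e, z⟫ := by
  have ha := hp.inner_apply_self_pos he
  rw [inner_sub_right, real_inner_smul_right, div_mul_cancel₀ _ ha.ne']
  ring

/-- A Lipschitz function vanishing on the hyperplane `⟪e, x⟫ = 0`, restricted to the half space
`0 ≤ ⟪e, x⟫` and extended by zero, is continuous and of linear growth in `⟪e, x⟫`. -/
theorem EllipticPair.exists_continuous_zero_extension (hp : EllipticPair a B c) (he : e ≠ 0)
    (hv : LipschitzWith L v) (hv0 : ∀ y, ⟪e, y⟫ = 0 → v y = 0) :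
    ∃ w : E → ℝ, Continuous w ∧ (∀ x, 0 ≤ ⟪e, x⟫ → w x = v x) ∧
      ∃ C, 0 ≤ C ∧ ∀ x, |w x| ≤ C * max ⟪e, x⟫ 0 := by
  have ha := hp.inner_apply_self_pos he
  refine ⟨fun x => if 0 ≤ ⟪e, x⟫ then v x else 0, ?_, fun x hx => if_pos hx,
    L * (‖a e‖ / ⟪e, a e⟫), by positivity, fun x => ?_⟩
  · exact Continuous.if_le hv.continuous continuous_const continuous_const (by fun_prop)
      fun x hx => hv0 x hx.symm
  · by_cases hx : 0 ≤ ⟪e, x⟫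
    · have h1 := hv.dist_le_mul x (x - (⟪e, x⟫ / ⟪e, a e⟫) • a e)
      rw [hv0 (x - _) (by rw [inner_sub_right, real_inner_smul_right,
        div_mul_cancel₀ _ ha.ne', sub_self]), Real.dist_eq, sub_zero, dist_eq_norm,
        sub_sub_cancel, norm_smul, Real.norm_of_nonneg (by positivity)] at h1
      simp only [if_pos hx, max_eq_left hx]
      refine h1.trans_eq ?_
      ring
    · simp only [if_neg hx, abs_zero]
      positivity

end Reflection

variable [FiniteDimensional ℝ E] [MeasurableSpace E] [BorelSpace E] {μ : Measure E}
  [μ.IsAddHaarMeasure]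

section MeanValue

/-- If `w` is orthogonal to the operator applied to cut-off radial test functions centred at `z` and
at its reflection `z'`, then the cut-off can be removed in the difference. -/
theorem EllipticPair.integral_radial_eq (hp : EllipticPair a B c) {w : E → ℝ}
    (hw : Continuous w) {C : ℝ} (hC : 0 ≤ C) (hwC : ∀ x, |w x| ≤ C * max ⟪e, x⟫ 0) {z z' : E}
    {k : ℝ} (hk : ∀ x, quad B (x - z') = quad B (x - z) + k * ⟪e, x⟫) {G G₁ G₂ : ℝ → ℝ} {R : ℝ}
    (hG : ∀ t, HasDerivAt G (G₁ t) t) (hG₁ : Continuous G₁) (hG₂ : Continuous G₂)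
    (hR : ∀ q, R ≤ q → G q = 0) (hR₁ : ∀ q, R ≤ q → G₁ q = 0) (hR₂ : ∀ q, R ≤ q → G₂ q = 0)
    (hz : ∀ ε > 0, ∫ x, w x * testOp a B e (fun t => step₁ (t / ε)) (fun t => step₂ (t / ε) / ε)
      (fun t => step₃ (t / ε) / ε ^ 2) G G₁ G₂ z x ∂μ = 0)
    (hz' : ∀ ε > 0, ∫ x, w x * testOp a B e (fun t => step₁ (t / ε)) (fun t => step₂ (t / ε) / ε)
      (fun t => step₃ (t / ε) / ε ^ 2) G G₁ G₂ z' x ∂μ = 0) :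
    ∫ x, w x * (2 * Module.finrank ℝ E * G₁ (quad B (x - z)) +
        4 * G₂ (quad B (x - z)) * quad B (x - z)) ∂μ =
      ∫ x, w x * (2 * Module.finrank ℝ E * G₁ (quad B (x - z')) +
        4 * G₂ (quad B (x - z')) * quad B (x - z')) ∂μ := by
  have cs₁ := contDiff_step₁.continuous
  have cs₂ := contDiff_step₂.continuous
  have cs₃ := contDiff_step₃.continuous
  have cG : Continuous G := continuous_iff_continuousAt.2 fun t => (hG t).continuousAt
  set N : E → E → ℝ := fun z x => 2 * Module.finrank ℝ E * G₁ (quad B (x - z)) +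
    4 * G₂ (quad B (x - z)) * quad B (x - z) with hN
  have hNint (y : E) : Integrable (fun x => w x * N y x) μ := by
    refine Continuous.integrable_of_hasCompactSupport (by fun_prop)
      (hp.hasCompactSupport (R := R) (z := y) fun x hx => ?_)
    simp [hN, hR₁ _ hx, hR₂ _ hx]
  have hTint (ε : ℝ) (y : E) : Integrable (fun x => w x * testOp a B e (fun t => step₁ (t / ε))
      (fun t => step₂ (t / ε) / ε) (fun t => step₃ (t / ε) / ε ^ 2) G G₁ G₂ y x) μ := by
    refine Continuous.integrable_of_hasCompactSupport (by unfold testOp; fun_prop)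
      (hp.hasCompactSupport (R := R) (z := y) fun x hx => ?_)
    simp [testOp, hR _ hx, hR₁ _ hx, hR₂ _ hx]
  rw [← sub_eq_zero, ← integral_sub (hNint z) (hNint z')]
  set S : Set E := closedBall z (R / c + 1) ∪ closedBall z' (R / c + 1) with hS
  have hSc : IsCompact S := (isCompact_closedBall _ _).union (isCompact_closedBall _ _)
  have hSz (x : E) (hx : x ∉ S) : R ≤ quad B (x - z) ∧ R ≤ quad B (x - z') := by
    simp only [hS, mem_union, mem_closedBall, dist_eq_norm, not_or] at hx
    exact ⟨le_of_not_ge fun h => hx.1 (hp.norm_le_of_quad_le h),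
      le_of_not_ge fun h => hx.2 (hp.norm_le_of_quad_le h)⟩
  set F : ℝ → E → ℝ := fun ε x =>
    w x * testOp a B e (fun t => step₁ (t / ε)) (fun t => step₂ (t / ε) / ε)
      (fun t => step₃ (t / ε) / ε ^ 2) G G₁ G₂ z x -
    w x * testOp a B e (fun t => step₁ (t / ε)) (fun t => step₂ (t / ε) / ε)
      (fun t => step₃ (t / ε) / ε ^ 2) G G₁ G₂ z' x with hF
  obtain ⟨C₁, hC₁, hstep⟩ := exists_abs_mul_step_le
  have hbdd (g : E → ℝ) (hg : Continuous g) : ∃ D, 0 ≤ D ∧ ∀ x ∈ S, |g x| ≤ D := by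
    obtain ⟨D, hD⟩ := hSc.exists_bound_of_continuousOn hg.continuousOn
    exact ⟨max D 0, le_max_right _ _, fun x hx => (hD x hx).trans (le_max_left _ _)⟩
  obtain ⟨D₁, hD₁, hD₁'⟩ := hbdd (fun x => G₁ (quad B (x - z)) * ⟪e, x - z⟫ -
    G₁ (quad B (x - z')) * ⟪e, x - z'⟫) (by fun_prop)
  obtain ⟨D₂, hD₂, hD₂'⟩ := hbdd (fun x => w x * (N z x - N z' x)) (by fun_prop)
  obtain ⟨D₀, hD₀, hD₀'⟩ : ∃ D, 0 ≤ D ∧ ∀ x, |G (quad B (x - z)) - G (quad B (x - z'))| ≤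
      D * |⟪e, x⟫| := by
    obtain ⟨D, hD⟩ := isCompact_Icc.exists_bound_of_continuousOn (s := Icc (0 : ℝ) R)
      hG₁.continuousOn
    have hD' (q : ℝ) (hq : q ∈ Ici (0 : ℝ)) : ‖G₁ q‖ ≤ max D 0 := by
      rcases le_or_gt R q with h | h
      · simp [hR₁ q h]
      · exact (hD q ⟨hq, h.le⟩).trans (le_max_left _ _)
    refine ⟨max D 0 * |k|, by positivity, fun x => ?_⟩
    have := (convex_Ici (0 : ℝ)).norm_image_sub_le_of_norm_hasDerivWithin_le
      (fun q _ => (hG q).hasDerivWithinAt) hD' (hp.quad_nonneg (x - z')) (hp.quad_nonneg (x - z))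
    refine this.trans_eq ?_
    rw [hk x, Real.norm_eq_abs, mul_assoc, ← abs_mul, abs_sub_comm]
    congr 2
    ring
  have hlim : Tendsto (fun ε => ∫ x, F ε x ∂μ) (𝓝[>] 0)
      (𝓝 (∫ x, (w x * N z x - w x * N z' x) ∂μ)) := by
    refine tendsto_integral_filter_of_dominated_convergence
      (S.indicator fun _ => |⟪e, a e⟫| * (C * C₁ * D₀) + 4 * (C * C₁ * D₁) + D₂) ?_ ?_ ?_ ?_
    · exact Eventually.of_forall fun ε =>
        ((hTint ε z).sub (hTint ε z')).aestronglyMeasurable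
    · filter_upwards [self_mem_nhdsWithin] with ε (hε : 0 < ε)
      refine ae_of_all _ fun x => ?_
      by_cases hx : x ∈ S
      · rw [indicator_of_mem hx]
        have e1 : F ε x = ⟪e, a e⟫ * (w x * (step₃ (⟪e, x⟫ / ε) / ε ^ 2) *
              (G (quad B (x - z)) - G (quad B (x - z')))) +
            4 * (w x * (step₂ (⟪e, x⟫ / ε) / ε) * (G₁ (quad B (x - z)) * ⟪e, x - z⟫ -
              G₁ (quad B (x - z')) * ⟪e, x - z'⟫)) +
            step₁ (⟪e, x⟫ / ε) * (w x * (N z x - N z' x)) := by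
          simp only [hF, hN, testOp]
          ring
        have hwx : |w x| ≤ C * |⟪e, x⟫| :=
          (hwC x).trans (by gcongr; exact max_le (le_abs_self _) (abs_nonneg _))
        have t₃ : |w x * (step₃ (⟪e, x⟫ / ε) / ε ^ 2) *
              (G (quad B (x - z)) - G (quad B (x - z')))| ≤ C * C₁ * D₀ := by
          rw [abs_mul, abs_mul]
          calc |w x| * |step₃ (⟪e, x⟫ / ε) / ε ^ 2| * |G (quad B (x - z)) - G (quad B (x - z'))|
              ≤ (C * |⟪e, x⟫|) * |step₃ (⟪e, x⟫ / ε) / ε ^ 2| * (D₀ * |⟪e, x⟫|) := by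
                gcongr
                exact hD₀' x
            _ = C * |(⟪e, x⟫ / ε) ^ 2 * step₃ (⟪e, x⟫ / ε)| * D₀ := by
                rw [abs_mul, abs_div, abs_pow, abs_pow, abs_div, abs_of_pos hε]
                ring
            _ ≤ C * C₁ * D₀ := by
                gcongr
                exact (hstep _).2
        have t₂ : |w x * (step₂ (⟪e, x⟫ / ε) / ε) * (G₁ (quad B (x - z)) * ⟪e, x - z⟫ -
              G₁ (quad B (x - z')) * ⟪e, x - z'⟫)| ≤ C * C₁ * D₁ := by
          rw [abs_mul, abs_mul]
          calc _ ≤ (C * |⟪e, x⟫|) * |step₂ (⟪e, x⟫ / ε) / ε| * D₁ := by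
                gcongr
                exact hD₁' x hx
            _ = C * |⟪e, x⟫ / ε * step₂ (⟪e, x⟫ / ε)| * D₁ := by
                rw [abs_mul, abs_div, abs_div, abs_of_pos hε]
                ring
            _ ≤ C * C₁ * D₁ := by
                gcongr
                exact (hstep _).1
        have t₁ : |step₁ (⟪e, x⟫ / ε) * (w x * (N z x - N z' x))| ≤ D₂ := by
          rw [abs_mul, abs_of_nonneg (step₁_nonneg _)]
          exact (mul_le_of_le_one_left (abs_nonneg _) (step₁_le_one _)).trans (hD₂' x hx)
        rw [e1, Real.norm_eq_abs]
        refine (abs_add_three _ _ _).trans ?_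
        rw [abs_mul ⟪e, a e⟫, abs_mul 4, abs_of_pos (by norm_num : (0 : ℝ) < 4)]
        gcongr
      · obtain ⟨h1, h2⟩ := hSz x hx
        rw [indicator_of_notMem hx]
        simp [hF, testOp, hR _ h1, hR₁ _ h1, hR₂ _ h1, hR _ h2, hR₁ _ h2, hR₂ _ h2]
    · exact (integrableOn_const hSc.measure_lt_top.ne).integrable_indicator hSc.measurableSet
    · refine ae_of_all _ fun x => ?_
      rcases le_or_gt ⟪e, x⟫ 0 with hx | hx
      · have : w x = 0 := by
          have := hwC x
          rwa [max_eq_right hx, mul_zero, abs_nonpos_iff] at this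
        simp [hF, this]
      · refine tendsto_const_nhds.congr' ?_
        filter_upwards [Ioo_mem_nhdsGT (half_pos hx)] with ε hε
        have h2 : 2 < ⟪e, x⟫ / ε := by
          rw [lt_div_iff₀ hε.1]
          linarith [hε.2]
        simp only [hF, hN, testOp, step₁_eq_one h2.le, step₂_eq_zero (Or.inr h2),
          step₃_eq_zero (Or.inr h2)]
        ring
  refine tendsto_nhds_unique hlim (tendsto_const_nhds.congr' ?_)
  filter_upwards [self_mem_nhdsWithin] with ε (hε : 0 < ε)
  simp only [hF]
  rw [integral_sub (hTint ε z) (hTint ε z'), hz ε hε, hz' ε hε, sub_zero]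

theorem IsBlowup.radial_mean_sub_eq (hv : IsBlowup U v) (hU : AlmostSolution μ a e γ L U)
    (hp : EllipticPair a B c) (hγ0 : 0 < γ) {w : E → ℝ} (hw : Continuous w)
    (hwv : ∀ x, 0 ≤ ⟪e, x⟫ → w x = v x) {C : ℝ} (hC : 0 ≤ C)
    (hwC : ∀ x, |w x| ≤ C * max ⟪e, x⟫ 0) {z z' : E} {k : ℝ}
    (hk : ∀ x, quad B (x - z') = quad B (x - z) + k * ⟪e, x⟫) {s : ℝ} (hs : 0 < s) :
    ∫ x, w x * (-Module.finrank ℝ E * bump₁ (quad B (x - z) / s ^ 2) +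
        2 * bump₂ (quad B (x - z) / s ^ 2) * (quad B (x - z) / s ^ 2)) ∂μ =
      ∫ x, w x * (-Module.finrank ℝ E * bump₁ (quad B (x - z') / s ^ 2) +
        2 * bump₂ (quad B (x - z') / s ^ 2) * (quad B (x - z') / s ^ 2)) ∂μ := by
  have cs₃ := contDiff_step₃.continuous
  have cb₁ := contDiff_bump₁.continuous
  have cb₂ := contDiff_bump₂.continuous
  have hs2 : 0 < s ^ 2 := by positivity
  have hG : ∀ q, HasDerivAt (fun q => bump₀ (q / s ^ 2)) (-bump₁ (q / s ^ 2) / s ^ 2) q :=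
    hasDerivAt_comp_div hasDerivAt_bump₀ (s ^ 2)
  have hG₁ (q : ℝ) : HasDerivAt (fun q => -bump₁ (q / s ^ 2) / s ^ 2)
      (bump₂ (q / s ^ 2) / s ^ 2 / s ^ 2) q := by
    refine (((hasDerivAt_comp_div hasDerivAt_bump₁ (s ^ 2) q).neg).div_const (s ^ 2)).congr_deriv ?_
    ring
  have hq (q : ℝ) (h : s ^ 2 ≤ q) : 1 ≤ q / s ^ 2 := (one_le_div hs2).2 h
  have hR (q : ℝ) (h : s ^ 2 ≤ q) : bump₀ (q / s ^ 2) = 0 := bump₀_eq_zero (hq q h)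
  have hR₁ (q : ℝ) (h : s ^ 2 ≤ q) : -bump₁ (q / s ^ 2) / s ^ 2 = 0 := by
    rw [bump₁_eq_zero (hq q h), neg_zero, zero_div]
  have hR₂ (q : ℝ) (h : s ^ 2 ≤ q) : bump₂ (q / s ^ 2) / s ^ 2 / s ^ 2 = 0 := by
    rw [bump₂_eq_zero (hq q h), zero_div, zero_div]
  have hh₁ (ε t : ℝ) : HasDerivAt (fun t => step₂ (t / ε) / ε) (step₃ (t / ε) / ε ^ 2) t := by
    refine (((hasDerivAt_step₂ (t / ε)).comp t
      ((hasDerivAt_id t).div_const ε)).div_const ε).congr_deriv ?_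
    ring
  have hzero (y : E) (ε : ℝ) (hε : 0 < ε) : ∫ x, w x * testOp a B e (fun t => step₁ (t / ε))
      (fun t => step₂ (t / ε) / ε) (fun t => step₃ (t / ε) / ε ^ 2) (fun q => bump₀ (q / s ^ 2))
      (fun q => -bump₁ (q / s ^ 2) / s ^ 2) (fun q => bump₂ (q / s ^ 2) / s ^ 2 / s ^ 2)
      y x ∂μ = 0 := by
    have h0 := hv.integral_fderiv_testFun hU hγ0 hp hε (hasDerivAt_step₁_div ε) (hh₁ ε)
      (by fun_prop) hG hG₁ (by fun_prop) (contDiff_step₁.comp (contDiff_id.div_const _))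
      (contDiff_bump₀.comp (contDiff_id.div_const _))
      (fun t ht => step₁_eq_zero ((div_le_one hε).2 ht)) hR hR₁ hR₂ y
    rw [hp.integral_fderiv_gradient_testFun (hv.lipschitz hU.lipschitz) (hasDerivAt_step₁_div ε)
      (hh₁ ε) (by fun_prop) hG hG₁ (by fun_prop) hR hR₁ e y, neg_eq_zero] at h0
    rw [← h0]
    refine integral_congr_ae (ae_of_all _ fun x => ?_)
    rcases le_or_gt 0 ⟪e, x⟫ with hx | hx
    · simp only [hwv x hx]
    · have h1 : ⟪e, x⟫ / ε < 1 := (div_neg_of_neg_of_pos hx hε).trans one_pos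
      simp [testOp, step₁_eq_zero h1.le, step₂_eq_zero (Or.inl h1), step₃_eq_zero (Or.inl h1)]
  have key := hp.integral_radial_eq (μ := μ) hw hC hwC hk hG (by fun_prop) (by fun_prop) hR hR₁ hR₂
    (fun ε hε => hzero z ε hε) (fun ε hε => hzero z' ε hε)
  have hrw (y : E) : ∫ x, w x *
      (2 * Module.finrank ℝ E * (-bump₁ (quad B (x - y) / s ^ 2) / s ^ 2) +
      4 * (bump₂ (quad B (x - y) / s ^ 2) / s ^ 2 / s ^ 2) * quad B (x - y)) ∂μ =
      2 / s ^ 2 * ∫ x, w x * (-Module.finrank ℝ E * bump₁ (quad B (x - y) / s ^ 2) +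
        2 * bump₂ (quad B (x - y) / s ^ 2) * (quad B (x - y) / s ^ 2)) ∂μ := by
    rw [← integral_const_mul]
    refine integral_congr_ae (ae_of_all _ fun x => ?_)
    ring
  rw [hrw, hrw] at key
  exact mul_left_cancel₀ (by positivity) key

theorem EllipticPair.tendsto_radial_mean_zero (hp : EllipticPair a B c) {w : E → ℝ}
    (hw : Continuous w) (z : E) :
    Tendsto (fun s : ℝ => (s ^ Module.finrank ℝ E)⁻¹ *
      ∫ x, w x * bump₁ (quad B (x - z) / s ^ 2) ∂μ) (𝓝[>] 0)
      (𝓝 (w z * ∫ x, bump₁ (quad B x) ∂μ)) := by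
  have cb₁ := contDiff_bump₁.continuous
  have hcont : Continuous fun s : ℝ => ∫ y, w (z + s • y) * bump₁ (quad B y) ∂μ := by
    rw [← continuousOn_univ]
    refine continuousOn_integral_of_compact_support (isCompact_closedBall (0 : E) (1 / c + 1))
      (Continuous.continuousOn (by fun_prop)) fun s y _ hy => ?_
    rw [bump₁_eq_zero, mul_zero]
    by_contra! h
    exact hy (by simpa using hp.norm_le_of_quad_le h.le)
  have h0 := (hcont.tendsto 0).mono_left (nhdsWithin_le_nhds (s := Ioi 0))
  simp only [zero_smul, add_zero, integral_const_mul] at h0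
  refine h0.congr' ?_
  filter_upwards [self_mem_nhdsWithin] with s (hs : 0 < s)
  rw [integral_eq_pow_mul_integral_comp (fun x => w x * bump₁ (quad B (x - z) / s ^ 2)) z hs,
    inv_mul_cancel_left₀ (by positivity)]
  simp only [add_sub_cancel_left, quad_smul]
  simp only [mul_div_cancel_left₀ _ (pow_ne_zero 2 hs.ne')]

theorem EllipticPair.tendsto_radial_mean_sub (hp : EllipticPair a B c) {w : E → ℝ}
    (hw : Continuous w) {C : ℝ} (hC : 0 ≤ C) (hwC : ∀ x, |w x| ≤ C * max ⟪e, x⟫ 0) {z z' : E}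
    {k : ℝ} (hk : ∀ x, quad B (x - z') = quad B (x - z) + k * ⟪e, x⟫) {κ : ℝ}
    (hκ : ∀ s > 0, meanSlope μ B e (rescale w s) = κ) :
    Tendsto (fun t : ℝ => ((t⁻¹ ^ Module.finrank ℝ E)⁻¹ *
        ∫ x, w x * bump₁ (quad B (x - z) / t⁻¹ ^ 2) ∂μ) -
      ((t⁻¹ ^ Module.finrank ℝ E)⁻¹ * ∫ x, w x * bump₁ (quad B (x - z') / t⁻¹ ^ 2) ∂μ))
      (𝓝[>] 0) (𝓝 (k * κ)) := by
  have cb₁ := contDiff_bump₁.continuous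
  have cb₂ := contDiff_bump₂.continuous
  obtain ⟨D, hD, hDb⟩ := exists_abs_le_of_eq_zero cb₂ fun q => bump₂_eq_zero
  set ψ : ℝ → E → ℝ := fun t y =>
    t⁻¹ * (bump₁ (quad B (y - t • z)) - bump₁ (quad B (y - t • z'))) with hψ
  set ψ₀ : E → ℝ := fun y => k * ⟪e, y⟫ * bump₂ (quad B y) with hψ₀
  have hkt (t : ℝ) (ht : 0 < t) (y : E) :
      quad B (y - t • z') = quad B (y - t • z) + k * t * ⟪e, y⟫ := by
    have h1 := congrArg (t ^ 2 * ·) (hk (t⁻¹ • y))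
    simp only [mul_add, ← quad_smul, smul_sub, smul_inv_smul₀ ht.ne', real_inner_smul_right] at h1
    rw [h1]
    field_simp
  have hrw (t : ℝ) (ht : 0 < t) (y : E) : (t⁻¹ ^ Module.finrank ℝ E)⁻¹ *
      ∫ x, w x * bump₁ (quad B (x - y) / t⁻¹ ^ 2) ∂μ =
      ∫ x, w (t⁻¹ • x) * bump₁ (quad B (x - t • y)) ∂μ := by
    rw [integral_eq_pow_mul_integral_comp (fun x => w x * bump₁ (quad B (x - y) / t⁻¹ ^ 2)) 0
      (inv_pos.2 ht), inv_mul_cancel_left₀ (by positivity)]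
    refine integral_congr_ae (ae_of_all _ fun x => ?_)
    simp only [zero_add]
    rw [inv_pow, div_inv_eq_mul, mul_comm (quad B _), ← quad_smul, smul_sub, smul_inv_smul₀ ht.ne']
  have hwr (t : ℝ) (ht : 0 < t) (y : E) : |rescale w t⁻¹ y| ≤ C * max ⟪e, y⟫ 0 := by
    rw [rescale, abs_div, abs_of_pos (inv_pos.2 ht), div_inv_eq_mul, ← le_div_iff₀ ht]
    refine (hwC _).trans_eq ?_
    rw [real_inner_smul_right, ← mul_zero t⁻¹, ← mul_max_of_nonneg _ _ (by positivity), mul_zero]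
    ring
  have cw (t : ℝ) : Continuous (rescale w t) := by
    unfold rescale
    fun_prop
  have i₁ (t : ℝ) (y : E) : Integrable (fun x => w (t⁻¹ • x) * bump₁ (quad B (x - t • y))) μ :=
    Continuous.integrable_of_hasCompactSupport (by fun_prop)
      (hp.hasCompactSupport (R := 1) (z := t • y) fun x hx => by rw [bump₁_eq_zero hx, mul_zero])
  have i₂ (t : ℝ) : Integrable (fun x => rescale w t⁻¹ x * ψ₀ x) μ :=
    Continuous.integrable_of_hasCompactSupport (by fun_prop)
      (hp.hasCompactSupport (R := 1) (z := 0) fun x hx => by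
        rw [sub_zero] at hx
        simp only [hψ₀, bump₂_eq_zero hx, mul_zero])
  have e₁ (t : ℝ) (ht : 0 < t) (x : E) : rescale w t⁻¹ x * ψ t x =
      w (t⁻¹ • x) * bump₁ (quad B (x - t • z)) - w (t⁻¹ • x) * bump₁ (quad B (x - t • z')) := by
    simp only [rescale, hψ]
    field_simp
  have i₃ (t : ℝ) (ht : 0 < t) : Integrable (fun x => rescale w t⁻¹ x * ψ t x) μ := by
    simp only [e₁ t ht]
    exact (i₁ t z).sub (i₁ t z')
  have hκ' (t : ℝ) (ht : 0 < t) : ∫ x, rescale w t⁻¹ x * ψ₀ x ∂μ = k * κ := by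
    rw [← hκ t⁻¹ (inv_pos.2 ht), meanSlope, ← integral_const_mul]
    refine integral_congr_ae (ae_of_all _ fun x => ?_)
    rcases le_or_gt 0 ⟪e, x⟫ with hx | hx
    · simp only [hψ₀, max_eq_left hx]
      ring
    · have := hwr t ht x
      rw [max_eq_right hx.le, mul_zero, abs_nonpos_iff] at this
      simp [this]
  set ρ := 1 / c + 1 + ‖z‖ + ‖z'‖
  have hc := hp.pos
  have hsupp (t : ℝ) (ht : 0 < t) (ht1 : t < 1) (x : E) (hx : x ∉ closedBall 0 ρ) :
      ψ t x = 0 ∧ ψ₀ x = 0 := by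
    rw [mem_closedBall_zero_iff, not_le] at hx
    have h0 : 1 ≤ quad B x := by
      by_contra! h
      have := hp.norm_le_of_quad_le h.le
      simp only [ρ] at hx
      linarith [norm_nonneg z, norm_nonneg z']
    have h1 (y : E) (hy : ‖y‖ ≤ ‖z‖ + ‖z'‖) : 1 ≤ quad B (x - t • y) := by
      by_contra! h
      have h2 := hp.norm_le_of_quad_le h.le
      have h3 : ‖t • y‖ ≤ ‖y‖ := by
        rw [norm_smul, Real.norm_of_nonneg ht.le]
        exact mul_le_of_le_one_left (norm_nonneg _) ht1.le
      have h4 := norm_le_norm_sub_add x (t • y)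
      simp only [ρ] at hx
      linarith
    simp [hψ, hψ₀, bump₂_eq_zero h0, bump₁_eq_zero (h1 z (by simp)),
      bump₁_eq_zero (h1 z' (by simp))]
  have hψb (t : ℝ) (ht : 0 < t) (x : E) : |ψ t x| ≤ D * |k| * |⟪e, x⟫| := by
    have h1 := (convex_Ici (0 : ℝ)).norm_image_sub_le_of_norm_hasDerivWithin_le
      (fun q _ => (hasDerivAt_bump₁ q).hasDerivWithinAt)
      (fun q hq => by simpa using hDb q hq) (hp.quad_nonneg (x - t • z'))
      (hp.quad_nonneg (x - t • z))
    rw [Real.norm_eq_abs, Real.norm_eq_abs, hkt t ht] at h1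
    rw [hψ, abs_mul, abs_inv, abs_of_pos ht, inv_mul_le_iff₀ ht, hkt t ht]
    refine h1.trans_eq ?_
    rw [sub_add_cancel_left, abs_neg, abs_mul, abs_mul, abs_of_pos ht]
    ring
  have hψlim (x : E) : Tendsto (fun t => ψ t x) (𝓝[>] 0) (𝓝 (ψ₀ x)) := by
    have hd (y : E) : HasDerivAt
        (fun t : ℝ => bump₁ (quad B x - 2 * (t * ⟪B x, y⟫) + t ^ 2 * quad B y))
        (2 * ⟪B x, y⟫ * bump₂ (quad B x)) 0 := by
      have h1 : HasDerivAt (fun t : ℝ => quad B x - 2 * (t * ⟪B x, y⟫) + t ^ 2 * quad B y)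
          (-(2 * ⟪B x, y⟫)) 0 := by
        have h2 := ((((hasDerivAt_id (0 : ℝ)).mul_const ⟪B x, y⟫).const_mul 2).const_sub
          (quad B x)).add ((hasDerivAt_pow 2 (0 : ℝ)).mul_const (quad B y))
        refine h2.congr_deriv ?_
        simp
      have h3 := (hasDerivAt_bump₁ _).comp 0 h1
      refine h3.congr_deriv ?_
      simp
      ring
    have h1 := ((hd z).sub (hd z')).tendsto_slope_zero_right
    have h2 : 2 * ⟪B x, z⟫ * bump₂ (quad B x) - 2 * ⟪B x, z'⟫ * bump₂ (quad B x) = ψ₀ x := by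
      have h3 := hk x
      have h4 := hk 0
      rw [hp.quad_sub, hp.quad_sub] at h3 h4
      simp only [inner_zero_right, map_zero, inner_zero_left] at h4
      simp only [hψ₀]
      linear_combination (h3 - h4) * bump₂ (quad B x)
    rw [h2] at h1
    refine h1.congr fun t => ?_
    simp only [hψ, hp.quad_sub, quad_smul, real_inner_smul_right, smul_eq_mul, zero_add]
    simp
  have hlim : Tendsto (fun t => ∫ x, rescale w t⁻¹ x * (ψ t x - ψ₀ x) ∂μ) (𝓝[>] 0)
      (𝓝 (∫ _, (0 : ℝ) ∂μ)) := by
    refine tendsto_integral_filter_of_dominated_convergence ((closedBall 0 ρ).indicator fun x =>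
      C * max ⟪e, x⟫ 0 * (D * |k| * |⟪e, x⟫| + |ψ₀ x|)) ?_ ?_ ?_ ?_
    · exact Eventually.of_forall fun t => Continuous.aestronglyMeasurable (by fun_prop)
    · filter_upwards [Ioo_mem_nhdsGT one_pos] with t ht
      refine ae_of_all _ fun x => ?_
      by_cases hx : x ∈ closedBall 0 ρ
      · rw [indicator_of_mem hx, norm_mul]
        have h1 := hwr t ht.1 x
        have h2 := (norm_sub_le (ψ t x) (ψ₀ x)).trans (add_le_add_left (hψb t ht.1 x) _)
        exact mul_le_mul h1 h2 (norm_nonneg _) (by positivity)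
      · rw [indicator_of_notMem hx]
        simp [hsupp t ht.1 ht.2 x hx]
    · exact IntegrableOn.integrable_indicator (Continuous.continuousOn (by fun_prop)
        |>.integrableOn_compact (isCompact_closedBall _ _)) measurableSet_closedBall
    · refine ae_of_all _ fun x => squeeze_zero_norm' (a := fun t =>
        C * max ⟪e, x⟫ 0 * |ψ t x - ψ₀ x|) ?_ ?_
      · filter_upwards [self_mem_nhdsWithin] with t (ht : 0 < t)
        rw [norm_mul]
        exact mul_le_mul_of_nonneg_right (hwr t ht x) (abs_nonneg _)
      · simpa using (((hψlim x).sub_const (ψ₀ x)).abs).const_mul (C * max ⟪e, x⟫ 0)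
  rw [integral_zero] at hlim
  have h1 := hlim.add_const (k * κ)
  rw [zero_add] at h1
  refine h1.congr' ?_
  filter_upwards [self_mem_nhdsWithin] with t (ht : 0 < t)
  rw [hrw t ht, hrw t ht, ← integral_sub (i₁ t z) (i₁ t z')]
  simp only [mul_sub]
  rw [integral_sub (i₃ t ht) (i₂ t), hκ' t ht, sub_add_cancel]
  simp only [e₁ t ht]

/-- Every blow-up is the same multiple of `⟪e, x⟫` on the half-space `0 ≤ ⟪e, x⟫`. -/
theorem AlmostSolution.exists_blowup_eq (hU : AlmostSolution μ a e γ L U)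
    (hp : EllipticPair a B c) (hγ0 : 0 < γ) (hγ1 : γ < 1) (he : e ≠ 0) :
    ∃ α, ∀ v, IsBlowup U v → ∀ z, 0 ≤ ⟪e, z⟫ → v z = α * ⟪e, z⟫ := by
  have ha := hp.inner_apply_self_pos he
  have cb₁ := contDiff_bump₁.continuous
  obtain ⟨κ, hκ⟩ := hU.exists_tendsto_meanSlope hp hγ0 hγ1
  have hP : 0 < ∫ x, bump₁ (quad B x) ∂μ :=
    Continuous.integral_pos_of_hasCompactSupport_nonneg_nonzero (by fun_prop)
      (hp.hasCompactSupport (R := 1) (z := 0) fun x hx => bump₁_eq_zero (by simpa using hx))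
      (fun x => bump₁_nonneg _) (x := 0) (bump₁_pos (by simp [quad])).ne'
  set P := ∫ x, bump₁ (quad B x) ∂μ with hPdef
  refine ⟨4 * κ / (⟪e, a e⟫ * P), fun v hv z hz => ?_⟩
  obtain ⟨w, hw, hwv, C, hC, hwC⟩ := hp.exists_continuous_zero_extension he
    (hv.lipschitz hU.lipschitz) fun y hy => hv.eq_zero_of_inner_eq_zero hU hp hγ0 hγ1 he hy
  set z' := z - (2 * ⟪e, z⟫ / ⟪e, a e⟫) • a e
  have hk := hp.quad_sub_reflection he z
  set k := 4 * ⟪e, z⟫ / ⟪e, a e⟫ with hkdef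
  set Φ : ℝ → ℝ := fun s =>
    ((s ^ Module.finrank ℝ E)⁻¹ * ∫ x, w x * bump₁ (quad B (x - z) / s ^ 2) ∂μ) -
      ((s ^ Module.finrank ℝ E)⁻¹ * ∫ x, w x * bump₁ (quad B (x - z') / s ^ 2) ∂μ) with hΦ
  have hder (s : ℝ) (hs : s ∈ Ioi (0 : ℝ)) : HasDerivAt Φ 0 s := by
    have hav (y : E) := hp.hasDerivAt_average (μ := μ) hw hasDerivAt_bump₁
      contDiff_bump₂.continuous (fun q => bump₁_eq_zero) (fun q => bump₂_eq_zero) y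
      (Module.finrank ℝ E) hs
    refine ((hav z).sub (hav z')).congr_deriv ?_
    rw [hv.radial_mean_sub_eq hU hp hγ0 hw hwv hC hwC hk hs, sub_self]
  have hΦc (s : ℝ) (hs : 0 < s) : Φ s = Φ 1 :=
    isOpen_Ioi.is_const_of_deriv_eq_zero isPreconnected_Ioi
      (fun s hs => (hder s hs).differentiableAt.differentiableWithinAt)
      (fun s hs => (hder s hs).deriv) hs (mem_Ioi.2 one_pos)
  have hκw (s : ℝ) (hs : 0 < s) : meanSlope μ B e (rescale w s) = κ := by
    rw [← (hv.rescale_of_pos hs).meanSlope_eq hU.lipschitz hp hκ, meanSlope, meanSlope]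
    refine integral_congr_ae (ae_of_all _ fun x => ?_)
    rcases le_or_gt 0 ⟪e, x⟫ with hx | hx
    · simp only [rescale, hwv (s • x) (by rw [real_inner_smul_right]; positivity)]
    · simp [max_eq_right hx.le]
  have l₀ : Tendsto Φ (𝓝[>] 0) (𝓝 (w z * P - w z' * P)) :=
    (hp.tendsto_radial_mean_zero hw z).sub (hp.tendsto_radial_mean_zero hw z')
  have l₁ := hp.tendsto_radial_mean_sub (μ := μ) hw hC hwC hk hκw
  have h₀ : w z * P - w z' * P = Φ 1 := tendsto_nhds_unique l₀ <|
    tendsto_const_nhds.congr' <| by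
      filter_upwards [self_mem_nhdsWithin] with s hs using (hΦc s hs).symm
  have h₁ : k * κ = Φ 1 := tendsto_nhds_unique l₁ <|
    tendsto_const_nhds.congr' <| by
      filter_upwards [self_mem_nhdsWithin] with t ht using (hΦc t⁻¹ (inv_pos.2 ht)).symm
  have hz' : w z' = 0 := by
    have := hwC z'
    rwa [hp.inner_reflection he, max_eq_right (by linarith), mul_zero, abs_nonpos_iff] at this
  rw [hz', zero_mul, sub_zero, ← h₁, hwv z hz, hkdef] at h₀
  rw [← eq_div_iff hP.ne'] at h₀
  rw [h₀]
  field_simp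

end MeanValue

end AsymptoticDev

namespace AsymptoticDev

variable {E : Type*} [NormedAddCommGroup E] [InnerProductSpace ℝ E] [FiniteDimensional ℝ E]
  [MeasurableSpace E] [BorelSpace E] {μ : Measure E} [μ.IsAddHaarMeasure]
  {a B : E →L[ℝ] E} {c γ : ℝ} {L : ℝ≥0} {e : E} {U : E → ℝ}

section Expansion

theorem AlmostSolution.exists_expansion (hU : AlmostSolution μ a e γ L U)
    (hp : EllipticPair a B c) (hγ0 : 0 < γ) (hγ1 : γ < 1) (he : e ≠ 0) :
    ∃ α, 0 ≤ α ∧ ∀ ε > 0, ∀ᶠ x in 𝓝[{x | 0 ≤ ⟪e, x⟫}] 0, |U x - α * ⟪e, x⟫| ≤ ε * ‖x‖ := by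
  obtain ⟨α, hα⟩ := hU.exists_blowup_eq hp hγ0 hγ1 he
  refine ⟨α, ?_, fun ε hε => ?_⟩
  · obtain ⟨v, hv⟩ := exists_tendsto_rescale hU.lipschitz hU.zero (Ultrafilter.of (𝓝[>] (0 : ℝ)))
      (Ultrafilter.of_le _)
    have hv' : IsBlowup U v := ⟨_, inferInstance, Ultrafilter.of_le _, hv⟩
    have hee : 0 < ⟪e, e⟫ := real_inner_self_pos.2 he
    have h1 := hv'.nonneg hU he hee.le
    rw [hα v hv' e hee.le] at h1
    exact nonneg_of_mul_nonneg_left h1 hee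
  by_contra hcon
  set bad : Set E := {x | ε * ‖x‖ < |U x - α * ⟪e, x⟫|} with hbad
  have hne : (𝓝[{x | 0 ≤ ⟪e, x⟫}] 0 ⊓ 𝓟 bad).NeBot := by
    rw [← frequently_mem_iff_neBot]
    simp only [not_eventually, not_le] at hcon
    exact hcon
  set F : Ultrafilter E := Ultrafilter.of (𝓝[{x | 0 ≤ ⟪e, x⟫}] 0 ⊓ 𝓟 bad)
  have hF : (F : Filter E) ≤ 𝓝[{x | 0 ≤ ⟪e, x⟫}] 0 ⊓ 𝓟 bad := Ultrafilter.of_le _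
  have hFbad : ∀ᶠ x in (F : Filter E), x ∈ bad := hF (mem_inf_of_right (mem_principal_self _))
  have hFpos : ∀ᶠ x in (F : Filter E), 0 ≤ ⟪e, x⟫ :=
    hF (mem_inf_of_left self_mem_nhdsWithin)
  have hFnorm : ∀ᶠ x in (F : Filter E), 0 < ‖x‖ := by
    filter_upwards [hFbad] with x hx
    refine norm_pos_iff.2 fun h0 => ?_
    simp [hbad, h0, hU.zero] at hx
  have hr : ((F.map norm : Ultrafilter ℝ) : Filter ℝ) ≤ 𝓝[>] 0 := by
    refine tendsto_nhdsWithin_iff.2 ⟨?_, hFnorm⟩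
    exact tendsto_norm_zero.mono_left (hF.trans (inf_le_left.trans nhdsWithin_le_nhds))
  obtain ⟨v, hv⟩ := exists_tendsto_rescale hU.lipschitz hU.zero _ hr
  have hv' : IsBlowup U v := ⟨_, inferInstance, hr, hv⟩
  obtain ⟨ω, -, hω⟩ := (isCompact_sphere (0 : E) 1).ultrafilter_le_nhds
    (F.map fun x => ‖x‖⁻¹ • x) (by
      rw [le_principal_iff]
      change ∀ᶠ x in (F : Filter E), ‖x‖⁻¹ • x ∈ sphere 0 1
      filter_upwards [hFnorm] with x hx
      simp [norm_smul, hx.ne'])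
  have hω' : Tendsto (fun x => ‖x‖⁻¹ • x) (F : Filter E) (𝓝 ω) := hω
  have hωpos : 0 ≤ ⟪e, ω⟫ := by
    refine ge_of_tendsto (tendsto_const_nhds.inner hω') ?_
    filter_upwards [hFpos] with x hx
    rw [real_inner_smul_right]
    positivity
  have h1 : Tendsto (fun x => rescale U ‖x‖ (‖x‖⁻¹ • x)) (F : Filter E) (𝓝 (v ω)) := by
    have h2 : Tendsto (fun x : E => rescale U ‖x‖ ω) (F : Filter E) (𝓝 (v ω)) := hv ω
    refine h2.congr_dist (squeeze_zero' (g := fun x : E => L * dist ω (‖x‖⁻¹ • x))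
      (Eventually.of_forall fun _ => dist_nonneg) ?_ ?_)
    · filter_upwards [hFnorm] with x hx using (hU.lipschitz.rescale hx).dist_le_mul _ _
    · simpa using ((tendsto_const_nhds (x := ω)).dist hω').const_mul (L : ℝ)
  have h2 := (h1.sub ((tendsto_const_nhds (x := e)).inner hω' |>.const_mul α)).abs
  rw [hα v hv' ω hωpos, sub_self, abs_zero] at h2
  obtain ⟨x, hx1, hx2, hx3⟩ := ((h2.eventually (gt_mem_nhds hε)).and (hFbad.and hFnorm)).exists
  rw [rescale, smul_inv_smul₀ hx3.ne', real_inner_smul_right, div_eq_inv_mul, mul_left_comm,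
    ← mul_sub, abs_mul, abs_inv, abs_norm, inv_mul_lt_iff₀ hx3, mul_comm ‖x‖] at hx1
  exact lt_asymm hx1 hx2

end Expansion

end AsymptoticDev

namespace AsymptoticDev

section Frozen

variable {E : Type*} [NormedAddCommGroup E] [InnerProductSpace ℝ E]

theorem fderiv_rescale (U : E → ℝ) {r : ℝ} (hr : r ≠ 0) (x : E) :
    fderiv ℝ (rescale U r) x = fderiv ℝ U (r • x) := by
  have h : rescale U r = r⁻¹ • fun x => U (r • x) := by
    funext x
    simp [rescale, div_eq_inv_mul]
  rw [h, fderiv_const_smul_field, Pi.smul_apply, fderiv_comp_smul, smul_smul,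
    inv_mul_cancel₀ hr, one_smul]

variable [FiniteDimensional ℝ E]

/-- A symmetric coercive operator has a symmetric coercive inverse. -/
theorem exists_ellipticPair {a : E →L[ℝ] E} {l : ℝ} (hl : 0 < l)
    (hsym : ∀ x y, ⟪a x, y⟫ = ⟪x, a y⟫) (hell : ∀ x, l * ‖x‖ ^ 2 ≤ ⟪a x, x⟫) :
    ∃ B c, EllipticPair a B c := by
  have hinj : Function.Injective a := by
    rw [injective_iff_map_eq_zero]
    intro x hx
    have h := hell x
    rw [hx, inner_zero_left] at h
    by_contra hx0
    have : 0 < ‖x‖ := norm_pos_iff.2 hx0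
    exact absurd h (not_le.2 (by positivity))
  let T : E ≃L[ℝ] E :=
    (LinearEquiv.ofInjectiveEndo (a : E →ₗ[ℝ] E) hinj).toContinuousLinearEquiv
  have hT : ∀ x, T x = a x := fun _ => rfl
  have hr : ∀ x, a (T.symm x) = x := fun x => by rw [← hT, T.apply_symm_apply]
  refine ⟨T.symm, l / (‖a‖ + 1) ^ 2, by positivity, hr,
    fun x => by rw [← hT]; exact T.symm_apply_apply x, fun x y => ?_, fun x => ?_⟩
  · change ⟪T.symm x, y⟫ = ⟪x, T.symm y⟫
    conv_lhs => rw [← hr y]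
    rw [← hsym, hr]
  · change _ ≤ ⟪T.symm x, x⟫
    have h1 : ‖x‖ ≤ (‖a‖ + 1) * ‖T.symm x‖ := by
      have := a.le_opNorm (T.symm x)
      rw [hr] at this
      nlinarith [norm_nonneg (T.symm x)]
    have h2 := hell (T.symm x)
    rw [hr, real_inner_comm] at h2
    refine le_trans ?_ h2
    rw [div_mul_eq_mul_div, div_le_iff₀ (by positivity), mul_assoc]
    gcongr
    calc ‖x‖ ^ 2 ≤ ((‖a‖ + 1) * ‖T.symm x‖) ^ 2 := by gcongr
      _ = _ := by ring

variable [MeasurableSpace E] [BorelSpace E] {μ : Measure E} [IsFiniteMeasureOnCompacts μ]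

theorem integrable_fderiv_apply {L : ℝ≥0} {V : E → ℝ} (hV : LipschitzWith L V) {h : E → E}
    (hh : Continuous h) (hc : HasCompactSupport h) :
    Integrable (fun x => fderiv ℝ V x (h x)) μ := by
  refine ((hh.norm.integrable_of_hasCompactSupport hc.norm).const_mul (L : ℝ)).mono' ?_
    (ae_of_all _ fun x => ?_)
  · have h1 : Measurable fun x => (fderiv ℝ V x, h x) :=
      (measurable_fderiv ℝ V).prodMk hh.measurable
    exact (isBoundedBilinearMap_apply.continuous.measurable.comp h1).aestronglyMeasurable
  · refine ((fderiv ℝ V x).le_opNorm _).trans ?_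
    gcongr
    exact norm_fderiv_le_of_lipschitz ℝ hV

end Frozen

section Coefficients

variable {A : EucSp n → (EucSp n →L[ℝ] EucSp n)} {γ K M r R : ℝ} {L : ℝ≥0}
  {u U f : EucSp n → ℝ} {D s : Set (EucSp n)} {φ : EucSp n → ℝ}

theorem _root_.HolderSemi.continuousAt (hA : HolderSemi A γ K s) (hγ : 0 < γ) {x : EucSp n}
    (hx : s ∈ 𝓝 x) : ContinuousAt A x := by
  rw [ContinuousAt, tendsto_iff_norm_sub_tendsto_zero]
  have h1 : Tendsto (fun y => K * ‖y - x‖ ^ γ) (𝓝 x) (𝓝 0) := by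
    have : Continuous fun y => K * ‖y - x‖ ^ γ :=
      continuous_const.mul ((continuous_id.sub continuous_const).norm.rpow_const
        fun _ => Or.inr hγ.le)
    simpa [Real.zero_rpow hγ.ne'] using this.tendsto x
  refine squeeze_zero' (Eventually.of_forall fun _ => norm_nonneg _) ?_ h1
  filter_upwards [hx] with y hy using hA y hy x (mem_of_mem_nhds hx)

theorem _root_.IsTest.comp_inv_smul (hr : r ≠ 0) (hφ : ContDiff ℝ (⊤ : ℕ∞) φ)
    (hc : HasCompactSupport φ) (hs : ∀ x ∈ tsupport φ, r • x ∈ D) :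
    IsTest D fun y => φ (r⁻¹ • y) := by
  refine ⟨hφ.comp (contDiff_const_smul _),
    hc.comp_homeomorph (Homeomorph.smulOfNeZero r⁻¹ (inv_ne_zero hr)), fun y hy => ?_⟩
  have h1 : r⁻¹ • y ∈ tsupport φ :=
    tsupport_comp_subset_preimage φ (continuous_const_smul r⁻¹) hy
  simpa [smul_inv_smul₀ hr] using hs _ h1

theorem gradient_comp_inv_smul (φ : EucSp n → ℝ) (r : ℝ) (x : EucSp n) :
    gradient (fun y => φ (r⁻¹ • y)) x = r⁻¹ • gradient φ (r⁻¹ • x) := by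
  simp only [gradient, fderiv_comp_smul, map_smul]

theorem gradient_eq_zero_of_notMem_tsupport {x : EucSp n} (hx : x ∉ tsupport φ) :
    gradient φ x = 0 := by
  rw [gradient, fderiv_of_notMem_tsupport (𝕜 := ℝ) hx, map_zero]

theorem continuous_gradient (hφ : ContDiff ℝ (⊤ : ℕ∞) φ) : Continuous (gradient φ) :=
  (InnerProductSpace.toDual ℝ (EucSp n)).symm.continuous.comp (hφ.continuous_fderiv (by simp))

/-- The weak equation after rescaling. -/
theorem _root_.WeakEq.integral_rescale (h : WeakEq A u f D) (hD : IsOpen D)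
    (hu : EqOn u U D) (hsym : IsSymmCoeff A D) (hr : 0 < r) (hφ : ContDiff ℝ (⊤ : ℕ∞) φ)
    (hc : HasCompactSupport φ) (hs : ∀ x ∈ tsupport φ, r • x ∈ D) :
    ∫ x, fderiv ℝ (rescale U r) x (A (r • x) (gradient φ x)) = -(r * ∫ x, f (r • x) * φ x) := by
  set ψ : EucSp n → ℝ := fun y => φ (r⁻¹ • y) with hψ
  have hT : IsTest D ψ := .comp_inv_smul hr.ne' hφ hc hs
  have hz : ∀ y ∉ D, ψ y = 0 ∧ gradient ψ y = 0 := fun y hy =>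
    ⟨image_eq_zero_of_notMem_tsupport fun h => hy (hT.2.2 h),
      gradient_eq_zero_of_notMem_tsupport fun h => hy (hT.2.2 h)⟩
  have h1 := h ψ hT
  have hgrad : ∀ y ∈ D, gradient u y = gradient U y := fun y hy => by
    rw [gradient, gradient, (hu.eventuallyEq_of_mem (hD.mem_nhds hy)).fderiv_eq]
  have h2 : ∫ x in D, ⟪A x (gradient u x), gradient ψ x⟫ =
      ∫ x, fderiv ℝ U x (A x (gradient ψ x)) := by
    rw [← setIntegral_eq_integral_of_forall_compl_eq_zero (s := D)
      (f := fun x => fderiv ℝ U x (A x (gradient ψ x))) fun x hx => by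
      rw [(hz x hx).2, map_zero, map_zero]]
    refine setIntegral_congr_fun hD.measurableSet fun x hx => ?_
    rw [hgrad x hx, hsym x hx, gradient, InnerProductSpace.toDual_symm_apply]
  rw [h2, setIntegral_eq_integral_of_forall_compl_eq_zero fun x hx => by
    rw [(hz x hx).1, mul_zero], integral_eq_pow_mul_integral_comp _ 0 hr,
    integral_eq_pow_mul_integral_comp (fun x => f x * ψ x) 0 hr, ← mul_neg] at h1
  have h3 := mul_left_cancel₀ (by positivity) h1
  simp only [zero_add, hψ, gradient_comp_inv_smul, inv_smul_smul₀ hr.ne', map_smul,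
    smul_eq_mul] at h3
  rw [integral_const_mul, inv_mul_eq_iff_eq_mul₀ hr.ne', mul_neg] at h3
  simpa only [fderiv_rescale U hr.ne'] using h3

theorem _root_.WeakEq.abs_integral_rescale_le (h : WeakEq A u f D) (hD : IsOpen D)
    (hu : EqOn u U D) (hU : LipschitzWith L U) (hDs : D ⊆ s) (hs : IsOpen s) (h0 : 0 ∈ s)
    (hsym : IsSymmCoeff A s)
    (hA : HolderSemi A γ K s) (hγ : 0 < γ) (hK : 0 ≤ K) (hf : ∀ x ∈ D, |f x| ≤ M)
    (hr : 0 < r) (hφ : ContDiff ℝ (⊤ : ℕ∞) φ) (hc : HasCompactSupport φ)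
    (hsupp : ∀ x ∈ tsupport φ, r • x ∈ D ∧ ‖x‖ ≤ R) :
    |∫ x, fderiv ℝ (rescale U r) x (A 0 (gradient φ x))| ≤
      r * M * (∫ x, |φ x|) + K * (r * R) ^ γ * L * ∫ x, ‖gradient φ x‖ := by
  have hV := hU.rescale hr
  have hg := continuous_gradient hφ
  have hgc : HasCompactSupport (gradient φ) :=
    hc.mono' fun x hx => by_contra fun h => hx (gradient_eq_zero_of_notMem_tsupport h)
  have hk0 : Continuous fun x => A 0 (gradient φ x) := (A 0).continuous.comp hg
  have hk0c : HasCompactSupport fun x => A 0 (gradient φ x) := hgc.comp_left (map_zero _)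
  have hsub : tsupport (fun x => A (r • x) (gradient φ x)) ⊆ tsupport φ := by
    refine closure_minimal (fun x hx => by_contra fun h => hx ?_) (isClosed_tsupport φ)
    simp only [gradient_eq_zero_of_notMem_tsupport h, map_zero]
  have hkc : HasCompactSupport fun x => A (r • x) (gradient φ x) :=
    hc.mono' (subset_closure.trans hsub)
  have hk : Continuous fun x => A (r • x) (gradient φ x) := by
    refine continuous_of_tsupport fun x hx => ?_
    have hx' := hDs (hsupp x (hsub hx)).1
    exact ((hA.continuousAt hγ (hs.mem_nhds hx')).comp
      (f := fun x => r • x) (continuous_const_smul r).continuousAt).clm_apply hg.continuousAt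
  have hi0 := integrable_fderiv_apply (μ := volume) hV hk0 hk0c
  have hi := integrable_fderiv_apply (μ := volume) hV hk hkc
  have hsplit := integral_sub hi0 hi
  rw [h.integral_rescale hD hu (fun x hx => hsym x (hDs hx)) hr hφ hc
    fun x hx => (hsupp x hx).1] at hsplit
  have e1 : |∫ x, f (r • x) * φ x| ≤ M * ∫ x, |φ x| := by
    rw [← integral_const_mul, ← Real.norm_eq_abs]
    refine norm_integral_le_of_norm_le
      ((hφ.continuous.abs.integrable_of_hasCompactSupport hc.abs).const_mul M)
      (ae_of_all _ fun x => ?_)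
    by_cases hx : x ∈ tsupport φ
    · rw [norm_mul, Real.norm_eq_abs, Real.norm_eq_abs]
      gcongr
      exact hf _ (hsupp x hx).1
    · simp [image_eq_zero_of_notMem_tsupport hx]
  have e2 : |∫ x, (fderiv ℝ (rescale U r) x (A 0 (gradient φ x)) -
      fderiv ℝ (rescale U r) x (A (r • x) (gradient φ x)))| ≤
      K * (r * R) ^ γ * L * ∫ x, ‖gradient φ x‖ := by
    rw [← integral_const_mul, ← Real.norm_eq_abs]
    refine norm_integral_le_of_norm_le
      ((hg.norm.integrable_of_hasCompactSupport hgc.norm).const_mul _) (ae_of_all _ fun x => ?_)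
    by_cases hx : x ∈ tsupport φ
    · rw [← map_sub, ← _root_.sub_apply]
      have h1 : ‖A 0 - A (r • x)‖ ≤ K * (r * R) ^ γ := by
        refine (hA 0 h0 _ (hDs (hsupp x hx).1)).trans ?_
        rw [zero_sub, norm_neg, norm_smul, Real.norm_of_nonneg hr.le]
        gcongr
        exact (hsupp x hx).2
      calc _ ≤ ‖fderiv ℝ (rescale U r) x‖ * (‖A 0 - A (r • x)‖ * ‖gradient φ x‖) :=
            (ContinuousLinearMap.le_opNorm _ _).trans (by
              gcongr
              exact ContinuousLinearMap.le_opNorm _ _)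
        _ ≤ L * (K * (r * R) ^ γ * ‖gradient φ x‖) := by
            gcongr
            exact norm_fderiv_le_of_lipschitz ℝ hV
        _ = _ := by ring
    · simp [gradient_eq_zero_of_notMem_tsupport hx]
  rw [hsplit] at e2
  rw [abs_le] at e1 e2 ⊢
  have h1 := mul_le_mul_of_nonneg_left e1.1 hr.le
  have h2 := mul_le_mul_of_nonneg_left e1.2 hr.le
  constructor <;> linarith [e2.1, e2.2]

end Coefficients

section InteriorBall

variable {A : EucSp n → (EucSp n →L[ℝ] EucSp n)} {γ K M ρ : ℝ} {L : ℝ≥0}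
  {u U f : EucSp n → ℝ} {D s : Set (EucSp n)} {e : EucSp n}

theorem smul_mem_ball_smul {E : Type*} [NormedAddCommGroup E] [InnerProductSpace ℝ E] {e x : E}
    {ρ r : ℝ} (he : ‖e‖ = 1) (hρ : 0 < ρ) (hr : 0 < r) (h : r * ‖x‖ ^ 2 < 2 * ρ * ⟪e, x⟫) :
    r • x ∈ ball (ρ • e) ρ := by
  rw [mem_ball, dist_eq_norm, ← sq_lt_sq₀ (norm_nonneg _) hρ.le, norm_sub_sq_real, norm_smul,
    norm_smul, he, real_inner_smul_left, real_inner_smul_right, real_inner_comm,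
    Real.norm_of_nonneg hr.le, Real.norm_of_nonneg hρ.le]
  nlinarith

theorem inner_pos_of_mem_ball_smul {E : Type*} [NormedAddCommGroup E] [InnerProductSpace ℝ E]
    {e x : E} {ρ : ℝ} (he : ‖e‖ = 1) (hρ : 0 < ρ) (hx : x ∈ ball (ρ • e) ρ) : 0 < ⟪e, x⟫ := by
  rw [mem_ball, dist_eq_norm, ← sq_lt_sq₀ (norm_nonneg _) hρ.le, norm_sub_sq_real, norm_smul,
    he, real_inner_smul_right, real_inner_comm, Real.norm_of_nonneg hρ.le] at hx
  nlinarith [sq_nonneg ‖x‖]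

theorem AlmostSolution.of_weakEq (h : WeakEq A u f D) (hD : IsOpen D)
    (hu : EqOn u U D) (hU : LipschitzWith L U) (hU0 : U 0 = 0) (hpos : ∀ x ∈ D, 0 ≤ u x)
    (hDs : D ⊆ s) (hs : IsOpen s) (h0 : 0 ∈ s) (hsym : IsSymmCoeff A s)
    (hA : HolderSemi A γ K s) (hγ0 : 0 < γ) (hγ1 : γ < 1) (hK : 0 ≤ K)
    (hf : ∀ x ∈ D, |f x| ≤ M) (he : ‖e‖ = 1) (hρ : 0 < ρ) (hint : ball (ρ • e) ρ ∩ s ⊆ D) :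
    AlmostSolution volume (A 0) e γ L U := by
  refine ⟨hU, hU0, fun R => ?_⟩
  set C : ℝ := R ^ 2 / ρ + K * |R| ^ γ * L + |M| + 1 with hC
  have hR1 : 0 ≤ R ^ 2 / ρ := by positivity
  have hR2 : 0 ≤ K * |R| ^ γ * L := by positivity
  have hR3 := abs_nonneg M
  refine ⟨C, by positivity, ?_⟩
  obtain ⟨δ, hδ, hδs⟩ := Metric.isOpen_iff.1 hs 0 h0
  have hev : ∀ᶠ r in 𝓝[>] (0 : ℝ), r ∈ Ioo 0 (min 1 (δ / (|R| + 1))) :=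
    Ioo_mem_nhdsGT (by positivity)
  filter_upwards [hev] with r ⟨hr, hr'⟩
  rw [lt_min_iff, lt_div_iff₀ (by positivity)] at hr'
  obtain ⟨hr1, hrδ⟩ := hr'
  have hmem : ∀ x, ‖x‖ < R → C * r < ⟪e, x⟫ → r • x ∈ D := by
    refine fun x hx hxe => hint ⟨smul_mem_ball_smul he hρ hr ?_, hδs ?_⟩
    · have h1 : R ^ 2 / ρ * r ≤ C * r := by
        gcongr
        linarith
      have h2 : R ^ 2 / ρ * r * ρ = R ^ 2 * r := by field_simp
      have h3 : ‖x‖ ^ 2 ≤ R ^ 2 := by gcongr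
      have h4 : 0 < ⟪e, x⟫ := lt_of_le_of_lt (by positivity) hxe
      nlinarith [mul_lt_mul_of_pos_right (h1.trans_lt hxe) hρ]
    · rw [mem_ball_zero_iff, norm_smul, Real.norm_of_nonneg hr.le]
      nlinarith [le_abs_self R]
  refine ⟨fun x hx hxe => ?_, fun φ hφ hc hsupp => ?_⟩
  · have hx' := hmem x hx hxe
    exact div_nonneg (hu hx' ▸ hpos _ hx') hr.le
  · refine (h.abs_integral_rescale_le hD hu hU hDs hs h0 hsym hA hγ0 hK hf hr hφ hc (R := |R|)
      fun x hx => ⟨hmem x (hsupp hx).1 (hsupp hx).2,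
        (hsupp hx).1.le.trans (le_abs_self R)⟩).trans ?_
    rw [mul_add]
    refine add_le_add (mul_le_mul_of_nonneg_right ?_ (integral_nonneg fun _ => abs_nonneg _))
      (mul_le_mul_of_nonneg_right ?_ (integral_nonneg fun _ => norm_nonneg _))
    · have h1 : r ≤ r ^ γ := by
        simpa using Real.rpow_le_rpow_of_exponent_ge hr hr1.le hγ1.le
      calc r * M ≤ r * |M| := by
            gcongr
            exact le_abs_self M
        _ ≤ r ^ γ * |M| := by gcongr
        _ ≤ C * r ^ γ := by
            rw [mul_comm]
            gcongr
            linarith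
    · rw [Real.mul_rpow hr.le (abs_nonneg R)]
      calc K * (r ^ γ * |R| ^ γ) * L = K * |R| ^ γ * L * r ^ γ := by ring
        _ ≤ C * r ^ γ := by
            gcongr
            linarith

end InteriorBall

end AsymptoticDev

/-- **Lemma 2.3 (Asymptotic development, interior touching ball).** -/
theorem asymptotic_dev_interior_ball
    {n : ℕ} (hn : 2 ≤ n)
    (A : EucSp n → (EucSp n →L[ℝ] EucSp n)) (γ lam Lam K : ℝ)
    (hγ : γ ∈ Set.Ioo (0:ℝ) 1) (hlam : 0 < lam) (hlamLam : lam ≤ Lam) (hK : 0 < K)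
    (hell : IsElliptic A lam Lam (ball 0 2)) (hsym : IsSymmCoeff A (ball 0 2))
    (hhold : HolderSemi A γ K (ball 0 2))
    (Ω : Set (EucSp n)) (hΩ : IsOpen Ω) (h0 : (0 : EucSp n) ∈ frontier Ω)
    (ρ : ℝ) (hρ : 0 < ρ)
    (hint : ball (ρ • EuclideanSpace.single (⟨0, by omega⟩ : Fin n) (1:ℝ)) ρ ⊆ Ω)
    (f : EucSp n → ℝ) (M : ℝ) (hf : ∀ x ∈ Ω ∩ ball 0 2, |f x| ≤ M)
    (u : EucSp n → ℝ) (L : ℝ≥0)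
    (hLip : LipschitzOnWith L u (closure Ω ∩ ball 0 2))
    (hpos : ∀ x ∈ closure Ω ∩ ball (0 : EucSp n) 2, 0 ≤ u x)
    (heq : WeakEq A u f (Ω ∩ ball 0 2))
    (hzero : ∀ x ∈ frontier Ω ∩ ball (0 : EucSp n) 2, u x = 0) :
    ∃ α : ℝ, 0 ≤ α ∧
      SmallO (fun x => u x - α * x ⟨0, by omega⟩) 0
        (ball (ρ • EuclideanSpace.single (⟨0, by omega⟩ : Fin n) (1:ℝ)) ρ) := by
  set e : EucSp n := EuclideanSpace.single (⟨0, by omega⟩ : Fin n) (1 : ℝ) with he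
  have he1 : ‖e‖ = 1 := by simp [he]
  have hex (x : EucSp n) : ⟪e, x⟫ = x ⟨0, by omega⟩ := by
    rw [he, EuclideanSpace.inner_single_left, map_one, one_mul]
  obtain ⟨U, hU, huU⟩ := hLip.extend_real
  have h02 : (0 : EucSp n) ∈ ball (0 : EucSp n) 2 := mem_ball_self two_pos
  have hsub : Ω ∩ ball (0 : EucSp n) 2 ⊆ closure Ω ∩ ball 0 2 :=
    inter_subset_inter_left _ subset_closure
  have hU0 : U 0 = 0 := by
    rw [← huU ⟨frontier_subset_closure h0, h02⟩, hzero 0 ⟨h0, h02⟩]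
  have hsol : AsymptoticDev.AlmostSolution volume (A 0) e γ L U :=
    .of_weakEq heq (hΩ.inter isOpen_ball) (huU.mono hsub) hU hU0 (fun x hx => hpos x (hsub hx))
      inter_subset_right isOpen_ball h02 hsym hhold hγ.1 hγ.2 hK.le hf he1 hρ
      (inter_subset_inter_left _ hint)
  obtain ⟨B, c, hp⟩ := AsymptoticDev.exists_ellipticPair hlam (hsym 0 h02)
    fun x => (hell 0 h02 x).1
  obtain ⟨α, hα, hexp⟩ := hsol.exists_expansion hp hγ.1 hγ.2 (norm_pos_iff.1 (he1 ▸ one_pos))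
  refine ⟨α, hα, fun ε hε => ?_⟩
  have hle : 𝓝[ball (ρ • e) ρ] (0 : EucSp n) ≤ 𝓝[{x | 0 ≤ ⟪e, x⟫}] 0 :=
    nhdsWithin_mono _ fun x hx => (AsymptoticDev.inner_pos_of_mem_ball_smul he1 hρ hx).le
  filter_upwards [hle (hexp ε hε), self_mem_nhdsWithin,
    nhdsWithin_le_nhds (isOpen_ball.mem_nhds h02)] with x hx hxb hx2
  rw [sub_zero, huU (hsub ⟨hint hxb, hx2⟩), ← hex]
  exact hx
end
end

section
/- Let B ⊂ ℝⁿ be an open ball, M ≥ 0, and let v be a locally Lipschitz function on B satisfying 𝓛v ≥ −M weakly in the open set B ∩ {v > 0}. Then v⁺ = max(v, 0) satisfies 𝓛v⁺ ≥ −M weakly in B, i.e. ∫_B ⟨A(x)∇v⁺(x), ∇φ(x)⟩ dx ≤ M ∫_B φ dx for every nonnegative smooth φ with compact support in B. -/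
open Set Filter MeasureTheory Metric Bornology
open scoped Topology RealInnerProductSpace ENNReal NNReal

noncomputable section

variable {n : ℕ}

section Mollification

open scoped Convolution

/-- A locally Lipschitz function with compact support is globally Lipschitz. -/
lemma LocallyLipschitz.exists_lipschitzWith_of_hasCompactSupport {f : EucSp n → ℝ}
    (hf : LocallyLipschitz f) (hc : HasCompactSupport f) : ∃ C, LipschitzWith C f := by
  have hS : IsCompact (cthickening 1 (tsupport f)) := hc.isCompact.cthickening
  obtain ⟨K, hK⟩ := hf.locallyLipschitzOn.exists_lipschitzOnWith_of_compact hS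
  obtain ⟨B, hB⟩ := hc.exists_bound_of_continuous hf.continuous
  have hB0 : 0 ≤ B := (norm_nonneg _).trans (hB 0)
  have key : ∀ x ∈ cthickening 1 (tsupport f), ∀ y ∉ cthickening 1 (tsupport f),
      dist (f x) (f y) ≤ max K ⟨B, hB0⟩ * dist x y := by
    intro x hx y hy
    have hfy : f y = 0 := by
      by_contra h
      exact hy (self_subset_cthickening _ (subset_tsupport f h))
    by_cases hfx : f x = 0
    · rw [hfx, hfy, dist_self]; positivity
    · have hd : 1 ≤ dist x y := by
        by_contra! h
        exact hy (mem_cthickening_of_dist_le y x 1 _ (subset_tsupport f hfx)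
          (by rw [dist_comm]; exact h.le))
      rw [hfy, dist_zero_right]
      calc ‖f x‖ ≤ B * 1 := by rw [mul_one]; exact hB x
        _ ≤ max K ⟨B, hB0⟩ * dist x y := by
          gcongr
          exact (NNReal.coe_le_coe.2 (le_max_right K ⟨B, hB0⟩))
  refine ⟨max K ⟨B, hB0⟩, LipschitzWith.of_dist_le_mul fun x y => ?_⟩
  by_cases hx : x ∈ cthickening 1 (tsupport f) <;> by_cases hy : y ∈ cthickening 1 (tsupport f)
  · refine (hK.dist_le_mul x hx y hy).trans ?_
    gcongr
    exact le_max_left _ _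
  · exact key x hx y hy
  · rw [dist_comm, dist_comm x]; exact key y hy x hx
  · have h0 : ∀ z ∉ cthickening 1 (tsupport f), f z = 0 := by
      intro z hz
      by_contra h
      exact hz (self_subset_cthickening _ (subset_tsupport f h))
    rw [h0 x hx, h0 y hy, dist_self]; positivity

/-- Mollification by a normed bump function does not increase a uniform bound. -/
lemma norm_normed_convolution_le {E : Type*} [NormedAddCommGroup E] [NormedSpace ℝ E]
    (ρ : ContDiffBump (0 : EucSp n)) {f : EucSp n → E} {C : ℝ} (hC : ∀ x, ‖f x‖ ≤ C)
    (x : EucSp n) :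
    ‖(ρ.normed volume ⋆[ContinuousLinearMap.lsmul ℝ ℝ, volume] f) x‖ ≤ C := by
  rw [convolution_def]
  calc _ ≤ ∫ t, ρ.normed volume t * C := by
        refine norm_integral_le_of_norm_le (ρ.integrable_normed.mul_const C)
          (ae_of_all _ fun t => ?_)
        rw [ContinuousLinearMap.lsmul_apply, norm_smul, Real.norm_of_nonneg (ρ.nonneg_normed t)]
        exact mul_le_mul_of_nonneg_left (hC _) (ρ.nonneg_normed t)
    _ = C := by rw [integral_mul_const, ρ.integral_normed, one_mul]

/-- The derivative of a mollified Lipschitz function is the mollified derivative. -/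
lemma LipschitzWith.fderiv_normed_convolution (ρ : ContDiffBump (0 : EucSp n))
    {ψ : EucSp n → ℝ} {C : ℝ≥0} (hψ : LipschitzWith C ψ) (x : EucSp n) :
    fderiv ℝ (ρ.normed volume ⋆[ContinuousLinearMap.lsmul ℝ ℝ, volume] ψ) x =
      (ρ.normed volume ⋆[ContinuousLinearMap.lsmul ℝ ℝ, volume] (fderiv ℝ ψ)) x := by
  have hcont : ∀ y, Continuous fun t => ρ.normed volume t • ψ (y - t) := fun y =>
    ρ.continuous_normed.smul (hψ.continuous.comp (continuous_const.sub continuous_id))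
  have hdiff : ∀ᵐ t, DifferentiableAt ℝ ψ (x - t) :=
    (quasiMeasurePreserving_sub_left volume x).ae hψ.ae_differentiableAt
  refine (hasFDerivAt_integral_of_dominated_loc_of_lip' (𝕜 := ℝ)
    (F := fun y t => ρ.normed volume t • ψ (y - t))
    (F' := fun t => ρ.normed volume t • fderiv ℝ ψ (x - t))
    (bound := fun t => ρ.normed volume t * C) univ_mem ?_ ?_ ?_ ?_ ?_ ?_).2.fderiv
  · exact fun y _ => (hcont y).aestronglyMeasurable
  · exact (hcont x).integrable_of_hasCompactSupport ρ.hasCompactSupport_normed.smul_right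
  · exact (ρ.continuous_normed.measurable.smul
      ((measurable_fderiv ℝ ψ).comp (measurable_const.sub measurable_id))).aestronglyMeasurable
  · refine ae_of_all _ fun t y _ => ?_
    rw [← smul_sub, norm_smul, Real.norm_of_nonneg (ρ.nonneg_normed t), mul_assoc]
    refine mul_le_mul_of_nonneg_left ?_ (ρ.nonneg_normed t)
    simpa using hψ.norm_sub_le (y - t) (x - t)
  · exact ρ.integrable_normed.mul_const _
  · filter_upwards [hdiff] with t ht
    have hsub : HasFDerivAt (fun y => y - t) (ContinuousLinearMap.id ℝ (EucSp n)) x :=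
      (hasFDerivAt_id x).sub_const t
    exact (ht.hasFDerivAt.comp x hsub).const_smul (ρ.normed volume t)

/-- A Lipschitz function compactly supported in an open set is a limit of test functions there,
with uniform bounds and almost everywhere convergence of the derivatives. -/
lemma LipschitzWith.exists_isTest_approx {D : Set (EucSp n)} (hD : IsOpen D) {ψ : EucSp n → ℝ}
    {C : ℝ≥0} (hψ : LipschitzWith C ψ) (hc : HasCompactSupport ψ) (hsupp : tsupport ψ ⊆ D)
    (hnn : ∀ x, 0 ≤ ψ x) :
    ∃ (u : ℕ → EucSp n → ℝ) (S : Set (EucSp n)) (B : ℝ), IsCompact S ∧ S ⊆ D ∧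
      (∀ k, IsTest D (u k)) ∧ (∀ k x, 0 ≤ u k x) ∧ (∀ k, tsupport (u k) ⊆ S) ∧
      (∀ k x, ‖u k x‖ ≤ B) ∧ (∀ k x, ‖fderiv ℝ (u k) x‖ ≤ C) ∧
      (∀ x, Tendsto (fun k => u k x) atTop (𝓝 (ψ x))) ∧
      ∀ᵐ x, Tendsto (fun k => fderiv ℝ (u k) x) atTop (𝓝 (fderiv ℝ ψ x)) := by
  obtain ⟨δ, hδ, hδD⟩ := hc.isCompact.exists_cthickening_subset_open hD hsupp
  obtain ⟨B, hB⟩ := hc.exists_bound_of_continuous hψ.continuous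
  have hpos : ∀ k : ℕ, 0 < δ / (k + 1) := fun k => by positivity
  let ρ : ℕ → ContDiffBump (0 : EucSp n) := fun k =>
    ⟨δ / (k + 1) / 2, δ / (k + 1), half_pos (hpos k), half_lt_self (hpos k)⟩
  have hρ : Tendsto (fun k => (ρ k).rOut) atTop (𝓝 0) := by
    simpa [ρ, div_eq_mul_inv] using (tendsto_one_div_add_atTop_nhds_zero_nat (𝕜 := ℝ)).const_mul δ
  let u : ℕ → EucSp n → ℝ := fun k =>
    (ρ k).normed volume ⋆[ContinuousLinearMap.lsmul ℝ ℝ, volume] ψ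
  have hC : ∀ x, ‖fderiv ℝ ψ x‖ ≤ C := fun x => norm_fderiv_le_of_lipschitz ℝ hψ
  have hS : IsCompact (cthickening δ (tsupport ψ)) := hc.isCompact.cthickening
  have hsub : ∀ k, tsupport (u k) ⊆ cthickening δ (tsupport ψ) := by
    intro k
    refine closure_minimal (fun x hx => ?_) isClosed_cthickening
    obtain ⟨a, ha, b, hb, rfl⟩ := support_convolution_subset _ hx
    rw [(ρ k).support_normed_eq, mem_ball_zero_iff] at ha
    refine mem_cthickening_of_dist_le _ b _ _ (subset_tsupport ψ hb) ?_
    simp only [dist_add_self_left]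
    refine ha.le.trans (div_le_self hδ.le ?_)
    simp
  refine ⟨u, _, B, hS, hδD, fun k => ⟨?_, ?_, (hsub k).trans hδD⟩, fun k x => ?_, hsub,
    fun k x => norm_normed_convolution_le _ hB x, fun k x => ?_, fun x => ?_, ?_⟩
  · exact (ρ k).hasCompactSupport_normed.contDiff_convolution_left _ (ρ k).contDiff_normed
      hψ.continuous.locallyIntegrable
  · exact hS.of_isClosed_subset (isClosed_tsupport _) (hsub k)
  · exact integral_nonneg fun t => mul_nonneg ((ρ k).nonneg_normed t) (hnn _)
  · rw [hψ.fderiv_normed_convolution]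
    exact norm_normed_convolution_le _ hC x
  · exact ContDiffBump.convolution_tendsto_right_of_continuous hρ hψ.continuous x
  · have hloc : LocallyIntegrable (fderiv ℝ ψ) volume :=
      (locallyIntegrable_const (C : ℝ)).mono
        (measurable_fderiv ℝ ψ).aestronglyMeasurable
        (ae_of_all _ fun x => by simpa using hC x)
    filter_upwards [ContDiffBump.ae_convolution_tendsto_right_of_locallyIntegrable (K := 2) hρ
      (Eventually.of_forall fun k => by simp only [ρ]; linarith) hloc] with x hx
    simpa only [u, hψ.fderiv_normed_convolution] using hx

end Mollification

/-- Pairing a field integrable on `S` with bounded linear forms vanishing off `S`. -/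
lemma IntegrableOn.clm_apply_of_bound {S : Set (EucSp n)} {F : EucSp n → EucSp n}
    (hS : MeasurableSet S) (hF : IntegrableOn F S) {L : EucSp n → EucSp n →L[ℝ] ℝ}
    (hL : AEStronglyMeasurable L (volume.restrict S)) {C : ℝ} (hC : ∀ x ∈ S, ‖L x‖ ≤ C)
    (h0 : ∀ x ∉ S, L x = 0) : Integrable fun x => L x (F x) := by
  rw [← integrableOn_iff_integrable_of_support_subset (s := S)]
  · refine Integrable.mono' (hF.norm.const_mul C) ?_ ?_
    · exact (ContinuousLinearMap.apply ℝ ℝ).flip.aestronglyMeasurable_comp₂ hL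
        hF.aestronglyMeasurable
    · filter_upwards [ae_restrict_mem hS] with x hx
      exact (L x).le_of_opNorm_le (hC x hx) _
  · intro x hx
    by_contra h
    exact hx (by simp [h0 x h])

/-- A differential inequality tested against smooth functions extends to Lipschitz test
functions. -/
lemma setIntegral_fderiv_apply_le_of_lipschitz {D : Set (EucSp n)} (hD : IsOpen D)
    {F : EucSp n → EucSp n} (hF : ∀ S ⊆ D, IsCompact S → IntegrableOn F S) {M : ℝ}
    (h : ∀ φ, IsTest D φ → (∀ x, 0 ≤ φ x) →
      ∫ x in D, fderiv ℝ φ x (F x) ≤ M * ∫ x in D, φ x)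
    {ψ : EucSp n → ℝ} {C : ℝ≥0} (hψ : LipschitzWith C ψ) (hc : HasCompactSupport ψ)
    (hsupp : tsupport ψ ⊆ D) (hnn : ∀ x, 0 ≤ ψ x) :
    ∫ x in D, fderiv ℝ ψ x (F x) ≤ M * ∫ x in D, ψ x := by
  obtain ⟨u, S, B, hS, hSD, htest, hunn, husupp, huB, huC, hu, hu'⟩ :=
    hψ.exists_isTest_approx hD hc hsupp hnn
  have hFS := hF S hSD hS
  have hzero : ∀ k, ∀ x ∉ S, fderiv ℝ (u k) x = 0 := fun k x hx =>
    image_eq_zero_of_notMem_tsupport fun hx' => hx (husupp k (tsupport_fderiv_subset ℝ hx'))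
  refine le_of_tendsto_of_tendsto' (f := fun k => ∫ x in D, fderiv ℝ (u k) x (F x))
    (g := fun k => M * ∫ x in D, u k x) (b := atTop) ?_ (Tendsto.const_mul M ?_)
    fun k => h _ (htest k) (hunn k)
  · refine tendsto_integral_of_dominated_convergence (S.indicator fun x => C * ‖F x‖)
      (fun k => ?_) ?_ (fun k => ae_of_all _ fun x => ?_) ?_
    · exact (IntegrableOn.clm_apply_of_bound hS.measurableSet hFS
        (measurable_fderiv ℝ (u k)).aestronglyMeasurable (fun x _ => huC k x)
        (hzero k)).aestronglyMeasurable.restrict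
    · exact ((integrable_indicator_iff hS.measurableSet).2 (hFS.norm.const_mul _)).restrict
    · by_cases hx : x ∈ S
      · rw [indicator_of_mem hx]
        exact (fderiv ℝ (u k) x).le_of_opNorm_le (huC k x) _
      · simp [hx, hzero k x hx]
    · filter_upwards [ae_restrict_of_ae hu'] with x hx
      exact ((ContinuousLinearMap.apply ℝ ℝ (F x)).continuous.tendsto _).comp hx
  · refine tendsto_integral_of_dominated_convergence (S.indicator fun _ => B)
      (fun k => ?_) ?_ (fun k => ae_of_all _ fun x => ?_) (ae_of_all _ hu)
    · exact (htest k).1.continuous.aestronglyMeasurable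
    · exact ((integrable_indicator_iff hS.measurableSet).2
        (integrableOn_const hS.measure_lt_top.ne)).restrict
    · by_cases hx : x ∈ S
      · rw [indicator_of_mem hx]
        exact huB k x
      · have : u k x = 0 := image_eq_zero_of_notMem_tsupport fun hx' => hx (husupp k hx')
        simp [hx, this]

section LocLipOn

variable {v : EucSp n → ℝ} {U : Set (EucSp n)}

lemma LocLipOn.locallyLipschitzOn (hv : LocLipOn v U) : LocallyLipschitzOn U v :=
  fun _ hx => hv _ hx

/-- Rademacher's theorem for locally Lipschitz functions on an open set. -/
lemma LocLipOn.ae_differentiableAt (hv : LocLipOn v U) (hU : IsOpen U) :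
    ∀ᵐ x, x ∈ U → DifferentiableAt ℝ v x := by
  have : volume {x | x ∈ U ∧ ¬ DifferentiableAt ℝ v x} = 0 := by
    refine measure_null_of_locally_null _ fun x hx => ?_
    obtain ⟨C, t, ht, hL⟩ := hv x hx.1
    rw [hU.nhdsWithin_eq hx.1] at ht
    refine ⟨{y | y ∈ U ∧ ¬ DifferentiableAt ℝ v y} ∩ interior t,
      inter_mem_nhdsWithin _ (interior_mem_nhds.2 ht), ?_⟩
    refine measure_mono_null (fun y hy => ?_) (ae_iff.1 hL.ae_differentiableWithinAt_of_mem)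
    exact fun h => hy.1.2 ((h (interior_subset hy.2)).differentiableAt
      (mem_interior_iff_mem_nhds.1 hy.2))
  rw [ae_iff]
  simpa only [Classical.not_imp] using this

lemma LocLipOn.exists_norm_fderiv_le (hv : LocLipOn v U) (hU : IsOpen U) {S : Set (EucSp n)}
    (hS : IsCompact S) (hSU : S ⊆ U) : ∃ C : ℝ, ∀ x ∈ S, ‖fderiv ℝ v x‖ ≤ C := by
  obtain ⟨L, hL, hSL, hLU⟩ := exists_compact_between hS hU hSU
  obtain ⟨C, hC⟩ := (hv.locallyLipschitzOn.mono hLU).exists_lipschitzOnWith_of_compact hL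
  exact ⟨C, fun x hx =>
    norm_fderiv_le_of_lipschitzOn ℝ (mem_interior_iff_mem_nhds.1 (hSL hx)) hC⟩

end LocLipOn

lemma HolderSemi.continuousOn {A : EucSp n → (EucSp n →L[ℝ] EucSp n)} {γ K : ℝ}
    {U : Set (EucSp n)} (hA : HolderSemi A γ K U) (hγ : 0 < γ) : ContinuousOn A U := by
  intro x hx
  refine tendsto_iff_norm_sub_tendsto_zero.2 (squeeze_zero' (g := fun y => K * ‖y - x‖ ^ γ)
    (Eventually.of_forall fun _ => norm_nonneg _) ?_ ?_)
  · filter_upwards [self_mem_nhdsWithin] with y hy using hA y hy x hx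
  · have hcont : Continuous fun y : EucSp n => K * ‖y - x‖ ^ γ :=
      continuous_const.mul ((continuous_id.sub continuous_const).norm.rpow_const
        fun _ => Or.inr hγ.le)
    have := hcont.tendsto x
    simp only [sub_self, norm_zero, Real.zero_rpow hγ.ne', mul_zero] at this
    exact this.mono_left nhdsWithin_le_nhds

lemma measurable_gradient (v : EucSp n → ℝ) : Measurable (gradient v) :=
  (InnerProductSpace.toDual ℝ (EucSp n)).symm.continuous.measurable.comp (measurable_fderiv ℝ v)

lemma norm_gradient (v : EucSp n → ℝ) (x : EucSp n) : ‖gradient v x‖ = ‖fderiv ℝ v x‖ :=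
  (InnerProductSpace.toDual ℝ (EucSp n)).symm.norm_map _

lemma inner_gradient_eq_fderiv (φ : EucSp n → ℝ) (x y : EucSp n) :
    ⟪y, gradient φ x⟫ = fderiv ℝ φ x y := by
  rw [real_inner_comm, inner_gradient_left]

/-- The flux `A ∇v` is integrable on compact sets. -/
lemma integrableOn_flux {A : EucSp n → (EucSp n →L[ℝ] EucSp n)} {v : EucSp n → ℝ}
    {U S : Set (EucSp n)} (hU : IsOpen U) (hA : ContinuousOn A U) (hv : LocLipOn v U)
    (hS : IsCompact S) (hSU : S ⊆ U) : IntegrableOn (fun x => A x (gradient v x)) S := by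
  obtain ⟨a, ha⟩ := hS.exists_bound_of_continuousOn (hA.mono hSU)
  obtain ⟨C, hC⟩ := hv.exists_norm_fderiv_le hU hS hSU
  refine Integrable.mono' (g := fun _ => a * C) (integrableOn_const hS.measure_lt_top.ne) ?_ ?_
  · exact (ContinuousLinearMap.id ℝ (EucSp n →L[ℝ] EucSp n)).aestronglyMeasurable_comp₂
      ((hA.mono hSU).aestronglyMeasurable hS.measurableSet)
      (measurable_gradient v).aestronglyMeasurable
  · filter_upwards [ae_restrict_mem hS.measurableSet] with x hx
    refine (A x).le_of_opNorm_le_of_le (ha x hx) ?_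
    rw [norm_gradient]
    exact hC x hx

lemma IsTest.integrable_fderiv_flux {A : EucSp n → (EucSp n →L[ℝ] EucSp n)}
    {v φ : EucSp n → ℝ} {U : Set (EucSp n)} (hφ : IsTest U φ) (hU : IsOpen U)
    (hA : ContinuousOn A U) (hv : LocLipOn v U) :
    Integrable fun x => fderiv ℝ φ x (A x (gradient v x)) := by
  obtain ⟨a, ha⟩ := (hφ.1.continuous_fderiv (by simp)).bounded_above_of_compact_support
    (hφ.2.1.fderiv (𝕜 := ℝ))
  exact IntegrableOn.clm_apply_of_bound hφ.2.1.isCompact.measurableSet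
    (integrableOn_flux hU hA hv hφ.2.1.isCompact hφ.2.2)
    (measurable_fderiv ℝ φ).aestronglyMeasurable (fun x _ => ha x) fun x hx =>
      image_eq_zero_of_notMem_tsupport fun hx' => hx (tsupport_fderiv_subset ℝ hx')

lemma gradient_PPart_of_pos {v : EucSp n → ℝ} {x : EucSp n} (hv : ContinuousAt v x)
    (hx : 0 < v x) : gradient (PPart v) x = gradient v x := by
  have : PPart v =ᶠ[𝓝 x] v := by
    filter_upwards [hv.eventually (lt_mem_nhds hx)] with y hy using max_eq_left hy.le
  rw [gradient, gradient, this.fderiv_eq]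

lemma gradient_PPart_of_nonpos {v : EucSp n → ℝ} {x : EucSp n} (hx : v x ≤ 0) :
    gradient (PPart v) x = 0 := by
  have : IsLocalMin (PPart v) x := Eventually.of_forall fun y => by
    simp only [PPart, max_eq_right hx]
    exact le_max_right _ _
  rw [gradient, this.fderiv_eq_zero, map_zero]

/-- The weak inequality on `{v > 0}` with an additional nondecreasing smooth cutoff of `v`
vanishing near `(-∞, 0]`. -/
lemma setIntegral_cutoff_mul_fderiv_le {U : Set (EucSp n)} (hU : IsOpen U)
    {A : EucSp n → (EucSp n →L[ℝ] EucSp n)} (hA : ContinuousOn A U)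
    (hpos : ∀ x ∈ U, ∀ ξ, 0 ≤ ⟪A x ξ, ξ⟫) {v : EucSp n → ℝ} (hv : LocLipOn v U) {M : ℝ}
    (h : ∀ φ, IsTest (U ∩ {x | 0 < v x}) φ → (∀ x, 0 ≤ φ x) →
      ∫ x in U ∩ {x | 0 < v x}, fderiv ℝ φ x (A x (gradient v x)) ≤
        M * ∫ x in U ∩ {x | 0 < v x}, φ x)
    {φ : EucSp n → ℝ} (hφ : IsTest U φ) (hφ0 : ∀ x, 0 ≤ φ x)
    {η : ℝ → ℝ} (hη : ContDiff ℝ 1 η) (hmono : Monotone η) (hη0 : ∀ t, 0 ≤ η t)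
    (hη1 : ∀ t, η t ≤ 1) {ε : ℝ} (hε : 0 < ε) (hηε : ∀ t ≤ ε, η t = 0) :
    ∫ x in U ∩ {x | 0 < v x}, η (v x) * fderiv ℝ φ x (A x (gradient v x)) ≤
      M * ∫ x in U ∩ {x | 0 < v x}, η (v x) * φ x := by
  set D := U ∩ {x | 0 < v x}
  have hvc : ContinuousOn v U := hv.locallyLipschitzOn.continuousOn
  have hD : IsOpen D := hvc.isOpen_inter_preimage hU isOpen_Ioi
  let S := tsupport φ ∩ {x | ε ≤ v x}
  have hScl : IsClosed S := (hvc.mono hφ.2.2).preimage_isClosed_of_isClosed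
    (isClosed_tsupport φ) isClosed_Ici
  have hSc : IsCompact S := hφ.2.1.isCompact.of_isClosed_subset hScl inter_subset_left
  have hSD : S ⊆ D := fun x hx => ⟨hφ.2.2 hx.1, hε.trans_le hx.2⟩
  let ψ : EucSp n → ℝ := fun x => η (v x) * φ x
  have hψS : tsupport ψ ⊆ S := by
    refine closure_minimal (fun x hx => ⟨subset_tsupport φ (right_ne_zero_of_mul hx), ?_⟩) hScl
    by_contra hlt
    exact left_ne_zero_of_mul hx (hηε _ (not_le.1 hlt).le)
  have hψc : HasCompactSupport ψ := hSc.of_isClosed_subset (isClosed_tsupport _) hψS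
  have hψlip : LocallyLipschitz ψ := by
    intro x
    by_cases hx : x ∈ U
    · obtain ⟨C, t, ht, hL⟩ := hv x hx
      rw [hU.nhdsWithin_eq hx] at ht
      obtain ⟨C', t', ht', hL'⟩ := (hφ.1.of_le (by simp)).locallyLipschitz x
      have hP : ContDiff ℝ 1 fun p : ℝ × ℝ => η p.1 * p.2 :=
        (hη.comp contDiff_fst).mul contDiff_snd
      obtain ⟨C'', t'', ht'', hL''⟩ := hP.locallyLipschitz (v x, φ x)
      have hc : ContinuousAt (fun y => (v y, φ y)) x :=
        (hvc.continuousAt (hU.mem_nhds hx)).prodMk hφ.1.continuous.continuousAt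
      refine ⟨C'' * max C C', t ∩ t' ∩ (fun y => (v y, φ y)) ⁻¹' t'',
        inter_mem (inter_mem ht ht') (hc ht''), ?_⟩
      exact hL''.comp ((hL.mono fun y hy => hy.1.1).prodMk (hL'.mono fun y hy => hy.1.2))
        fun y hy => hy.2
    · refine ⟨0, (tsupport ψ)ᶜ, (isClosed_tsupport ψ).isOpen_compl.mem_nhds
        fun hx' => hx (hSD (hψS hx')).1, ?_⟩
      intro y hy z hz
      rw [image_eq_zero_of_notMem_tsupport hy, image_eq_zero_of_notMem_tsupport hz]
      simp
  obtain ⟨C, hC⟩ := hψlip.exists_lipschitzWith_of_hasCompactSupport hψc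
  have hFint : ∀ T ⊆ U, IsCompact T → IntegrableOn (fun x => A x (gradient v x)) T :=
    fun T hT hTc => integrableOn_flux hU hA hv hTc hT
  have hmain := setIntegral_fderiv_apply_le_of_lipschitz hD
    (fun T hT => hFint T (hT.trans inter_subset_left)) h hC hψc (hψS.trans hSD)
    fun x => mul_nonneg (hη0 _) (hφ0 x)
  refine le_trans (integral_mono_ae ?_ ?_ ?_) hmain
  · refine (hφ.integrable_fderiv_flux hU hA hv).norm.restrict.mono' ?_ (ae_of_all _ fun x => ?_)
    · exact ((hη.continuous.comp_continuousOn
        (hvc.mono inter_subset_left)).aestronglyMeasurable hD.measurableSet).mul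
        (hφ.integrable_fderiv_flux hU hA hv).aestronglyMeasurable.restrict
    · rw [norm_mul, Real.norm_of_nonneg (hη0 _)]
      exact mul_le_of_le_one_left (norm_nonneg _) (hη1 _)
  · refine (IntegrableOn.clm_apply_of_bound hSc.measurableSet
      (hFint S (hSD.trans inter_subset_left) hSc) (measurable_fderiv ℝ ψ).aestronglyMeasurable
      (fun x _ => norm_fderiv_le_of_lipschitz ℝ hC) fun x hx => ?_).integrableOn
    exact image_eq_zero_of_notMem_tsupport fun hx' => hx (hψS (tsupport_fderiv_subset ℝ hx'))
  · filter_upwards [ae_restrict_mem hD.measurableSet,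
      ae_restrict_of_ae (hv.ae_differentiableAt hU)] with x hx hdiff
    have hvx := (hdiff hx.1).hasFDerivAt
    have hηx := (hη.differentiable one_ne_zero (v x)).hasDerivAt
    have hφx := (hφ.1.differentiable (by simp) x).hasFDerivAt
    have hd := ((hηx.comp_hasFDerivAt x hvx).mul hφx).fderiv
    change _ ≤ fderiv ℝ ψ x _
    have hd' : fderiv ℝ ψ x = η (v x) • fderiv ℝ φ x + φ x • deriv η (v x) • fderiv ℝ v x := hd
    rw [hd']
    simp only [add_apply, smul_apply, smul_eq_mul]
    rw [← inner_gradient_eq_fderiv v]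
    have := mul_nonneg (hφ0 x) (mul_nonneg (hmono.deriv_nonneg (x := v x))
      (hpos x hx.1 (gradient v x)))
    linarith

/-- **Remark 3.3.** If `𝓛v ≥ −M` in `B ∩ {v > 0}`, then `𝓛v⁺ ≥ −M` weakly in `B`. -/
theorem pos_part_supersolution
    {n : ℕ} (hn : 2 ≤ n)
    (A : EucSp n → (EucSp n →L[ℝ] EucSp n)) (γ lam Lam K : ℝ)
    (hγ : γ ∈ Set.Ioo (0:ℝ) 1) (hlam : 0 < lam) (hlamLam : lam ≤ Lam) (hK : 0 < K)
    (c : EucSp n) (R : ℝ) (hR : 0 < R)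
    (hell : IsElliptic A lam Lam (ball c R)) (hsym : IsSymmCoeff A (ball c R))
    (hhold : HolderSemi A γ K (ball c R))
    (M : ℝ) (hM : 0 ≤ M)
    (v : EucSp n → ℝ) (hv : LocLipOn v (ball c R))
    (hsub : WeakGe A v (fun _ => -M) (ball c R ∩ {x | 0 < v x})) :
    WeakGe A (PPart v) (fun _ => -M) (ball c R) := by
  set B := ball c R
  set D := B ∩ {x | 0 < v x}
  have hB : IsOpen B := isOpen_ball
  have hA : ContinuousOn A B := hhold.continuousOn hγ.1
  have hvc : ContinuousOn v B := hv.locallyLipschitzOn.continuousOn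
  have hD : IsOpen D := hvc.isOpen_inter_preimage hB isOpen_Ioi
  have hpos : ∀ x ∈ B, ∀ ξ, 0 ≤ ⟪A x ξ, ξ⟫ := fun x hx ξ =>
    (by positivity : 0 ≤ lam * ‖ξ‖ ^ 2).trans (hell x hx ξ).1
  have hsub' : ∀ φ, IsTest D φ → (∀ x, 0 ≤ φ x) →
      ∫ x in D, fderiv ℝ φ x (A x (gradient v x)) ≤ M * ∫ x in D, φ x := by
    intro φ hφ hφ0
    simpa only [inner_gradient_eq_fderiv, integral_const_mul, neg_mul, neg_neg, integral_neg]
      using hsub φ hφ hφ0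
  intro φ hφ hφ0
  simp only [inner_gradient_eq_fderiv, integral_const_mul, neg_mul, neg_neg, integral_neg]
  have hφint : Integrable φ := hφ.1.continuous.integrable_of_hasCompactSupport hφ.2.1
  have hfint : Integrable fun x => fderiv ℝ φ x (A x (gradient v x)) :=
    hφ.integrable_fderiv_flux hB hA hv
  have hred : ∫ x in B, fderiv ℝ φ x (A x (gradient (PPart v) x)) =
      ∫ x in D, fderiv ℝ φ x (A x (gradient v x)) := by
    rw [setIntegral_eq_of_subset_of_forall_sdiff_eq_zero hB.measurableSet
      (inter_subset_left : D ⊆ B)]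
    · refine setIntegral_congr_fun hD.measurableSet fun x hx => ?_
      simp only [gradient_PPart_of_pos (hvc.continuousAt (hB.mem_nhds hx.1)) hx.2]
    · intro x hx
      rw [gradient_PPart_of_nonpos (not_lt.1 fun h => hx.2 ⟨hx.1, h⟩), map_zero, map_zero]
  rw [hred]
  let η : ℕ → ℝ → ℝ := fun k t => Real.smoothTransition ((k + 1) * t - 1)
  have hηsmooth : ∀ k, ContDiff ℝ 1 (η k) := fun k =>
    (Real.smoothTransition.contDiff (n := 1)).comp
      ((contDiff_const.mul contDiff_id).sub contDiff_const)
  have hη0 : ∀ k t, 0 ≤ η k t := fun k t => Real.smoothTransition.nonneg _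
  have hη1 : ∀ k t, η k t ≤ 1 := fun k t => Real.smoothTransition.le_one _
  have hcut : ∀ k : ℕ, ∫ x in D, η k (v x) * fderiv ℝ φ x (A x (gradient v x)) ≤
      M * ∫ x in B, φ x := by
    intro k
    have hk : (0 : ℝ) < k + 1 := by positivity
    refine (setIntegral_cutoff_mul_fderiv_le hB hA hpos hv hsub' hφ hφ0 (hηsmooth k)
      (fun s t hst => Real.smoothTransition.monotone (by gcongr)) (hη0 k) (hη1 k)
      (ε := 1 / (k + 1)) (by positivity) fun t ht => ?_).trans ?_
    · refine Real.smoothTransition.zero_of_nonpos ?_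
      rw [le_div_iff₀ hk] at ht
      linarith
    · refine mul_le_mul_of_nonneg_left ?_ hM
      refine (integral_mono_of_nonneg (ae_of_all _ fun x => mul_nonneg (hη0 k _) (hφ0 x))
        hφint.restrict (ae_of_all _ fun x => mul_le_of_le_one_left (hφ0 x) (hη1 k _))).trans ?_
      exact setIntegral_mono_set hφint.restrict (ae_of_all _ hφ0)
        (Eventually.of_forall inter_subset_left)
  refine le_of_tendsto' (x := atTop) ?_ hcut
  refine tendsto_integral_of_dominated_convergence
    (fun x => ‖fderiv ℝ φ x (A x (gradient v x))‖) (fun k => ?_) hfint.norm.restrict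
    (fun k => ae_of_all _ fun x => ?_) ?_
  · exact (((hηsmooth k).continuous.comp_continuousOn
      (hvc.mono inter_subset_left)).aestronglyMeasurable hD.measurableSet).mul
      hfint.aestronglyMeasurable.restrict
  · rw [norm_mul, Real.norm_of_nonneg (hη0 k _)]
    exact mul_le_of_le_one_left (norm_nonneg _) (hη1 k _)
  · filter_upwards [ae_restrict_mem hD.measurableSet] with x hx
    refine tendsto_const_nhds.congr' ?_
    have hlim : Tendsto (fun k : ℕ => ((k : ℝ) + 1) * v x - 1) atTop atTop :=
      tendsto_atTop_add_const_right _ _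
        ((tendsto_natCast_atTop_atTop.atTop_add tendsto_const_nhds).atTop_mul_const hx.2)
    filter_upwards [hlim.eventually_ge_atTop 1] with k hk
    simp only [η, Real.smoothTransition.one_of_one_le hk, one_mul]
end
end
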